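/- arXiv:0803.1890 — 2 statements merged into one kernel-verified Lean document; each statement's English description precedes it below -/
import Mathlib

section
/- If condition NA1_s holds, then 𝒴_s ≠ ∅; that is, there exists an adapted càdlàg process Y with P[Y_0 = 1 and Y_t > 0 for all t ∈ [0,∞)] = 1 such that the product process Y·X is a supermartingale for every X ∈ 𝒳_s. -/
open MeasureTheory Set Filter
open scoped NNReal ENNReal Topology

noncomputable section

/-- A property of a path: right-continuous with left limits (càdlàg). -/
def IsCadlag {E : Type*} [TopologicalSpace E] (f : ℝ≥0 → E) : Prop :=
  (∀ t : ℝ≥0, ContinuousWithinAt f (Set.Ici t) t) ∧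
    ∀ t : ℝ≥0, 0 < t → ∃ l : E, Filter.Tendsto f (nhdsWithin t (Set.Iio t)) (nhds l)

/-- The `d`-dimensional simplex. -/
def stdSimplexSet (d : ℕ) : Set (Fin d → ℝ) :=
  {z | (∀ i, 0 ≤ z i) ∧ ∑ i, z i ≤ 1}

variable {Ω : Type*} {m : MeasurableSpace Ω}

/-- A simple predictable strategy: finitely many trading times `τ 0 = 0 ≤ τ 1 ≤ … ≤ τ n`
(finite stopping times), where the (random) vector `ϑ j` of numbers of units of the `d` assets
held on the interval `(τ j, τ (j+1)]` is `ℱ_{τ j}`-measurable. -/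
structure SimpleStrategy (ℱ : MeasureTheory.Filtration ℝ≥0 m) (d : ℕ) where
  n : ℕ
  τ : ℕ → Ω → ℝ≥0
  ϑ : ℕ → Ω → Fin d → ℝ
  τ_zero : ∀ ω, τ 0 ω = 0
  τ_mono : ∀ j, ∀ ω, τ j ω ≤ τ (j + 1) ω
  τ_stopping : ∀ j, MeasureTheory.IsStoppingTime ℱ (fun ω => (τ j ω : WithTop ℝ≥0))
  ϑ_meas : ∀ j, Measurable[(τ_stopping j).measurableSpace] (ϑ j)

namespace SimpleStrategy

variable {ℱ : MeasureTheory.Filtration ℝ≥0 m} {d : ℕ}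

/-- The wealth process `X^{x,θ}` associated with initial capital `x` and simple strategy `θ`. -/
def wealth (θ : SimpleStrategy ℱ d) (S : ℝ≥0 → Ω → Fin d → ℝ) (x : ℝ) (t : ℝ≥0) (ω : Ω) : ℝ :=
  x + ∑ j ∈ Finset.range θ.n, ∑ i, θ.ϑ j ω i *
    (S (min (θ.τ (j + 1) ω) t) ω i - S (min (θ.τ j ω) t) ω i)

/-- No-short-sales admissibility: all holdings are nonnegative, and the value of the held
assets never exceeds current wealth. -/
def Admissible (θ : SimpleStrategy ℱ d) (P : MeasureTheory.Measure Ω)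
    (S : ℝ≥0 → Ω → Fin d → ℝ) (x : ℝ) : Prop :=
  ∀ j < θ.n, ∀ᵐ ω ∂P, (∀ i, 0 ≤ θ.ϑ j ω i) ∧
    ∑ i, θ.ϑ j ω i * S (θ.τ j ω) ω i ≤ θ.wealth S x (θ.τ j ω) ω

end SimpleStrategy

/-- `𝒳_s(x)`: wealth processes of simple, no-short-sales strategies with initial capital `x`. -/
def Xs (P : MeasureTheory.Measure Ω) (ℱ : MeasureTheory.Filtration ℝ≥0 m) {d : ℕ}
    (S : ℝ≥0 → Ω → Fin d → ℝ) (x : ℝ) : Set (ℝ≥0 → Ω → ℝ) :=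
  {X | ∃ θ : SimpleStrategy ℱ d, θ.Admissible P S x ∧ X = θ.wealth S x}

/-- `𝒳_s = ⋃_{x ≥ 0} 𝒳_s(x)`. -/
def XsAll (P : MeasureTheory.Measure Ω) (ℱ : MeasureTheory.Filtration ℝ≥0 m) {d : ℕ}
    (S : ℝ≥0 → Ω → Fin d → ℝ) : Set (ℝ≥0 → Ω → ℝ) :=
  {X | ∃ x : ℝ, 0 ≤ x ∧ X ∈ Xs P ℱ S x}

/-- `ξ` is an arbitrage of the first kind on `[0, T]`. -/
def ArbitrageOfFirstKind (P : MeasureTheory.Measure Ω) (ℱ : MeasureTheory.Filtration ℝ≥0 m)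
    {d : ℕ} (S : ℝ≥0 → Ω → Fin d → ℝ) (T : ℝ≥0) (ξ : Ω → ℝ) : Prop :=
  Measurable[ℱ T] ξ ∧ (∀ᵐ ω ∂P, 0 ≤ ξ ω) ∧ 0 < P {ω | 0 < ξ ω} ∧
    ∀ x : ℝ, 0 < x → ∃ X ∈ Xs P ℱ S x, ∀ᵐ ω ∂P, ξ ω ≤ X T ω

/-- Condition NA1_s: no arbitrage of the first kind on any interval `[0, T]`. -/
def NA1s (P : MeasureTheory.Measure Ω) (ℱ : MeasureTheory.Filtration ℝ≥0 m) {d : ℕ}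
    (S : ℝ≥0 → Ω → Fin d → ℝ) : Prop :=
  ∀ (T : ℝ≥0) (ξ : Ω → ℝ), ¬ ArbitrageOfFirstKind P ℱ S T ξ

/-- A set of random variables is bounded in probability. -/
def BddInProb (P : MeasureTheory.Measure Ω) (C : Set (Ω → ℝ)) : Prop :=
  Filter.Tendsto (fun ℓ : ℝ => ⨆ f ∈ C, P {ω | ℓ < |f ω|}) Filter.atTop (nhds 0)

/-- The filtration is right-continuous. -/
def RightContinuousFiltration (ℱ : MeasureTheory.Filtration ℝ≥0 m) : Prop :=
  ∀ t : ℝ≥0, (ℱ t : MeasurableSpace Ω) = ⨅ (u : ℝ≥0) (_ : t < u), ℱ u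

/-- `ℱ 0` (hence every `ℱ t`) contains all `P`-null sets. -/
def CompleteFiltration (ℱ : MeasureTheory.Filtration ℝ≥0 m) (P : MeasureTheory.Measure Ω) : Prop :=
  ∀ N : Set Ω, MeasurableSet N → P N = 0 → MeasurableSet[ℱ 0] N

/-- The (first) bankruptcy time `ζ^X` of a process `X`, valued in `ℝ≥0∞`. -/
def bankruptcyTime (X : ℝ≥0 → Ω → ℝ) (ω : Ω) : ℝ≥0∞ :=
  sInf ((fun t : ℝ≥0 => (t : ℝ≥0∞)) ''
    {t : ℝ≥0 | Function.leftLim (fun s => X s ω) t = 0 ∨ X t ω = 0})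

/-- `X` cannot revive from bankruptcy: a.s., `X_t = 0` for all `t ≥ ζ^X` on `{ζ^X < ∞}`. -/
def CannotRevive (P : MeasureTheory.Measure Ω) (X : ℝ≥0 → Ω → ℝ) : Prop :=
  ∀ᵐ ω ∂P, ∀ t : ℝ≥0, bankruptcyTime X ω ≤ (t : ℝ≥0∞) → X t ω = 0

/-- `𝒴_s`: strictly positive supermartingale deflators for simple, no-short-sales trading. -/
def Ys (P : MeasureTheory.Measure Ω) (ℱ : MeasureTheory.Filtration ℝ≥0 m) {d : ℕ}
    (S : ℝ≥0 → Ω → Fin d → ℝ) : Set (ℝ≥0 → Ω → ℝ) :=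
  {Y | MeasureTheory.StronglyAdapted ℱ Y ∧ (∀ ω, IsCadlag (fun t => Y t ω)) ∧
    (∀ᵐ ω ∂P, Y 0 ω = 1 ∧ ∀ t : ℝ≥0, 0 < Y t ω) ∧
    ∀ X ∈ XsAll P ℱ S, MeasureTheory.Supermartingale (fun t ω => Y t ω * X t ω) ℱ P}

noncomputable section
open MeasureTheory Set Filter
open scoped NNReal ENNReal Topology

theorem NA_exists_weight {Ω : Type*} {m : MeasurableSpace Ω} (P : Measure Ω)
    [IsProbabilityMeasure P] (C : Set (Ω → ℝ≥0)) (hne : C.Nonempty)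
    (hmeas : ∀ h ∈ C, Measurable h)
    (hconv : ∀ h ∈ C, ∀ h' ∈ C, ∀ a b : ℝ≥0, a + b = 1 → (fun ω => a * h ω + b * h' ω) ∈ C)
    (hNA : ∀ B, MeasurableSet B → (∀ n : ℕ, ∃ h ∈ C, ∀ ω ∈ B, (n : ℝ≥0) ≤ h ω) → P B = 0) :
    ∃ g : Ω → ℝ≥0, Measurable g ∧ (∀ ω, 0 < g ω) ∧
      ∀ h ∈ C, ∫⁻ ω, (g ω : ℝ≥0∞) * h ω ∂P ≤ 1 := by
  classical
  let u : (Ω → ℝ≥0) → Ω → ℝ := fun h ω => (1 + (h ω : ℝ))⁻¹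
  have hu_pos : ∀ h ω, 0 < u h ω := fun h ω => by positivity
  have hu_le : ∀ h ω, u h ω ≤ 1 := fun h ω => by
    apply inv_le_one_of_one_le₀
    have := (h ω).coe_nonneg
    linarith
  have hu_meas : ∀ h ∈ C, Measurable (u h) := fun h hh => by
    have := hmeas h hh
    fun_prop
  have hu_int : ∀ h ∈ C, Integrable (u h) P := fun h hh =>
    Integrable.of_bound (hu_meas h hh).aestronglyMeasurable 1
      (Eventually.of_forall fun ω => by
        rw [Real.norm_eq_abs, abs_of_pos (hu_pos h ω)]; exact hu_le h ω)
  let E : (Ω → ℝ≥0) → ℝ := fun h => ∫ ω, u h ω ∂P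
  let I : ℝ := sInf (E '' C)
  have hI_le : ∀ h ∈ C, I ≤ E h := fun h hh =>
    csInf_le ⟨0, by rintro _ ⟨k, _, rfl⟩; exact integral_nonneg fun ω => (hu_pos k ω).le⟩
      ⟨h, hh, rfl⟩
  have hex : ∀ n : ℕ, ∃ f ∈ C, E f < I + (1 / 16) ^ n := fun n => by
    obtain ⟨_, ⟨f, hf, rfl⟩, h2⟩ := exists_lt_of_csInf_lt (hne.image E)
      (show sInf (E '' C) < I + (1 / 16) ^ n from lt_add_of_pos_right _ (by positivity))
    exact ⟨f, hf, h2⟩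
  choose f hfC hfE using hex
  -- one step of the Cauchy estimate
  have hdiff : ∀ n, ∫ ω, (u (f n) ω - u (f (n + 1)) ω) ^ 2 ∂P ≤ 4 * (1 / 16) ^ n := by
    intro n
    let w : Ω → ℝ≥0 := fun ω => (1 / 2) * f n ω + (1 / 2) * f (n + 1) ω
    have hw : w ∈ C := hconv _ (hfC n) _ (hfC (n + 1)) _ _ (by rw [← add_div]; norm_num)
    have hpt : ∀ ω, (u (f n) ω - u (f (n + 1)) ω) ^ 2 ≤
        2 * u (f n) ω + 2 * u (f (n + 1)) ω - 4 * u w ω := by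
      intro ω
      have hx := (f n ω).coe_nonneg
      have hy := (f (n + 1) ω).coe_nonneg
      simp only [u, w]
      push_cast
      generalize (f n ω : ℝ) = x at *
      generalize (f (n + 1) ω : ℝ) = y at *
      have key : 2 * (1 + x)⁻¹ + 2 * (1 + y)⁻¹ - 4 * (1 + (1 / 2 * x + 1 / 2 * y))⁻¹
          - ((1 + x)⁻¹ - (1 + y)⁻¹) ^ 2 =
          (x - y) ^ 2 * (2 * (1 + x) * (1 + y) - (2 + x + y)) /
            ((1 + x) ^ 2 * (1 + y) ^ 2 * (2 + x + y)) := by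
        have h1 : (1 + (1 / 2 * x + 1 / 2 * y)) = (2 + x + y) / 2 := by ring
        rw [h1]
        have : 2 + x + y ≠ 0 := by positivity
        field_simp
        ring
      have : 0 ≤ (x - y) ^ 2 * (2 * (1 + x) * (1 + y) - (2 + x + y)) /
            ((1 + x) ^ 2 * (1 + y) ^ 2 * (2 + x + y)) := by
        apply div_nonneg _ (by positivity)
        apply mul_nonneg (sq_nonneg _)
        nlinarith [mul_nonneg hx hy]
      linarith
    have hsub : Integrable (fun ω => 2 * u (f n) ω + 2 * u (f (n + 1)) ω - 4 * u w ω) P :=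
      (((hu_int _ (hfC n)).const_mul 2).add ((hu_int _ (hfC (n + 1))).const_mul 2)).sub
        ((hu_int _ hw).const_mul 4)
    calc ∫ ω, (u (f n) ω - u (f (n + 1)) ω) ^ 2 ∂P
        ≤ ∫ ω, (2 * u (f n) ω + 2 * u (f (n + 1)) ω - 4 * u w ω) ∂P :=
          integral_mono_of_nonneg (Eventually.of_forall fun ω => sq_nonneg _) hsub
            (Eventually.of_forall hpt)
      _ = 2 * E (f n) + 2 * E (f (n + 1)) - 4 * E w := by
          have hadd : Integrable (fun ω => 2 * u (f n) ω + 2 * u (f (n + 1)) ω) P :=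
            ((hu_int _ (hfC n)).const_mul 2).add ((hu_int _ (hfC (n + 1))).const_mul 2)
          rw [integral_sub hadd ((hu_int _ hw).const_mul 4),
            integral_add ((hu_int _ (hfC n)).const_mul 2) ((hu_int _ (hfC (n + 1))).const_mul 2),
            integral_const_mul, integral_const_mul, integral_const_mul]
      _ ≤ 4 * (1 / 16) ^ n := by
          have h1 := hfE n
          have h2 := hfE (n + 1)
          have h3 := hI_le w hw
          have h4 : ((1 : ℝ) / 16) ^ (n + 1) ≤ (1 / 16) ^ n := by
            rw [pow_succ]
            have : (0 : ℝ) < (1 / 16) ^ n := by positivity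
            linarith
          linarith
  have hlint : ∀ n, ∫⁻ ω, edist (u (f n) ω) (u (f (n + 1)) ω) ∂P ≤
      ENNReal.ofReal (5 * (1 / 2) ^ n) := by
    intro n
    have hpt : ∀ ω, |u (f n) ω - u (f (n + 1)) ω| ≤
        (1 / 2) ^ n + 2 ^ n * (u (f n) ω - u (f (n + 1)) ω) ^ 2 := by
      intro ω
      generalize u (f n) ω - u (f (n + 1)) ω = x
      have hc : (0 : ℝ) < 2 ^ n := by positivity
      have h2 : ((1 : ℝ) / 2) ^ n * 2 ^ n = 1 := by rw [← mul_pow]; norm_num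
      rw [← sq_abs]
      have h3 := sq_nonneg ((2 : ℝ) ^ n * |x| - 1)
      have h0 := abs_nonneg x
      have : 2 ^ n * |x| ≤ 2 ^ n * ((1 / 2) ^ n + 2 ^ n * |x| ^ 2) := by nlinarith
      exact le_of_mul_le_mul_left this hc
    have hi1 : Integrable (fun ω => (u (f n) ω - u (f (n + 1)) ω) ^ 2) P := by
      refine Integrable.of_bound (((hu_meas _ (hfC n)).sub
        (hu_meas _ (hfC (n + 1)))).pow_const 2).aestronglyMeasurable 1
        (Eventually.of_forall fun ω => ?_)
      rw [Real.norm_eq_abs, abs_of_nonneg (sq_nonneg _), sq_le_one_iff_abs_le_one, abs_le]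
      have := hu_pos (f n) ω; have := hu_pos (f (n+1)) ω
      have := hu_le (f n) ω; have := hu_le (f (n+1)) ω
      constructor <;> linarith
    calc ∫⁻ ω, edist (u (f n) ω) (u (f (n + 1)) ω) ∂P
        ≤ ∫⁻ ω, ENNReal.ofReal ((1 / 2) ^ n + 2 ^ n * (u (f n) ω - u (f (n + 1)) ω) ^ 2) ∂P := by
          apply lintegral_mono
          intro ω
          dsimp only
          rw [edist_dist, Real.dist_eq]
          exact ENNReal.ofReal_le_ofReal (hpt ω)
      _ = ENNReal.ofReal (∫ ω, ((1 / 2) ^ n + 2 ^ n * (u (f n) ω - u (f (n + 1)) ω) ^ 2) ∂P) := by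
          rw [ofReal_integral_eq_lintegral_ofReal]
          · exact (integrable_const _).add (hi1.const_mul _)
          · exact Eventually.of_forall fun ω => by positivity
      _ ≤ ENNReal.ofReal (5 * (1 / 2) ^ n) := by
          apply ENNReal.ofReal_le_ofReal
          rw [integral_add (integrable_const _) (hi1.const_mul _), integral_const,
            integral_const_mul]
          have h1 := mul_le_mul_of_nonneg_left (hdiff n) (show (0 : ℝ) ≤ 2 ^ n by positivity)
          have h2 : (2 : ℝ) ^ n * (4 * (1 / 16) ^ n) = 4 * (1 / 8) ^ n := by
            rw [mul_left_comm, ← mul_pow]; norm_num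
          have h3 : ((1 : ℝ) / 8) ^ n ≤ (1 / 2) ^ n :=
            pow_le_pow_left₀ (by norm_num) (by norm_num) n
          simp only [probReal_univ, smul_eq_mul, one_mul]
          linarith
  have hcauchy : ∀ᵐ ω ∂P, ∃ l, Tendsto (fun n => u (f n) ω) atTop (𝓝 l) := by
    have hm : ∀ n, Measurable fun ω => edist (u (f n) ω) (u (f (n + 1)) ω) := fun n =>
      (hu_meas _ (hfC n)).edist (hu_meas _ (hfC (n + 1)))
    have hsum : ∫⁻ ω, ∑' n, edist (u (f n) ω) (u (f (n + 1)) ω) ∂P ≠ ∞ := by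
      rw [lintegral_tsum fun n => (hm n).aemeasurable]
      refine ne_top_of_le_ne_top ?_ (ENNReal.tsum_le_tsum hlint)
      apply Summable.tsum_ofReal_ne_top
      exact (summable_geometric_of_lt_one (by norm_num) (by norm_num)).mul_left 5
    filter_upwards [ae_lt_top (Measurable.tsum hm) hsum] with ω hω
    exact cauchySeq_tendsto_of_complete
      (cauchySeq_of_edist_le_of_tsum_ne_top _ (fun n => le_rfl) hω.ne)
  obtain ⟨v, hv_meas, hv⟩ := measurable_limit_of_tendsto_metrizable_ae
    (fun n => (hu_meas _ (hfC n)).aemeasurable) hcauchy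
  have hv_nonneg : ∀ᵐ ω ∂P, 0 ≤ v ω := by
    filter_upwards [hv] with ω hω
    exact ge_of_tendsto' hω fun n => (hu_pos _ ω).le
  -- positivity of the limit
  have hv_pos : ∀ᵐ ω ∂P, 0 < v ω := by
    have hB : MeasurableSet {ω | v ω ≤ 0} := hv_meas measurableSet_Iic
    have : P {ω | v ω ≤ 0} = 0 := by
      by_contra hne0
      have hpos : 0 < (P {ω | v ω ≤ 0}).toReal :=
        ENNReal.toReal_pos hne0 (measure_ne_top _ _)
      obtain ⟨t, ht, htP, htu⟩ := tendstoUniformlyOn_of_ae_tendsto'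
        (fun n => (hu_meas _ (hfC n)).stronglyMeasurable) hv_meas.stronglyMeasurable hv
        (half_pos hpos)
      have h0 := hNA ({ω | v ω ≤ 0} \ t) (hB.diff ht) (by
        intro n
        rw [Metric.tendstoUniformlyOn_iff] at htu
        obtain ⟨k, hk⟩ := (htu (1 / (n + 1)) (by positivity)).exists
        refine ⟨f k, hfC k, fun ω hω => ?_⟩
        have h1 := hk ω hω.2
        rw [Real.dist_eq] at h1
        have h2 := (abs_lt.1 h1).1
        have h3 : v ω ≤ 0 := hω.1
        have h4 : u (f k) ω < 1 / (n + 1) := by linarith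
        simp only [u] at h4
        rw [inv_lt_comm₀ (by positivity) (by positivity)] at h4
        simp only [one_div, inv_inv] at h4
        have : (n : ℝ) ≤ (f k ω : ℝ) := by linarith
        exact_mod_cast this)
      have h1 : P {ω | v ω ≤ 0} ≤ ENNReal.ofReal ((P {ω | v ω ≤ 0}).toReal / 2) := by
        calc P {ω | v ω ≤ 0} ≤ P (({ω | v ω ≤ 0} \ t) ∪ t) :=
              measure_mono (by intro ω hω; by_cases h : ω ∈ t <;> simp_all)
          _ ≤ P ({ω | v ω ≤ 0} \ t) + P t := measure_union_le _ _
          _ ≤ _ := by rw [h0, zero_add]; exact htP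
      have h2 := ENNReal.toReal_mono ENNReal.ofReal_ne_top h1
      rw [ENNReal.toReal_ofReal (by positivity)] at h2
      linarith
    filter_upwards [measure_eq_zero_iff_ae_notMem.1 this] with ω hω
    simpa using hω
  refine ⟨fun ω => if 0 < v ω then (v ω).toNNReal ^ 2 else 1, ?_, ?_, ?_⟩
  · exact Measurable.ite (hv_meas measurableSet_Ioi) (hv_meas.real_toNNReal.pow_const 2)
      measurable_const
  · intro ω
    dsimp only
    split_ifs with h
    · have : 0 < (v ω).toNNReal := Real.toNNReal_pos.2 h
      positivity
    · exact one_pos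
  intro h hh
  -- first order condition
  let a : ℕ → ℝ≥0 := fun n => (1 / 2) ^ n
  have ha_le : ∀ n, a n ≤ 1 := fun n => pow_le_one₀ (by simp) (by
    rw [div_le_iff₀ (by norm_num)]; norm_num)
  let w : ℕ → Ω → ℝ≥0 := fun n ω => (1 - a n) * f n ω + a n * h ω
  have hwC : ∀ n, w n ∈ C := fun n =>
    hconv _ (hfC n) _ hh _ _ (tsub_add_cancel_of_le (ha_le n))
  have hwcoe : ∀ n ω, (w n ω : ℝ) = (1 - (1 / 2) ^ n) * f n ω + (1 / 2) ^ n * h ω := by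
    intro n ω
    simp only [w]
    rw [NNReal.coe_add, NNReal.coe_mul, NNReal.coe_sub (ha_le n)]
    simp [a]
  have hfo : ∀ n, ∫⁻ ω, ENNReal.ofReal (h ω * u (f n) ω * u (w n) ω) ∂P ≤
      ENNReal.ofReal (1 + (1 / 8) ^ n) := by
    intro n
    have hid : ∀ ω, h ω * u (f n) ω * u (w n) ω =
        f n ω * u (f n) ω * u (w n) ω + 2 ^ n * (u (f n) ω - u (w n) ω) := by
      intro ω
      have e1 : u (f n) ω - u (w n) ω =
          ((w n ω : ℝ) - f n ω) * (u (f n) ω * u (w n) ω) := by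
        have h1 : (1 + (f n ω : ℝ)) ≠ 0 := by positivity
        have h2 : (1 + (w n ω : ℝ)) ≠ 0 := by positivity
        simp only [u]
        field_simp
        ring
      have e2 : (w n ω : ℝ) - f n ω = (1 / 2) ^ n * (h ω - f n ω) := by
        rw [hwcoe]; ring
      have h2 : (2 : ℝ) ^ n * (1 / 2) ^ n = 1 := by rw [← mul_pow]; norm_num
      rw [e1, e2]
      linear_combination (-(h ω - f n ω) * (u (f n) ω * u (w n) ω)) * h2
    have hle : ∀ ω, h ω * u (f n) ω * u (w n) ω ≤
        1 + 2 ^ n * (u (f n) ω - u (w n) ω) := by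
      intro ω
      rw [hid]
      have : f n ω * u (f n) ω ≤ 1 := by
        simp only [u]
        rw [← div_eq_mul_inv, div_le_one (by positivity)]
        linarith
      have h3 : f n ω * u (f n) ω * u (w n) ω ≤ 1 :=
        mul_le_one₀ this (hu_pos _ _).le (hu_le _ _)
      linarith
    have hnn : ∀ ω, 0 ≤ h ω * u (f n) ω * u (w n) ω := fun ω => by
      have := hu_pos (f n) ω; have := hu_pos (w n) ω; positivity
    have hri : Integrable (fun ω => 1 + 2 ^ n * (u (f n) ω - u (w n) ω)) P :=
      (integrable_const _).add (((hu_int _ (hfC n)).sub (hu_int _ (hwC n))).const_mul _)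
    calc ∫⁻ ω, ENNReal.ofReal (h ω * u (f n) ω * u (w n) ω) ∂P
        ≤ ∫⁻ ω, ENNReal.ofReal (1 + 2 ^ n * (u (f n) ω - u (w n) ω)) ∂P :=
          lintegral_mono fun ω => ENNReal.ofReal_le_ofReal (hle ω)
      _ = ENNReal.ofReal (∫ ω, (1 + 2 ^ n * (u (f n) ω - u (w n) ω)) ∂P) := by
          rw [ofReal_integral_eq_lintegral_ofReal hri]
          exact Eventually.of_forall fun ω => (hnn ω).trans (hle ω)
      _ ≤ _ := by
          apply ENNReal.ofReal_le_ofReal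
          have e := integral_sub (hu_int _ (hfC n)) (hu_int _ (hwC n))
          have hsub : Integrable (fun ω => (2 : ℝ) ^ n * (u (f n) ω - u (w n) ω)) P :=
            ((hu_int _ (hfC n)).sub (hu_int _ (hwC n))).const_mul _
          rw [integral_add (integrable_const _) hsub, integral_const,
            integral_const_mul, e]
          have h1 := hfE n
          have h2 := hI_le _ (hwC n)
          have h3 : E (f n) - E (w n) ≤ (1 / 16) ^ n := by linarith
          have h4 := mul_le_mul_of_nonneg_left h3 (show (0 : ℝ) ≤ 2 ^ n by positivity)
          have h5 : (2 : ℝ) ^ n * (1 / 16) ^ n = (1 / 8) ^ n := by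
            rw [← mul_pow]; norm_num
          simp only [probReal_univ, smul_eq_mul, one_mul]
          rw [h5] at h4
          exact add_le_add le_rfl h4
  have hlim : ∀ᵐ ω ∂P, Tendsto (fun n => ENNReal.ofReal (h ω * u (f n) ω * u (w n) ω)) atTop
      (𝓝 (ENNReal.ofReal (h ω * v ω * v ω))) := by
    filter_upwards [hv, hv_pos] with ω hω hωp
    refine ENNReal.tendsto_ofReal ((hω.const_mul _).mul ?_)
    have h1 : Tendsto (fun n => (u (f n) ω)⁻¹) atTop (𝓝 (v ω)⁻¹) := hω.inv₀ hωp.ne'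
    have h2 : Tendsto (fun n : ℕ => ((1 : ℝ) / 2) ^ n) atTop (𝓝 0) :=
      tendsto_pow_atTop_nhds_zero_of_lt_one (by norm_num) (by norm_num)
    have h3 : Tendsto (fun n : ℕ => (1 - ((1 : ℝ) / 2) ^ n) * (u (f n) ω)⁻¹ +
        (1 / 2) ^ n * (1 + h ω)) atTop (𝓝 ((1 - 0) * (v ω)⁻¹ + 0 * (1 + h ω))) :=
      ((h2.const_sub 1).mul h1).add (h2.mul_const _)
    have h4 : ∀ n, (u (w n) ω)⁻¹ =
        (1 - ((1 : ℝ) / 2) ^ n) * (u (f n) ω)⁻¹ + (1 / 2) ^ n * (1 + h ω) := by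
      intro n
      simp only [u, inv_inv]
      rw [hwcoe]; ring
    simp only [sub_zero, one_mul, zero_mul, add_zero, ← h4] at h3
    have h5 := h3.inv₀ (inv_ne_zero hωp.ne')
    simpa only [inv_inv] using h5
  calc ∫⁻ ω, ((if 0 < v ω then (v ω).toNNReal ^ 2 else 1 : ℝ≥0) : ℝ≥0∞) * h ω ∂P
      = ∫⁻ ω, liminf (fun n => ENNReal.ofReal (h ω * u (f n) ω * u (w n) ω)) atTop ∂P := by
        apply lintegral_congr_ae
        filter_upwards [hlim, hv_pos] with ω hω hωp
        rw [hω.liminf_eq, if_pos hωp, mul_assoc, ENNReal.ofReal_mul (NNReal.coe_nonneg _),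
          ENNReal.ofReal_coe_nnreal, mul_comm, ENNReal.coe_pow, ← pow_two,
          ENNReal.ofReal_pow hωp.le]
        rfl
    _ ≤ liminf (fun n => ∫⁻ ω, ENNReal.ofReal (h ω * u (f n) ω * u (w n) ω) ∂P) atTop := by
        apply lintegral_liminf_le
        intro n
        have := hu_meas _ (hfC n); have := hu_meas _ (hwC n); have := hmeas _ hh
        fun_prop
    _ ≤ liminf (fun n : ℕ => ENNReal.ofReal (1 + (1 / 8) ^ n)) atTop :=
        liminf_le_liminf (Eventually.of_forall hfo)
    _ = 1 := by
        have : Tendsto (fun n : ℕ => ENNReal.ofReal (1 + (1 / 8) ^ n)) atTop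
            (𝓝 (ENNReal.ofReal (1 + 0))) :=
          ENNReal.tendsto_ofReal ((tendsto_pow_atTop_nhds_zero_of_lt_one (by norm_num)
            (by norm_num)).const_add 1)
        rw [this.liminf_eq]; simp

end

noncomputable section
open MeasureTheory Set Filter
open scoped NNReal ENNReal Topology

/-- `V` represents `k` with respect to the sub-σ-algebra `m0`. -/
def NARep {Ω : Type*} (m0 : MeasurableSpace Ω) {m : MeasurableSpace Ω} (P : Measure Ω)
    (V k : Ω → ℝ≥0∞) : Prop :=
  Measurable[m0] V ∧ ∀ W : Ω → ℝ≥0∞, Measurable[m0] W →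
    ∫⁻ ω, W ω * V ω ∂P = ∫⁻ ω, W ω * k ω ∂P

theorem NARep_of_sets {Ω : Type*} {m0 m : MeasurableSpace Ω} (hm : m0 ≤ m) (P : Measure Ω)
    {V k : Ω → ℝ≥0∞} (hV : Measurable[m0] V) (hk : Measurable k)
    (h : ∀ A, MeasurableSet[m0] A → ∫⁻ ω in A, V ω ∂P = ∫⁻ ω in A, k ω ∂P) :
    NARep m0 P V k := by
  refine ⟨hV, fun W hW => ?_⟩
  have hV' : Measurable V := hV.mono hm le_rfl
  have hW' : Measurable W := hW.mono hm le_rfl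
  have e : (P.withDensity V).trim hm = (P.withDensity k).trim hm := by
    refine @Measure.ext _ m0 _ _ fun A hA => ?_
    rw [trim_measurableSet_eq hm hA, trim_measurableSet_eq hm hA,
      withDensity_apply _ (hm _ hA), withDensity_apply _ (hm _ hA), h A hA]
  calc ∫⁻ ω, W ω * V ω ∂P = ∫⁻ ω, W ω ∂(P.withDensity V) := by
        rw [lintegral_withDensity_eq_lintegral_mul _ hV' hW']
        simp only [Pi.mul_apply, mul_comm]
    _ = ∫⁻ ω, W ω ∂(P.withDensity k) := by
        rw [← lintegral_trim hm hW, e, lintegral_trim hm hW]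
    _ = _ := by
        rw [lintegral_withDensity_eq_lintegral_mul _ hk hW']
        simp only [Pi.mul_apply, mul_comm]

theorem NA_esssup {Ω : Type*} {m0 m : MeasurableSpace Ω} (hm : m0 ≤ m) (P : Measure Ω)
    [IsProbabilityMeasure P] (H : Set (Ω → ℝ≥0∞)) (hne : H.Nonempty)
    (hmeas : ∀ k ∈ H, Measurable k)
    (hmix : ∀ k ∈ H, ∀ k' ∈ H, ∀ A, MeasurableSet[m0] A →
      (fun ω => A.indicator k ω + Aᶜ.indicator k' ω) ∈ H)
    (hb : ∀ k ∈ H, ∫⁻ ω, k ω ∂P ≤ 1) :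
    ∃ V : Ω → ℝ≥0∞, Measurable[m0] V ∧ ∫⁻ ω, V ω ∂P ≤ 1 ∧
      (∀ k ∈ H, ∀ W : Ω → ℝ≥0∞, Measurable[m0] W →
        ∫⁻ ω, W ω * k ω ∂P ≤ ∫⁻ ω, W ω * V ω ∂P) ∧
      ∀ W : Ω → ℝ≥0∞, Measurable[m0] W → ∀ c, (∀ k ∈ H, ∫⁻ ω, W ω * k ω ∂P ≤ c) →
        ∫⁻ ω, W ω * V ω ∂P ≤ c := by
  classical
  have hrep : ∀ k ∈ H, ∃ V, NARep m0 P V k := fun k hk =>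
    ⟨P⁻[k|m0], NARep_of_sets hm P (measurable_condLExp _ _ _) (hmeas k hk)
      fun A hA => setLIntegral_condLExp hm P k hA⟩
  let VV : Set (Ω → ℝ≥0∞) := {V | ∃ k ∈ H, NARep m0 P V k}
  have hmax : ∀ V ∈ VV, ∀ V' ∈ VV, V ⊔ V' ∈ VV := by
    rintro V ⟨k, hk, hV⟩ V' ⟨k', hk', hV'⟩
    have hA : MeasurableSet[m0] {ω | V' ω ≤ V ω} := measurableSet_le hV'.1 hV.1
    refine ⟨_, hmix k hk k' hk' _ hA, hV.1.sup hV'.1, fun W hW => ?_⟩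
    set A := {ω | V' ω ≤ V ω}
    have e1 : ∀ ω, W ω * (V ⊔ V') ω =
        A.indicator W ω * V ω + Aᶜ.indicator W ω * V' ω := by
      intro ω
      by_cases h : ω ∈ A
      · have : V' ω ≤ V ω := h
        simp [h, this]
      · have : V ω ≤ V' ω := (not_le.1 h).le
        simp [h, this]
    have e2 : ∀ ω, W ω * (A.indicator k ω + Aᶜ.indicator k' ω) =
        A.indicator W ω * k ω + Aᶜ.indicator W ω * k' ω := by
      intro ω
      by_cases h : ω ∈ A <;> simp [h]
    have hW1 : Measurable[m0] (A.indicator W) := hW.indicator hA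
    have hW2 : Measurable[m0] (Aᶜ.indicator W) := hW.indicator hA.compl
    simp_rw [e1, e2]
    have m1 : Measurable (fun ω => A.indicator W ω * V ω) :=
      (hW1.mono hm le_rfl).mul (hV.1.mono hm le_rfl)
    have m2 : Measurable (fun ω => A.indicator W ω * k ω) :=
      (hW1.mono hm le_rfl).mul (hmeas k hk)
    rw [lintegral_add_left m1, lintegral_add_left m2, hV.2 _ hW1, hV'.2 _ hW2]
  have hVVb : ∀ V ∈ VV, ∫⁻ ω, V ω ∂P ≤ 1 := by
    rintro V ⟨k, hk, hV⟩
    have := hV.2 (fun _ => 1) measurable_const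
    simp only [one_mul] at this
    rw [this]; exact hb k hk
  have hVVne : VV.Nonempty := by
    obtain ⟨k, hk⟩ := hne
    obtain ⟨V, hV⟩ := hrep k hk
    exact ⟨V, k, hk, hV⟩
  have hVVm : ∀ V ∈ VV, Measurable[m0] V := by
    rintro V ⟨k, hk, hV⟩
    exact hV.1
  let J : (Ω → ℝ≥0∞) → ℝ≥0∞ := fun V => ∫⁻ ω, V ω ∂P
  obtain ⟨s, hs_mono, hs_tend, hs_mem⟩ := exists_seq_tendsto_sSup (hVVne.image J) (OrderTop.bddAbove _)
  choose V0 hV0 hV0s using hs_mem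
  have hpart : ∀ n, partialSups V0 n ∈ VV := by
    intro n
    induction n with
    | zero => simpa using hV0 0
    | succ n ih => rw [partialSups_add_one]; exact hmax _ ih _ (hV0 _)
  let V : Ω → ℝ≥0∞ := fun ω => ⨆ n, partialSups V0 n ω
  have hpm : ∀ n, Measurable (partialSups V0 n) := fun n => (hVVm _ (hpart n)).mono hm le_rfl
  have hVm : Measurable[m0] V := Measurable.iSup fun n => hVVm _ (hpart n)
  have hmono : Monotone (partialSups V0) := (partialSups V0).monotone
  have hJV : J V = sSup (J '' VV) := by
    have e : J V = ⨆ n, J (partialSups V0 n) := lintegral_iSup hpm hmono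
    apply le_antisymm
    · rw [e]
      exact iSup_le fun n => le_sSup ⟨_, hpart n, rfl⟩
    · refine le_of_tendsto' hs_tend fun n => ?_
      rw [← hV0s n]
      exact lintegral_mono fun ω => (le_partialSups V0 n ω).trans
        (le_iSup (fun n => partialSups V0 n ω) n)
  have hJ1 : J V ≤ 1 := by
    rw [hJV]; exact sSup_le (by rintro _ ⟨v, hv, rfl⟩; exact hVVb v hv)
  refine ⟨V, hVm, hJ1, ?_, ?_⟩
  · intro k hk W hW
    obtain ⟨v, hv⟩ := hrep k hk
    have hvV : v ∈ VV := ⟨k, hk, hv⟩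
    have hle : ∀ᵐ ω ∂P, v ω ≤ V ω := by
      have h1 : J (fun ω => ⨆ n, (partialSups V0 n ⊔ v) ω) ≤ J V := by
        have e : J (fun ω => ⨆ n, (partialSups V0 n ⊔ v) ω) =
            ⨆ n, J (partialSups V0 n ⊔ v) := lintegral_iSup
              (fun n => (hpm n).sup (hv.1.mono hm le_rfl))
              (fun a b hab => sup_le_sup_right (hmono hab) v)
        rw [e, hJV]
        exact iSup_le fun n => le_sSup ⟨_, hmax _ (hpart n) _ hvV, rfl⟩
      have h2 : ∀ ω, V ω ≤ ⨆ n, (partialSups V0 n ⊔ v) ω := fun ω =>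
        iSup_mono fun n => le_sup_left
      have h3 : AEMeasurable (fun ω => ⨆ n, (partialSups V0 n ⊔ v) ω) P :=
        (Measurable.iSup fun n => (hpm n).sup (hv.1.mono hm le_rfl)).aemeasurable
      have h4 := ae_eq_of_ae_le_of_lintegral_le (Eventually.of_forall h2)
        (ne_top_of_le_ne_top ENNReal.one_ne_top hJ1) h3 h1
      filter_upwards [h4] with ω hω
      rw [hω]
      exact le_sup_right.trans (le_iSup (fun n => (partialSups V0 n ⊔ v) ω) 0)
    rw [← hv.2 W hW]
    apply lintegral_mono_ae
    filter_upwards [hle] with ω hω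
    gcongr
  · intro W hW c hc
    have e : ∫⁻ ω, W ω * V ω ∂P = ⨆ n, ∫⁻ ω, W ω * partialSups V0 n ω ∂P := by
      have hmm : ∀ n, Measurable (fun ω => W ω * partialSups V0 n ω) :=
        fun n => (hW.mono hm le_rfl).mul (hpm n)
      have hmn : Monotone (fun n ω => W ω * partialSups V0 n ω) :=
        fun a b hab ω => mul_le_mul' le_rfl (hmono hab ω)
      rw [← lintegral_iSup hmm hmn]
      simp only [V, ENNReal.mul_iSup]
    rw [e]
    refine iSup_le fun n => ?_
    obtain ⟨k, hk, hV⟩ := hpart n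
    rw [hV.2 W hW]
    exact hc k hk

end

noncomputable section
open MeasureTheory Set Filter
open scoped NNReal ENNReal Topology

/-- Dyadic time `l / 2 ^ N`. -/
def NAdt (N l : ℕ) : ℝ≥0 := (l : ℝ≥0) / 2 ^ N

theorem NAdt_mono (N : ℕ) {l l' : ℕ} (h : l ≤ l') : NAdt N l ≤ NAdt N l' := by
  unfold NAdt; gcongr

theorem NAdt_inj {N l l' : ℕ} (h : NAdt N l = NAdt N l') : l = l' := by
  unfold NAdt at h
  have h2 : (2 : ℝ≥0) ^ N ≠ 0 := by positivity
  rw [div_left_inj' h2] at h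
  exact_mod_cast h

theorem NAdt_le_iff {N l l' : ℕ} : NAdt N l ≤ NAdt N l' ↔ l ≤ l' := by
  unfold NAdt
  rw [div_le_div_iff_of_pos_right (by positivity)]
  exact_mod_cast Iff.rfl

theorem NAdt_refine (N M l : ℕ) : NAdt (N + M) (l * 2 ^ M) = NAdt N l := by
  unfold NAdt
  rw [pow_add]; push_cast
  rw [mul_div_mul_right]; positivity

theorem NAdt_div_le (N M l : ℕ) : NAdt N (l / 2 ^ M) ≤ NAdt (N + M) l := by
  rw [← NAdt_refine N M]
  exact NAdt_mono _ (Nat.div_mul_le_self _ _)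

/-- `h` at level-`N` grid index `k` is the wealth reachable by simple trading from `f` at index
`j`. -/
def NAReach {Ω : Type*} {m : MeasurableSpace Ω} (ℱ : Filtration ℝ≥0 m) {ι : Type*} [Fintype ι]
    (B : ℝ≥0 → ι → Ω → ℝ≥0) (N j k : ℕ) (f h : Ω → ℝ≥0) : Prop :=
  j ≤ k ∧ ∃ θ : ℕ → ι → Ω → ℝ≥0, (∀ l, j ≤ l → ∀ i, Measurable[ℱ (NAdt N l)] (θ l i)) ∧
    (∀ ω, f ω = ∑ i, θ j i ω * B (NAdt N j) i ω) ∧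
    (∀ ω, h ω = ∑ i, θ k i ω * B (NAdt N k) i ω) ∧
    ∀ l, j ≤ l → l < k → ∀ ω, ∑ i, θ l i ω * B (NAdt N (l + 1)) i ω =
      ∑ i, θ (l + 1) i ω * B (NAdt N (l + 1)) i ω

section
variable {Ω : Type*} {m : MeasurableSpace Ω} {ℱ : Filtration ℝ≥0 m} {ι : Type*} [Fintype ι]
    {B : ℝ≥0 → ι → Ω → ℝ≥0}

theorem NAReach.refine {N j k : ℕ} {f h : Ω → ℝ≥0} (H : NAReach ℱ B N j k f h) (M : ℕ) :
    NAReach ℱ B (N + M) (j * 2 ^ M) (k * 2 ^ M) f h := by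
  obtain ⟨hjk, θ, hm, hf, hh, hs⟩ := H
  have hp : 0 < 2 ^ M := by positivity
  refine ⟨Nat.mul_le_mul_right _ hjk, fun l => θ (l / 2 ^ M), ?_, ?_, ?_, ?_⟩
  · intro l hl i
    exact (hm _ ((Nat.le_div_iff_mul_le hp).2 hl) i).mono (ℱ.mono (NAdt_div_le _ _ _)) le_rfl
  · intro ω
    simp only [NAdt_refine, Nat.mul_div_cancel _ hp, hf]
  · intro ω
    simp only [NAdt_refine, Nat.mul_div_cancel _ hp, hh]
  · intro l hl hlk ω
    by_cases hd : 2 ^ M ∣ l + 1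
    · have e : (l + 1) / 2 ^ M = l / 2 ^ M + 1 := by
        rw [Nat.succ_div, if_pos hd]
      have e2 : NAdt (N + M) (l + 1) = NAdt N (l / 2 ^ M + 1) := by
        rw [← NAdt_refine N M, ← e, Nat.div_mul_cancel hd]
      simp only [e, e2]
      exact hs _ ((Nat.le_div_iff_mul_le hp).2 hl) ((Nat.div_lt_iff_lt_mul hp).2 hlk) ω
    · have e : (l + 1) / 2 ^ M = l / 2 ^ M := by
        rw [Nat.succ_div, if_neg hd]; rfl
      simp only [e]

theorem NAReach.comb {N j k : ℕ} {f h f' h' : Ω → ℝ≥0} (H : NAReach ℱ B N j k f h)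
    (H' : NAReach ℱ B N j k f' h') {a a' : Ω → ℝ≥0} (ha : Measurable[ℱ (NAdt N j)] a)
    (ha' : Measurable[ℱ (NAdt N j)] a') :
    NAReach ℱ B N j k (fun ω => a ω * f ω + a' ω * f' ω) (fun ω => a ω * h ω + a' ω * h' ω) := by
  obtain ⟨hjk, θ, hm, hf, hh, hs⟩ := H
  obtain ⟨-, θ', hm', hf', hh', hs'⟩ := H'
  have key : ∀ l t ω, ∑ i, (a ω * θ l i ω + a' ω * θ' l i ω) * B t i ω =
      a ω * ∑ i, θ l i ω * B t i ω + a' ω * ∑ i, θ' l i ω * B t i ω := by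
    intro l t ω
    rw [Finset.mul_sum, Finset.mul_sum, ← Finset.sum_add_distrib]
    exact Finset.sum_congr rfl fun i _ => by ring
  refine ⟨hjk, fun l i ω => a ω * θ l i ω + a' ω * θ' l i ω, ?_, ?_, ?_, ?_⟩
  · intro l hl i
    have e := ℱ.mono (NAdt_mono N hl)
    exact ((ha.mono e le_rfl).mul (hm l hl i)).add ((ha'.mono e le_rfl).mul (hm' l hl i))
  · intro ω; dsimp only; rw [key, hf, hf']
  · intro ω; dsimp only; rw [key, hh, hh']
  · intro l hl hlk ω; rw [key, key, hs l hl hlk, hs' l hl hlk]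

theorem NAReach.comp {N j k r : ℕ} {f g h : Ω → ℝ≥0} (H : NAReach ℱ B N j k f g)
    (H' : NAReach ℱ B N k r g h) : NAReach ℱ B N j r f h := by
  obtain ⟨hjk, θ, hm, hf, hh, hs⟩ := H
  obtain ⟨hkr, θ', hm', hf', hh', hs'⟩ := H'
  refine ⟨hjk.trans hkr, fun l => if l < k then θ l else θ' l, ?_, ?_, ?_, ?_⟩
  · intro l hl i
    by_cases c : l < k
    · simp only [c, if_true]; exact hm l hl i
    · simp only [c, if_false]; exact hm' l (not_lt.1 c) i
  · intro ω
    by_cases c : j < k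
    · simp only [c, if_true, hf]
    · obtain rfl : j = k := by omega
      simp only [lt_irrefl, if_false]
      rw [← hf', hh, hf]
  · intro ω
    simp only [not_lt.2 hkr, if_false, hh']
  · intro l hl hlr ω
    rcases lt_trichotomy (l + 1) k with c | c | c
    · have : l < k := by omega
      simp only [c, this, if_true]; exact hs l hl this ω
    · have : l < k := by omega
      have c2 : ¬ (l + 1 < k) := by omega
      simp only [c2, this, if_true, if_false]
      rw [hs l hl this, c, ← hh, hf']
    · have : ¬ l < k := by omega
      have c2 : ¬ (l + 1 < k) := by omega
      simp only [c2, this, if_false]; exact hs' l (not_lt.1 this) hlr ω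

theorem NAReach.hold {N j k : ℕ} (hjk : j ≤ k) (i : ι) :
    NAReach ℱ B N j k (B (NAdt N j) i) (B (NAdt N k) i) := by
  classical
  refine ⟨hjk, fun _ i' _ => if i' = i then 1 else 0, fun l _ i' => measurable_const, ?_, ?_, ?_⟩
  · intro ω; simp
  · intro ω; simp
  · intro l _ _ ω; rfl

/-- Reachability between two dyadic times. -/
def NAR (ℱ : Filtration ℝ≥0 m) (B : ℝ≥0 → ι → Ω → ℝ≥0) (s t : ℝ≥0) (f h : Ω → ℝ≥0) : Prop :=
  ∃ N j k, NAdt N j = s ∧ NAdt N k = t ∧ NAReach ℱ B N j k f h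

/-- The dyadic times. -/
def NAD : Set ℝ≥0 := {s | ∃ N l, NAdt N l = s}

theorem NAD_common {s t : ℝ≥0} (hs : s ∈ NAD) (ht : t ∈ NAD) :
    ∃ N j k, NAdt N j = s ∧ NAdt N k = t := by
  obtain ⟨N, l, rfl⟩ := hs
  obtain ⟨N', l', rfl⟩ := ht
  refine ⟨N + N', l * 2 ^ N', l' * 2 ^ N, NAdt_refine _ _ _, ?_⟩
  rw [add_comm, NAdt_refine]

theorem NAR.le {s t : ℝ≥0} {f h : Ω → ℝ≥0} (H : NAR ℱ B s t f h) : s ≤ t := by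
  obtain ⟨N, j, k, rfl, rfl, h⟩ := H
  exact NAdt_mono _ h.1

theorem NAR.meas (hB : ∀ t i, Measurable[ℱ t] (B t i)) {s t : ℝ≥0} {f h : Ω → ℝ≥0}
    (H : NAR ℱ B s t f h) : Measurable[ℱ t] h := by
  obtain ⟨N, j, k, rfl, rfl, hjk, θ, hm, hf, hh, hs⟩ := H
  have : h = fun ω => ∑ i, θ k i ω * B (NAdt N k) i ω := funext hh
  rw [this]
  exact Finset.measurable_sum _ fun i _ => (hm k hjk i).mul (hB _ i)

theorem NAR.meas_left (hB : ∀ t i, Measurable[ℱ t] (B t i)) {s t : ℝ≥0} {f h : Ω → ℝ≥0}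
    (H : NAR ℱ B s t f h) : Measurable[ℱ s] f := by
  obtain ⟨N, j, k, rfl, rfl, hjk, θ, hm, hf, hh, hs⟩ := H
  have : f = fun ω => ∑ i, θ j i ω * B (NAdt N j) i ω := funext hf
  rw [this]
  exact Finset.measurable_sum _ fun i _ => (hm j le_rfl i).mul (hB _ i)

theorem NAR.comb {s t : ℝ≥0} {f h f' h' : Ω → ℝ≥0} (H : NAR ℱ B s t f h)
    (H' : NAR ℱ B s t f' h') {a a' : Ω → ℝ≥0} (ha : Measurable[ℱ s] a)
    (ha' : Measurable[ℱ s] a') :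
    NAR ℱ B s t (fun ω => a ω * f ω + a' ω * f' ω) (fun ω => a ω * h ω + a' ω * h' ω) := by
  obtain ⟨N, j, k, rfl, rfl, R⟩ := H
  obtain ⟨N', j', k', e1, e2, R'⟩ := H'
  have S1 := R.refine N'
  have S2 := R'.refine N
  rw [add_comm N' N] at S2
  have e3 : j' * 2 ^ N = j * 2 ^ N' := NAdt_inj (N := N + N') (by
    rw [NAdt_refine, add_comm, NAdt_refine, e1])
  have e4 : k' * 2 ^ N = k * 2 ^ N' := NAdt_inj (N := N + N') (by
    rw [NAdt_refine, add_comm, NAdt_refine, e2])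
  rw [e3, e4] at S2
  refine ⟨N + N', _, _, NAdt_refine _ _ _, NAdt_refine _ _ _, S1.comb S2 ?_ ?_⟩
  · rwa [NAdt_refine]
  · rwa [NAdt_refine]

theorem NAR.comp {s t u : ℝ≥0} {f g h : Ω → ℝ≥0} (H : NAR ℱ B s t f g)
    (H' : NAR ℱ B t u g h) : NAR ℱ B s u f h := by
  obtain ⟨N, j, k, rfl, rfl, R⟩ := H
  obtain ⟨N', j', k', e1, rfl, R'⟩ := H'
  have S1 := R.refine N'
  have S2 := R'.refine N
  rw [add_comm N' N] at S2
  have e3 : j' * 2 ^ N = k * 2 ^ N' := NAdt_inj (N := N + N') (by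
    rw [NAdt_refine, add_comm, NAdt_refine, e1])
  rw [e3] at S2
  refine ⟨N + N', _, _, NAdt_refine _ _ _, ?_, S1.comp S2⟩
  rw [add_comm, NAdt_refine]

theorem NAR.hold {s t : ℝ≥0} (hs : s ∈ NAD) (ht : t ∈ NAD) (hst : s ≤ t) (i : ι) :
    NAR ℱ B s t (B s i) (B t i) := by
  obtain ⟨N, j, k, rfl, rfl⟩ := NAD_common hs ht
  exact ⟨N, j, k, rfl, rfl, NAReach.hold (NAdt_le_iff.1 hst) i⟩

theorem NAR.smul {s t : ℝ≥0} {f h : Ω → ℝ≥0} (H : NAR ℱ B s t f h) {a : Ω → ℝ≥0}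
    (ha : Measurable[ℱ s] a) : NAR ℱ B s t (fun ω => a ω * f ω) (fun ω => a ω * h ω) := by
  have := H.comb H ha (a' := fun _ => 0) measurable_const
  simpa using this

end

/-- The extended price process: cash and the `d` assets. -/
def NAB {Ω : Type*} {d : ℕ} (S : ℝ≥0 → Ω → Fin d → ℝ) (t : ℝ≥0) (i : Option (Fin d)) (ω : Ω) :
    ℝ≥0 := i.elim 1 fun i => (S t ω i).toNNReal

theorem NAR.exists_wealth {Ω : Type*} {m : MeasurableSpace Ω} {ℱ : Filtration ℝ≥0 m}
    (P : Measure Ω) {d : ℕ} {S : ℝ≥0 → Ω → Fin d → ℝ} (hS : ∀ t ω i, 0 ≤ S t ω i)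
    {T : ℝ≥0} {x : ℝ≥0} {h : Ω → ℝ≥0} (H : NAR ℱ (NAB S) 0 T (fun _ => x) h) :
    ∃ X ∈ Xs P ℱ S x, ∀ ω, X T ω = h ω := by
  obtain ⟨N, j, k, ej, rfl, R⟩ := H
  obtain rfl : j = 0 := NAdt_inj (N := N) (by rw [ej]; simp [NAdt])
  obtain ⟨-, θ, hm, hf, hh, hs⟩ := R
  let st : SimpleStrategy ℱ d :=
    { n := k
      τ := fun l _ => NAdt N l
      ϑ := fun l ω i => θ l (some i) ω
      τ_zero := fun _ => by simp [NAdt]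
      τ_mono := fun l _ => NAdt_mono N (Nat.le_succ l)
      τ_stopping := fun l => isStoppingTime_const ℱ (NAdt N l)
      ϑ_meas := fun l => by
        rw [IsStoppingTime.measurableSpace_const]
        refine @measurable_pi_lambda _ _ _ (ℱ (NAdt N l)) _ _ fun i => ?_
        exact measurable_coe_nnreal_real.comp (hm l (Nat.zero_le _) (some i)) }
  have hB : ∀ t ω i, ((NAB S t (some i) ω : ℝ≥0) : ℝ) = S t ω i := fun t ω i =>
    Real.coe_toNNReal _ (hS t ω i)
  have hsum : ∀ (l : ℕ) t ω, ((∑ i, θ l i ω * NAB S t i ω : ℝ≥0) : ℝ) =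
      θ l none ω + ∑ i, (θ l (some i) ω : ℝ) * S t ω i := by
    intro l t ω
    rw [Fintype.sum_option]
    push_cast
    simp only [hB]
    simp [NAB]
  have key : ∀ l, l ≤ k → ∀ ω, st.wealth S x (NAdt N l) ω =
      ((∑ i, θ l i ω * NAB S (NAdt N l) i ω : ℝ≥0) : ℝ) := by
    intro l hl ω
    have e1 : ∀ l ≤ k, st.wealth S x (NAdt N l) ω = x + ∑ j ∈ Finset.range l, ∑ i, (θ j (some i) ω : ℝ) *
        (S (NAdt N (j+1)) ω i - S (NAdt N j) ω i) := by
      intro l hl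
      unfold SimpleStrategy.wealth
      congr 1
      rw [← Finset.sum_subset (Finset.range_mono hl)]
      · refine Finset.sum_congr rfl fun j hj => ?_
        have := Finset.mem_range.1 hj
        simp only [st]
        rw [min_eq_left (NAdt_mono N (by omega : j + 1 ≤ l)),
          min_eq_left (NAdt_mono N (by omega : j ≤ l))]
      · intro j _ hj
        have : ¬ j < l := fun c => hj (Finset.mem_range.2 c)
        simp only [st]
        rw [min_eq_right (NAdt_mono N (by omega : l ≤ j + 1)),
          min_eq_right (NAdt_mono N (by omega : l ≤ j))]
        simp
    induction l with
    | zero => rw [e1 0 hl, ← hf]; simp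
    | succ l ih =>
      have h1 := ih (by omega)
      rw [e1 _ hl, Finset.sum_range_succ, ← add_assoc, ← e1 l (by omega), h1,
        ← hs l (Nat.zero_le _) (by omega), hsum, hsum]
      simp only [mul_sub, Finset.sum_sub_distrib]
      ring
  refine ⟨st.wealth S x, ⟨st, ?_, rfl⟩, fun ω => by rw [key k le_rfl, ← hh]⟩
  intro l hl
  refine Eventually.of_forall fun ω => ⟨fun i => (θ l (some i) ω).2, ?_⟩
  show _ ≤ st.wealth S x (NAdt N l) ω
  rw [key l (le_of_lt hl), hsum]
  exact le_add_of_nonneg_left (θ l none ω).2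

end

noncomputable section
open MeasureTheory Set Filter
open scoped NNReal ENNReal Topology

section
variable {Ω : Type*} {m : MeasurableSpace Ω} {ℱ : Filtration ℝ≥0 m} {ι : Type*} [Fintype ι]
    {B : ℝ≥0 → ι → Ω → ℝ≥0}

theorem zero_mem_NAD : (0 : ℝ≥0) ∈ NAD := ⟨0, 0, by simp [NAdt]⟩

theorem nat_mem_NAD (n : ℕ) : (n : ℝ≥0) ∈ NAD := ⟨0, n, by simp [NAdt]⟩

theorem NA_exists_V (P : Measure Ω) [IsProbabilityMeasure P] (hB : ∀ t i, Measurable[ℱ t] (B t i))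
    (i0 : ι) (hi0 : ∀ t ω, B t i0 ω = 1) {T : ℝ≥0} (hT : T ∈ NAD)
    (hNA : ∀ A, MeasurableSet[ℱ T] A →
      (∀ n : ℕ, ∃ h, NAR ℱ B 0 T (fun _ => 1) h ∧ ∀ ω ∈ A, (n : ℝ≥0) ≤ h ω) → P A = 0) :
    ∃ V : ℝ≥0 → Ω → ℝ≥0∞, (∀ s ∈ NAD, s ≤ T → Measurable[ℱ s] (V s) ∧ ∫⁻ ω, V s ω ∂P ≤ 1 ∧
        ∀ᵐ ω ∂P, 0 < V s ω) ∧
      ∀ s ∈ NAD, ∀ t ∈ NAD, s ≤ t → t ≤ T → ∀ i, ∀ A, MeasurableSet[ℱ s] A →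
        ∫⁻ ω in A, B t i ω * V t ω ∂P ≤ ∫⁻ ω in A, B s i ω * V s ω ∂P := by
  classical
  have hcash : ∀ s ∈ NAD, ∀ t ∈ NAD, s ≤ t → NAR ℱ B s t (fun _ => 1) (fun _ => 1) := by
    intro s hs t ht hst
    have := NAR.hold (ℱ := ℱ) (B := B) hs ht hst i0
    rwa [show B s i0 = fun _ => 1 from funext (hi0 s),
      show B t i0 = fun _ => 1 from funext (hi0 t)] at this
  -- the weight
  obtain ⟨g, hgm, hgpos, hg⟩ : ∃ g : Ω → ℝ≥0, Measurable[ℱ T] g ∧ (∀ ω, 0 < g ω) ∧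
      ∀ h, NAR ℱ B 0 T (fun _ => 1) h → ∫⁻ ω, (g ω : ℝ≥0∞) * h ω ∂P ≤ 1 := by
    have : IsProbabilityMeasure (P.trim (ℱ.le T)) :=
      ⟨by rw [trim_measurableSet_eq _ MeasurableSet.univ]; exact measure_univ⟩
    obtain ⟨g, h1, h2, h3⟩ := @NA_exists_weight Ω (ℱ T) (P.trim (ℱ.le T)) _
      {h | NAR ℱ B 0 T (fun _ => 1) h} ⟨_, hcash 0 zero_mem_NAD T hT (zero_le)⟩
      (fun h hh => NAR.meas hB hh)
      (by
        intro h hh h' hh' a b hab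
        have := NAR.comb hh hh' (a := fun _ => a) (a' := fun _ => b) measurable_const
          measurable_const
        simpa [hab] using this)
      (by
        intro A hA hn
        rw [trim_measurableSet_eq _ hA]
        refine hNA A hA fun n => ?_
        obtain ⟨h, hh, hh'⟩ := hn n
        exact ⟨h, hh, hh'⟩)
    refine ⟨g, h1, h2, fun h hh => ?_⟩
    have hm : Measurable[ℱ T] (fun ω => (g ω : ℝ≥0∞) * h ω) :=
      h1.coe_nnreal_ennreal.mul (NAR.meas hB hh).coe_nnreal_ennreal
    rw [← lintegral_trim (ℱ.le T) hm]
    exact h3 h hh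
  have hgT : Measurable g := hgm.mono (ℱ.le T) le_rfl
  have hs1 : ∀ s ∈ NAD, s ≤ T → ∃ V : Ω → ℝ≥0∞, Measurable[ℱ s] V ∧ ∫⁻ ω, V ω ∂P ≤ 1 ∧
      (∀ h, NAR ℱ B s T (fun _ => 1) h → ∀ W : Ω → ℝ≥0∞, Measurable[ℱ s] W →
        ∫⁻ ω, W ω * (g ω * h ω) ∂P ≤ ∫⁻ ω, W ω * V ω ∂P) ∧
      ∀ W : Ω → ℝ≥0∞, Measurable[ℱ s] W → ∀ c,
        (∀ h, NAR ℱ B s T (fun _ => 1) h → ∫⁻ ω, W ω * (g ω * h ω) ∂P ≤ c) →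
        ∫⁻ ω, W ω * V ω ∂P ≤ c := by
    intro s hs hsT
    obtain ⟨V, h1, h2, h3, h4⟩ := NA_esssup (ℱ.le s) P
      {k | ∃ h, NAR ℱ B s T (fun _ => 1) h ∧ k = fun ω => (g ω : ℝ≥0∞) * h ω}
      ⟨_, _, hcash s hs T hT hsT, rfl⟩
      (by
        rintro k ⟨h, hh, rfl⟩
        exact hgT.coe_nnreal_ennreal.mul
          ((NAR.meas hB hh).mono (ℱ.le T) le_rfl).coe_nnreal_ennreal)
      (by
        rintro k ⟨h, hh, rfl⟩ k' ⟨h', hh', rfl⟩ A hA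
        have hma : ∀ A, MeasurableSet[ℱ s] A → Measurable[ℱ s] (A.indicator (fun _ => (1 : ℝ≥0))) :=
          fun A hA => measurable_const.indicator hA
        refine ⟨fun ω => A.indicator (fun _ => (1:ℝ≥0)) ω * h ω +
            Aᶜ.indicator (fun _ => (1:ℝ≥0)) ω * h' ω, ?_, ?_⟩
        · have := NAR.comb hh hh' (hma A hA) (hma Aᶜ hA.compl)
          have e : (fun ω => A.indicator (fun _ => (1:ℝ≥0)) ω * 1 +
            Aᶜ.indicator (fun _ => (1:ℝ≥0)) ω * 1) = fun _ => 1 := by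
            funext ω; by_cases h : ω ∈ A <;> simp [h]
          rw [e] at this
          exact this
        · funext ω; by_cases h : ω ∈ A <;> simp [h])
      (by
        rintro k ⟨h, hh, rfl⟩
        exact hg h ((hcash 0 zero_mem_NAD s hs (zero_le)).comp hh))
    exact ⟨V, h1, h2, fun h hh W hW => h3 _ ⟨h, hh, rfl⟩ W hW,
      fun W hW c hc => h4 W hW c (by rintro k ⟨h, hh, rfl⟩; exact hc h hh)⟩
  have hs2 : ∀ s, ∃ V : Ω → ℝ≥0∞, s ∈ NAD → s ≤ T → Measurable[ℱ s] V ∧ ∫⁻ ω, V ω ∂P ≤ 1 ∧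
      (∀ h, NAR ℱ B s T (fun _ => 1) h → ∀ W : Ω → ℝ≥0∞, Measurable[ℱ s] W →
        ∫⁻ ω, W ω * (g ω * h ω) ∂P ≤ ∫⁻ ω, W ω * V ω ∂P) ∧
      ∀ W : Ω → ℝ≥0∞, Measurable[ℱ s] W → ∀ c,
        (∀ h, NAR ℱ B s T (fun _ => 1) h → ∫⁻ ω, W ω * (g ω * h ω) ∂P ≤ c) →
        ∫⁻ ω, W ω * V ω ∂P ≤ c := by
    intro s
    by_cases h : s ∈ NAD ∧ s ≤ T
    · obtain ⟨V, hV⟩ := hs1 s h.1 h.2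
      exact ⟨V, fun _ _ => hV⟩
    · exact ⟨0, fun a b => (h ⟨a, b⟩).elim⟩
  choose V hV using hs2
  have lem1 : ∀ s ∈ NAD, s ≤ T → ∀ f k, NAR ℱ B s T f k → ∀ W : Ω → ℝ≥0∞, Measurable[ℱ s] W →
      ∫⁻ ω, W ω * (g ω * k ω) ∂P ≤ ∫⁻ ω, (W ω * f ω) * V s ω ∂P := by
    intro s hs hsT f k R W hW
    have hfm : Measurable[ℱ s] f := R.meas_left hB
    have hA : MeasurableSet[ℱ s] {ω | f ω = 0} := hfm (measurableSet_singleton 0)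
    have hkm : Measurable k := (R.meas hB).mono (ℱ.le T) le_rfl
    let I : Ω → ℝ≥0 := {ω | f ω = 0}.indicator (fun _ => 1)
    have hI : Measurable[ℱ s] I := measurable_const.indicator hA
    have hI' : Measurable I := hI.mono (ℱ.le s) le_rfl
    -- on the zero set
    have hz : ∫⁻ ω, (g ω : ℝ≥0∞) * (I ω * k ω) ∂P = 0 := by
      have hl : ∀ n : ℕ, (n : ℝ≥0∞) * ∫⁻ ω, (g ω : ℝ≥0∞) * (I ω * k ω) ∂P ≤ 1 := by
        intro n
        have R1 := NAR.comb (hcash s hs T hT hsT) R (a := fun _ => 1)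
          (a' := fun ω => n * I ω) measurable_const (measurable_const.mul hI)
        have e : (fun ω => (1:ℝ≥0) * 1 + (n * I ω) * f ω) = fun _ => 1 := by
          funext ω; by_cases h : f ω = 0 <;> simp [I, h]
        rw [e] at R1
        have := hg _ ((hcash 0 zero_mem_NAD s hs (zero_le)).comp R1)
        refine le_trans ?_ this
        rw [← lintegral_const_mul]
        · apply lintegral_mono
          intro ω
          push_cast
          calc (n : ℝ≥0∞) * (g ω * (I ω * k ω)) = g ω * (n * I ω * k ω) := by ring
            _ ≤ _ := by gcongr; exact le_add_self
        · exact hgT.coe_nnreal_ennreal.mul (hI'.coe_nnreal_ennreal.mul hkm.coe_nnreal_ennreal)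
      by_contra hc
      obtain ⟨n, hn⟩ := ENNReal.exists_nat_mul_gt hc ENNReal.one_ne_top
      exact absurd (hl n) (not_le.2 hn)
    have hz' : ∀ᵐ ω ∂P, f ω = 0 → k ω = 0 := by
      have := (lintegral_eq_zero_iff (hgT.coe_nnreal_ennreal.mul
        (hI'.coe_nnreal_ennreal.mul hkm.coe_nnreal_ennreal))).1 hz
      filter_upwards [this] with ω hω hf
      simpa [I, hf, (hgpos ω).ne'] using hω
    have R2 := NAR.comb R (hcash s hs T hT hsT) (a := fun ω => (f ω)⁻¹) (a' := I) hfm.inv hI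
    have e : (fun ω => (f ω)⁻¹ * f ω + I ω * 1) = fun _ => 1 := by
      funext ω; by_cases h : f ω = 0 <;> simp [I, h]
    rw [e] at R2
    refine le_trans (le_of_eq ?_) ((hV s hs hsT).2.2.1 _ R2 (fun ω => W ω * f ω)
      (hW.mul hfm.coe_nnreal_ennreal))
    apply lintegral_congr_ae
    filter_upwards [hz'] with ω hω
    by_cases h : f ω = 0
    · simp [h, hω h]
    · have : (f ω : ℝ≥0∞) * ((f ω)⁻¹ : ℝ≥0) = 1 := by
        rw [← ENNReal.coe_mul, mul_inv_cancel₀ h]; rfl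
      simp only [I, indicator, mem_ofPred_eq, h, if_false]
      push_cast
      calc W ω * (g ω * k ω) = W ω * (g ω * k ω) * (f ω * ((f ω)⁻¹ : ℝ≥0)) := by rw [this, mul_one]
        _ = _ := by ring
  refine ⟨V, fun s hs hsT => ⟨(hV s hs hsT).1, (hV s hs hsT).2.1, ?_⟩, ?_⟩
  · -- positivity
    have hVm := (hV s hs hsT).1
    have hA : MeasurableSet[ℱ s] {ω | V s ω = 0} := hVm (measurableSet_singleton 0)
    have h1 := (hV s hs hsT).2.2.1 _ (hcash s hs T hT hsT) ({ω | V s ω = 0}.indicator fun _ => 1)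
      (measurable_const.indicator hA)
    have h2 : ∫⁻ ω, ({ω | V s ω = 0}.indicator (fun _ => (1 : ℝ≥0∞))) ω * V s ω ∂P = 0 := by
      have : ∀ ω, ({ω | V s ω = 0}.indicator (fun _ => (1 : ℝ≥0∞))) ω * V s ω = 0 := by
        intro ω; by_cases h : V s ω = 0 <;> simp [h]
      simp [this]
    rw [h2, nonpos_iff_eq_zero, lintegral_eq_zero_iff] at h1
    · filter_upwards [h1] with ω hω
      rw [pos_iff_ne_zero]
      intro h
      simp [h, (hgpos ω).ne'] at hω
    · exact ((measurable_const.indicator hA).mono (ℱ.le s) le_rfl).mul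
        (hgT.coe_nnreal_ennreal.mul measurable_const)
  · intro s hs t ht hst htT i A hA
    have hsT := hst.trans htT
    have hIA : Measurable[ℱ s] (A.indicator (fun _ => (1:ℝ≥0∞))) := measurable_const.indicator hA
    have e : ∀ t, ∫⁻ ω in A, B t i ω * V t ω ∂P =
        ∫⁻ ω, (A.indicator (fun _ => (1:ℝ≥0∞)) ω * B t i ω) * V t ω ∂P := by
      intro t
      rw [← lintegral_indicator (ℱ.le s _ hA)]
      congr 1; funext ω
      by_cases h : ω ∈ A <;> simp [h]
    rw [e, e]
    refine (hV t ht htT).2.2.2 (fun ω => A.indicator (fun _ => (1:ℝ≥0∞)) ω * B t i ω) ((hIA.mono (ℱ.mono hst) le_rfl).mul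
      (hB t i).coe_nnreal_ennreal) _ fun h hh => ?_
    have R3 := (NAR.hold (ℱ := ℱ) (B := B) hs ht hst i).comp
      (by simpa using hh.smul (hB t i))
    refine le_trans (le_of_eq ?_) (lem1 s hs hsT _ _ R3 _ hIA)
    refine lintegral_congr fun ω => ?_
    push_cast
    ring

/-- Discrete-time deflator along the dyadics. -/
theorem NA_exists_Z (P : Measure Ω) [IsProbabilityMeasure P] (hB : ∀ t i, Measurable[ℱ t] (B t i))
    (i0 : ι) (hi0 : ∀ t ω, B t i0 ω = 1)
    (hNA : ∀ T ∈ NAD, ∀ A, MeasurableSet[ℱ T] A →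
      (∀ n : ℕ, ∃ h, NAR ℱ B 0 T (fun _ => 1) h ∧ ∀ ω ∈ A, (n : ℝ≥0) ≤ h ω) → P A = 0) :
    ∃ Z : ℝ≥0 → Ω → ℝ≥0∞, (∀ s ∈ NAD, Measurable[ℱ s] (Z s) ∧ ∫⁻ ω, Z s ω ∂P ≤ 1 ∧
        ∀ᵐ ω ∂P, 0 < Z s ω) ∧
      ∀ s ∈ NAD, ∀ t ∈ NAD, s ≤ t → ∀ i, ∀ A, MeasurableSet[ℱ s] A →
        ∫⁻ ω in A, B t i ω * Z t ω ∂P ≤ ∫⁻ ω in A, B s i ω * Z s ω ∂P := by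
  classical
  choose V hV hV2 using fun n : ℕ => NA_exists_V P hB i0 hi0 (nat_mem_NAD n)
    (hNA n (nat_mem_NAD n))
  let V' : ℕ → ℝ≥0 → Ω → ℝ≥0∞ := fun n s => if s ≤ n then V n s else 0
  have hm : ∀ s ∈ NAD, ∀ n, Measurable[ℱ s] (V' n s) := by
    intro s hs n
    by_cases h : s ≤ n
    · simp only [V', h, if_true]; exact (hV n s hs h).1
    · simp only [V', h, if_false]; exact @measurable_const _ _ _ (ℱ s) 0
  let c : ℕ → ℝ≥0∞ := fun n => 2⁻¹ ^ (n + 1)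
  have hc : ∑' n, c n = 1 := by
    simp only [c, pow_succ]
    rw [ENNReal.tsum_mul_right, ENNReal.tsum_geometric, ENNReal.one_sub_inv_two, inv_inv]
    exact ENNReal.mul_inv_cancel two_ne_zero ENNReal.ofNat_ne_top
  refine ⟨fun s ω => ∑' n, c n * V' n s ω, fun s hs => ⟨?_, ?_, ?_⟩, ?_⟩
  · exact @Measurable.ennreal_tsum _ (ℱ s) _ _ _ fun n => (hm s hs n).const_mul _
  · rw [lintegral_tsum fun n => (((hm s hs n).mono (ℱ.le s) le_rfl).const_mul _).aemeasurable]
    rw [← hc]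
    refine ENNReal.tsum_le_tsum fun n => ?_
    rw [lintegral_const_mul _ ((hm s hs n).mono (ℱ.le s) le_rfl)]
    by_cases h : s ≤ n
    · simp only [V', h, if_true]
      calc c n * _ ≤ c n * 1 := by gcongr; exact (hV n s hs h).2.1
        _ = c n := mul_one _
    · simp [V', h]
  · obtain ⟨n, hn⟩ := exists_nat_ge s
    filter_upwards [(hV n s hs hn).2.2] with ω hω
    refine lt_of_lt_of_le ?_ (ENNReal.le_tsum n)
    simp only [V', hn, if_true]
    refine ENNReal.mul_pos ?_ hω.ne'
    simp [c]
  · intro s hs t ht hst i A hA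
    have e : ∀ t ∈ NAD, ∫⁻ ω in A, B t i ω * ∑' n, c n * V' n t ω ∂P =
        ∑' n, c n * ∫⁻ ω in A, B t i ω * V' n t ω ∂P := by
      intro t ht
      have hBt := ((hB t i).mono (ℱ.le t) le_rfl).coe_nnreal_ennreal
      have h1 : ∀ n, Measurable (V' n t) := fun n => (hm t ht n).mono (ℱ.le t) le_rfl
      simp_rw [← ENNReal.tsum_mul_left]
      have h2 : ∀ n, Measurable fun ω => (B t i ω : ℝ≥0∞) * (c n * V' n t ω) :=
        fun n => hBt.mul ((h1 n).const_mul _)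
      have h3 : ∀ n, Measurable fun ω => (B t i ω : ℝ≥0∞) * V' n t ω := fun n => hBt.mul (h1 n)
      rw [lintegral_tsum fun n => (h2 n).aemeasurable]
      congr 1; funext n
      rw [← lintegral_const_mul _ (h3 n)]
      refine lintegral_congr fun ω => ?_
      ring
    rw [e s hs, e t ht]
    refine ENNReal.tsum_le_tsum fun n => ?_
    refine mul_le_mul' le_rfl ?_
    by_cases h : t ≤ n
    · have h' : s ≤ n := hst.trans h
      simp only [V', h, h', if_true]
      exact hV2 n s hs t ht hst h i A hA
    · simp [V', h]

end

theorem NAB_meas {Ω : Type*} {m : MeasurableSpace Ω} {ℱ : Filtration ℝ≥0 m}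
    {d : ℕ} {S : ℝ≥0 → Ω → Fin d → ℝ} (hS : StronglyAdapted ℱ S) (t : ℝ≥0) (i : Option (Fin d)) :
    Measurable[ℱ t] (NAB S t i) := by
  cases i with
  | none => exact measurable_const
  | some i =>
    have h1 : Measurable[ℱ t] (S t) := (hS t).measurable
    have h2 : Measurable[ℱ t] (fun ω => S t ω i) := (measurable_pi_apply i).comp h1
    exact measurable_real_toNNReal.comp h2

theorem NA_of_NA1s {Ω : Type*} {m : MeasurableSpace Ω} {ℱ : Filtration ℝ≥0 m}
    (P : Measure Ω) {d : ℕ} {S : ℝ≥0 → Ω → Fin d → ℝ} (hS : ∀ t ω i, 0 ≤ S t ω i)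
    (h : NA1s P ℱ S) (T : ℝ≥0) (A : Set Ω) (hA : MeasurableSet[ℱ T] A)
    (hn : ∀ n : ℕ, ∃ h, NAR ℱ (NAB S) 0 T (fun _ => 1) h ∧ ∀ ω ∈ A, (n : ℝ≥0) ≤ h ω) :
    P A = 0 := by
  by_contra hc
  refine h T (A.indicator fun _ => 1) ⟨measurable_const.indicator hA,
    Eventually.of_forall fun ω => indicator_nonneg (fun _ _ => zero_le_one) _, ?_, ?_⟩
  · have : {ω | 0 < A.indicator (fun _ => (1 : ℝ)) ω} = A := by
      ext ω; by_cases h : ω ∈ A <;> simp [h]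
    rw [this]; exact pos_iff_ne_zero.2 hc
  · intro x hx
    lift x to ℝ≥0 using hx.le
    have hx' : 0 < x := by exact_mod_cast hx
    obtain ⟨n, hn1⟩ := exists_nat_ge x⁻¹
    obtain ⟨h, R, hh⟩ := hn n
    have R' := R.smul (a := fun _ => x) measurable_const
    simp only [mul_one] at R'
    obtain ⟨X, hX, hXT⟩ := R'.exists_wealth P hS
    refine ⟨X, hX, Eventually.of_forall fun ω => ?_⟩
    rw [hXT]
    by_cases hω : ω ∈ A
    · simp only [hω, indicator_of_mem]
      have : 1 ≤ x * h ω := by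
        calc (1 : ℝ≥0) = x * x⁻¹ := (mul_inv_cancel₀ hx'.ne').symm
          _ ≤ x * h ω := by gcongr; exact hn1.trans (hh ω hω)
      exact_mod_cast this
    · simp only [hω, not_false_iff, indicator_of_notMem]
      exact NNReal.coe_nonneg _

end

noncomputable section
open MeasureTheory Set Filter
open scoped NNReal ENNReal Topology

/-- Alternation condition: low values at even stages, high values at odd stages. -/
def NACond (a b : ℝ≥0∞) (j : ℕ) (v : ℝ≥0∞) : Prop := if Even j then v ≤ a else b ≤ v

/-- `NAUp a b z j l`: along the list `l`, the path `z` completes `j` alternations. -/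
def NAUp (a b : ℝ≥0∞) (z : ℝ≥0 → ℝ≥0∞) : ℕ → List ℝ≥0 → Prop
  | 0, _ => True
  | _ + 1, [] => False
  | j + 1, q :: l => (NACond a b (j + 1) (z q) ∧ NAUp a b z j l) ∨ NAUp a b z (j + 1) l

theorem NAUp_zero {a b : ℝ≥0∞} {z : ℝ≥0 → ℝ≥0∞} (l : List ℝ≥0) : NAUp a b z 0 l := by
  unfold NAUp; trivial

theorem NAUp.pred {a b : ℝ≥0∞} {z : ℝ≥0 → ℝ≥0∞} {l : List ℝ≥0} : ∀ {j : ℕ},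
    NAUp a b z (j + 1) l → NAUp a b z j l := by
  induction l with
  | nil => intro j h; simp [NAUp] at h
  | cons q l ih =>
    intro j h
    cases j with
    | zero => exact NAUp_zero _
    | succ j =>
      rw [NAUp] at h ⊢
      rcases h with ⟨_, h⟩ | h
      · exact Or.inr h
      · exact Or.inr (ih h)

theorem NAUp.sublist {a b : ℝ≥0∞} {z : ℝ≥0 → ℝ≥0∞} {l l' : List ℝ≥0} (hl : l.Sublist l') :
    ∀ {j : ℕ}, NAUp a b z j l → NAUp a b z j l' := by
  induction hl with
  | slnil => intro j h; exact h
  | cons q hl ih =>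
    intro j h
    cases j with
    | zero => exact NAUp_zero _
    | succ j => rw [NAUp]; exact Or.inr (ih h)
  | cons_cons q hl ih =>
    intro j h
    cases j with
    | zero => exact NAUp_zero _
    | succ j =>
      rw [NAUp] at h ⊢
      rcases h with ⟨h1, h⟩ | h
      · exact Or.inl ⟨h1, ih h⟩
      · exact Or.inr (ih h)

theorem NAD_countable : NAD.Countable := by
  have : NAD = range (fun p : ℕ × ℕ => NAdt p.1 p.2) := by
    ext s; simp [NAD]
  rw [this]; exact countable_range _

section
variable {Ω : Type*} {m : MeasurableSpace Ω} {ℱ : Filtration ℝ≥0 m}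

theorem NAUp_bound (P : Measure Ω) {Z : ℝ≥0 → Ω → ℝ≥0∞} {a b : ℝ≥0∞} (hb0 : b ≠ 0) (hbt : b ≠ ⊤)
    (hZm : ∀ s ∈ NAD, Measurable[ℱ s] (Z s))
    (hZ : ∀ s ∈ NAD, ∀ t ∈ NAD, s ≤ t → ∀ A, MeasurableSet[ℱ s] A →
        ∫⁻ ω in A, Z t ω ∂P ≤ ∫⁻ ω in A, Z s ω ∂P) (l : List ℝ≥0) :
    ∀ s ∈ NAD, (∀ q ∈ l, q ∈ NAD) → (s :: l).Pairwise (· ≤ ·) → ∀ A, MeasurableSet[ℱ s] A →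
      ∀ k : ℕ,
      P (A ∩ {ω | NAUp a b (fun q => Z q ω) (2 * k) l}) ≤ (a / b) ^ k * P A ∧
      P (A ∩ {ω | NAUp a b (fun q => Z q ω) (2 * k + 1) l}) ≤
        (a / b) ^ k * (b⁻¹ * ∫⁻ ω in A, Z s ω ∂P) := by
  induction l with
  | nil =>
    intro s hs _ _ A hA k
    constructor
    · cases k with
      | zero => simpa using measure_mono inter_subset_left
      | succ k =>
        have : {ω | NAUp a b (fun q => Z q ω) (2 * (k + 1)) []} = ∅ := by
          ext ω; simp [NAUp, show 2 * (k + 1) = (2 * k + 1) + 1 by ring]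
        simp [this]
    · have : {ω | NAUp a b (fun q => Z q ω) (2 * k + 1) []} = ∅ := by
        ext ω; simp [NAUp]
      simp [this]
  | cons q l ih =>
    intro s hs hl hp A hA k
    have hq : q ∈ NAD := hl q (by simp)
    have hsq : s ≤ q := (List.pairwise_cons.1 hp).1 q (by simp)
    have IH := ih q hq (fun x hx => hl x (by simp [hx])) (List.pairwise_cons.1 hp).2
    have hAq : MeasurableSet[ℱ q] A := ℱ.mono hsq _ hA
    have split : ∀ (U X Y C : Set Ω), (∀ ω ∈ U, ω ∈ C → ω ∈ X) → (∀ ω ∈ U, ω ∉ C → ω ∈ Y) →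
        P (A ∩ U) ≤ P ((A ∩ C) ∩ X) + P ((A \ C) ∩ Y) := by
      intro U X Y C h1 h2
      refine le_trans (measure_mono ?_) (measure_union_le _ _)
      rintro ω ⟨hωA, hωU⟩
      by_cases hc : ω ∈ C
      · exact Or.inl ⟨⟨hωA, hc⟩, h1 ω hωU hc⟩
      · exact Or.inr ⟨⟨hωA, hc⟩, h2 ω hωU hc⟩
    constructor
    · cases k with
      | zero => simpa using measure_mono inter_subset_left
      | succ k =>
        have hC : MeasurableSet[ℱ q] {ω | Z q ω ≤ a} := (hZm q hq) measurableSet_Iic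
        set C := {ω | Z q ω ≤ a} with hCdef
        refine (split _ {ω | NAUp a b (fun q => Z q ω) (2 * k + 1) l}
          {ω | NAUp a b (fun q => Z q ω) (2 * (k + 1)) l} C ?_ ?_).trans ?_
        · intro ω h hc
          have h' : NAUp a b (fun q => Z q ω) (2 * k + 1 + 1) (q :: l) := h
          rw [NAUp] at h'
          rcases h' with ⟨_, h⟩ | h
          · exact h
          · exact h.pred
        · intro ω h hc
          have h' : NAUp a b (fun q => Z q ω) (2 * k + 1 + 1) (q :: l) := h
          rw [NAUp] at h'
          rcases h' with ⟨h1, h⟩ | h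
          · rw [NACond, if_pos (by rw [show 2 * k + 1 + 1 = 2 * (k + 1) by ring]; simp)] at h1
            exact (hc h1).elim
          · exact h
        · have hAC : MeasurableSet[ℱ q] (A ∩ C) := hAq.inter hC
          calc _ ≤ (a / b) ^ k * (b⁻¹ * ∫⁻ ω in A ∩ C, Z q ω ∂P) + (a / b) ^ (k + 1) * P (A \ C) :=
                add_le_add (IH _ hAC k).2 (IH _ (hAq.diff hC) (k + 1)).1
            _ ≤ (a / b) ^ k * (b⁻¹ * (a * P (A ∩ C))) + (a / b) ^ (k + 1) * P (A \ C) := by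
                gcongr
                calc ∫⁻ ω in A ∩ C, Z q ω ∂P ≤ ∫⁻ ω in A ∩ C, a ∂P :=
                      setLIntegral_mono measurable_const fun ω hω => hω.2
                  _ = _ := by simp
            _ = (a / b) ^ (k + 1) * (P (A ∩ C) + P (A \ C)) := by
                rw [pow_succ, div_eq_mul_inv]; ring
            _ = _ := by rw [measure_inter_add_diff _ (ℱ.le q _ hC)]
    · have hC : MeasurableSet[ℱ q] {ω | b ≤ Z q ω} := (hZm q hq) measurableSet_Ici
      set C := {ω | b ≤ Z q ω} with hCdef
      refine (split _ {ω | NAUp a b (fun q => Z q ω) (2 * k) l}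
        {ω | NAUp a b (fun q => Z q ω) (2 * k + 1) l} C ?_ ?_).trans ?_
      · intro ω h hc
        have h' : NAUp a b (fun q => Z q ω) (2 * k + 1) (q :: l) := h
        rw [NAUp] at h'
        rcases h' with ⟨_, h⟩ | h
        · exact h
        · exact h.pred
      · intro ω h hc
        have h' : NAUp a b (fun q => Z q ω) (2 * k + 1) (q :: l) := h
        rw [NAUp] at h'
        rcases h' with ⟨h1, h⟩ | h
        · rw [NACond, if_neg (by simp)] at h1
          exact (hc h1).elim
        · exact h
      · have hAC : MeasurableSet[ℱ q] (A ∩ C) := hAq.inter hC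
        calc _ ≤ (a / b) ^ k * P (A ∩ C) + (a / b) ^ k * (b⁻¹ * ∫⁻ ω in A \ C, Z q ω ∂P) :=
              add_le_add (IH _ hAC k).1 (IH _ (hAq.diff hC) k).2
          _ ≤ (a / b) ^ k * (b⁻¹ * ∫⁻ ω in A ∩ C, Z q ω ∂P) +
              (a / b) ^ k * (b⁻¹ * ∫⁻ ω in A \ C, Z q ω ∂P) := by
              gcongr
              rw [← ENNReal.mul_le_iff_le_inv hb0 hbt]
              calc b * P (A ∩ C) = ∫⁻ ω in A ∩ C, b ∂P := by simp
                _ ≤ _ := setLIntegral_mono ((hZm q hq).mono (ℱ.le q) le_rfl) fun ω hω => hω.2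
          _ = (a / b) ^ k * (b⁻¹ * ∫⁻ ω in A, Z q ω ∂P) := by
              rw [← mul_add, ← mul_add, lintegral_inter_add_diff _ _ (ℱ.le q _ hC)]
          _ ≤ _ := mul_le_mul' le_rfl (mul_le_mul' le_rfl (hZ s hs q hq hsq A hA))

/-- The event that some finite dyadic list witnesses `j` alternations. -/
def NAUpEv (a b : ℝ≥0∞) (z : ℝ≥0 → ℝ≥0∞) (j : ℕ) : Prop :=
  ∃ l : List ℝ≥0, (∀ q ∈ l, q ∈ NAD) ∧ l.Pairwise (· < ·) ∧ NAUp a b z j l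

theorem NAUpEv_bound (P : Measure Ω) {Z : ℝ≥0 → Ω → ℝ≥0∞} {a b : ℝ≥0∞} {j : ℕ} {c : ℝ≥0∞}
    (h : ∀ l : List ℝ≥0, (∀ q ∈ l, q ∈ NAD) → l.Pairwise (· ≤ ·) →
      P {ω | NAUp a b (fun q => Z q ω) j l} ≤ c) :
    P {ω | NAUpEv a b (fun q => Z q ω) j} ≤ c := by
  classical
  obtain ⟨e, he⟩ := NAD_countable.exists_eq_range ⟨0, zero_mem_NAD⟩
  let G : ℕ → Finset ℝ≥0 := fun N => (Finset.range N).image e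
  have hG : Monotone G := fun M N h => Finset.image_subset_image (Finset.range_mono h)
  let L : ℕ → List ℝ≥0 := fun N => (G N).sort (· ≤ ·)
  have hsub : ∀ (l : List ℝ≥0) N, l.Pairwise (· < ·) → (∀ q ∈ l, q ∈ G N) → l.Sublist (L N) := by
    intro l N hl hN
    refine List.sublist_of_subperm_of_pairwise (r := (· ≤ ·)) (List.subperm_of_subset ?_ ?_) ?_ ?_
    · exact hl.imp fun h => h.ne
    · intro q hq; exact (Finset.mem_sort _).2 (hN q hq)
    · exact hl.imp fun h => h.le
    · exact Finset.pairwise_sort _ _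
  have hfin : ∀ l : List ℝ≥0, (∀ q ∈ l, q ∈ NAD) → ∃ N, ∀ q ∈ l, q ∈ G N := by
    intro l
    induction l with
    | nil => intro _; exact ⟨0, by simp⟩
    | cons q l ih =>
      intro hq
      obtain ⟨N, hN⟩ := ih fun x hx => hq x (by simp [hx])
      have : q ∈ range e := he ▸ hq q (by simp)
      obtain ⟨n, rfl⟩ := this
      refine ⟨max N (n + 1), ?_⟩
      intro x hx
      rcases List.mem_cons.1 hx with rfl | hx
      · exact hG (le_max_right N (n + 1)) (Finset.mem_image.2 ⟨n, by simp, rfl⟩)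
      · exact hG (le_max_left N (n + 1)) (hN x hx)
  have hsub2 : {ω | NAUpEv a b (fun q => Z q ω) j} ⊆
      ⋃ N, {ω | NAUp a b (fun q => Z q ω) j (L N)} := by
    rintro ω ⟨l, hl, hp, hu⟩
    obtain ⟨N, hN⟩ := hfin l hl
    exact mem_iUnion.2 ⟨N, hu.sublist (hsub l N hp hN)⟩
  refine (measure_mono hsub2).trans ?_
  have hmono : Monotone fun N => {ω | NAUp a b (fun q => Z q ω) j (L N)} := by
    intro M N hMN ω hω
    refine NAUp.sublist (hsub (L M) N ?_ ?_) hω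
    · exact (Finset.sortedLT_sort _).pairwise
    · intro q hq
      exact hG hMN ((Finset.mem_sort _).1 hq)
  rw [hmono.measure_iUnion]
  refine iSup_le fun N => h _ ?_ (Finset.pairwise_sort _ _)
  intro q hq
  obtain ⟨n, _, rfl⟩ := Finset.mem_image.1 ((Finset.mem_sort _).1 hq)
  rw [he]; exact mem_range_self n

/-- Regular dyadic paths: right limits in `(0,∞)`, left limits in `[0,∞)`. -/
def NAGood (z : ℝ≥0 → ℝ≥0∞) : Prop :=
  (∀ t, ∃ L, L ≠ 0 ∧ L ≠ ⊤ ∧ Tendsto z (𝓝[Ioi t ∩ NAD] t) (𝓝 L)) ∧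
    ∀ t, 0 < t → ∃ L, L ≠ ⊤ ∧ Tendsto z (𝓝[Iio t ∩ NAD] t) (𝓝 L)

theorem NAUp_right {z : ℝ≥0 → ℝ≥0∞} {a b : ℝ≥0∞} {t : ℝ≥0}
    (h1 : ∃ᶠ q in 𝓝[Ioi t ∩ NAD] t, z q < a) (h2 : ∃ᶠ q in 𝓝[Ioi t ∩ NAD] t, b < z q) (j : ℕ) :
    NAUpEv a b z j := by
  have hc : ∀ j, ∃ᶠ q in 𝓝[Ioi t ∩ NAD] t, NACond a b j (z q) := by
    intro j
    by_cases hj : Even j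
    · exact h1.mono fun q hq => by rw [NACond, if_pos hj]; exact hq.le
    · exact h2.mono fun q hq => by rw [NACond, if_neg hj]; exact hq.le
  suffices H : ∃ u, t < u ∧ ∃ l : List ℝ≥0, (∀ q ∈ l, q ∈ NAD ∧ u ≤ q) ∧ l.Pairwise (· < ·) ∧
      NAUp a b z j l by
    obtain ⟨u, _, l, hl, hp, hu⟩ := H
    exact ⟨l, fun q hq => (hl q hq).1, hp, hu⟩
  induction j with
  | zero => exact ⟨t + 1, lt_add_one t, [], by simp, List.Pairwise.nil, NAUp_zero _⟩
  | succ j ih =>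
    obtain ⟨u, htu, l, hl, hp, hu⟩ := ih
    have hev : ∀ᶠ q in 𝓝[Ioi t ∩ NAD] t, q < u ∧ q ∈ Ioi t ∩ NAD :=
      Filter.Eventually.and (mem_nhdsWithin_of_mem_nhds (Iio_mem_nhds htu)) self_mem_nhdsWithin
    obtain ⟨q, hq1, hq2, hq3⟩ := ((hc (j + 1)).and_eventually hev).exists
    refine ⟨q, hq3.1, q :: l, ?_, ?_, ?_⟩
    · intro x hx
      rcases List.mem_cons.1 hx with rfl | hx
      · exact ⟨hq3.2, le_rfl⟩
      · exact ⟨(hl x hx).1, hq2.le.trans (hl x hx).2⟩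
    · exact List.pairwise_cons.2 ⟨fun x hx => hq2.trans_le (hl x hx).2, hp⟩
    · rw [NAUp]; exact Or.inl ⟨hq1, hu⟩

theorem NAUp_left {z : ℝ≥0 → ℝ≥0∞} {a b : ℝ≥0∞} {t : ℝ≥0} (ht : 0 < t)
    (h1 : ∃ᶠ q in 𝓝[Iio t ∩ NAD] t, z q < a) (h2 : ∃ᶠ q in 𝓝[Iio t ∩ NAD] t, b < z q) (j : ℕ) :
    NAUpEv a b z j := by
  have hc : ∀ j, ∃ᶠ q in 𝓝[Iio t ∩ NAD] t, NACond a b j (z q) := by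
    intro j
    by_cases hj : Even j
    · exact h1.mono fun q hq => by rw [NACond, if_pos hj]; exact hq.le
    · exact h2.mono fun q hq => by rw [NACond, if_neg hj]; exact hq.le
  suffices H : ∀ u, u < t → ∃ l : List ℝ≥0, (∀ q ∈ l, q ∈ NAD ∧ u < q) ∧ l.Pairwise (· < ·) ∧
      NAUp a b z j l by
    obtain ⟨l, hl, hp, hu⟩ := H 0 ht
    exact ⟨l, fun q hq => (hl q hq).1, hp, hu⟩
  induction j with
  | zero => intro u hu; exact ⟨[], by simp, List.Pairwise.nil, NAUp_zero _⟩
  | succ j ih =>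
    intro u hut
    have hev : ∀ᶠ q in 𝓝[Iio t ∩ NAD] t, u < q ∧ q ∈ Iio t ∩ NAD :=
      Filter.Eventually.and (mem_nhdsWithin_of_mem_nhds (Ioi_mem_nhds hut)) self_mem_nhdsWithin
    obtain ⟨q, hq1, hq2, hq3⟩ := ((hc (j + 1)).and_eventually hev).exists
    obtain ⟨l, hl, hp, hu⟩ := ih q hq3.1
    refine ⟨q :: l, ?_, ?_, ?_⟩
    · intro x hx
      rcases List.mem_cons.1 hx with rfl | hx
      · exact ⟨hq3.2, hq2⟩
      · exact ⟨(hl x hx).1, hq2.trans (hl x hx).2⟩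
    · exact List.pairwise_cons.2 ⟨fun x hx => (hl x hx).2, hp⟩
    · rw [NAUp]; exact Or.inl ⟨hq1, hu⟩

theorem NA_dense_right (t : ℝ≥0) : (𝓝[Ioi t ∩ NAD] t).NeBot := by
  rw [← mem_closure_iff_nhdsWithin_neBot, Metric.mem_closure_iff]
  intro ε hε
  obtain ⟨N, hN⟩ := exists_pow_lt_of_lt_one hε (by norm_num : (1/2 : ℝ) < 1)
  have hp : (0:ℝ≥0) < 2 ^ N := by positivity
  refine ⟨NAdt N (⌊t * 2 ^ N⌋₊ + 1), ⟨?_, N, _, rfl⟩, ?_⟩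
  · show t < _
    rw [NAdt, lt_div_iff₀ hp]
    exact_mod_cast Nat.lt_floor_add_one (t * 2 ^ N)
  · have h1 : t < NAdt N (⌊t * 2 ^ N⌋₊ + 1) := by
      rw [NAdt, lt_div_iff₀ hp]
      exact_mod_cast Nat.lt_floor_add_one (t * 2 ^ N)
    have h2 : NAdt N (⌊t * 2 ^ N⌋₊ + 1) ≤ t + (1/2) ^ N := by
      rw [NAdt, div_le_iff₀ hp, add_mul]
      have h3 : ((1/2 : ℝ≥0)) ^ N * 2 ^ N = 1 := by rw [← mul_pow]; norm_num
      rw [h3]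
      push_cast
      gcongr
      exact Nat.floor_le (zero_le)
    rw [dist_comm, NNReal.dist_eq, abs_of_nonneg (by exact sub_nonneg.2 (by exact_mod_cast h1.le))]
    have h4 : ((NAdt N (⌊t * 2 ^ N⌋₊ + 1) : ℝ≥0) : ℝ) ≤ t + (1/2) ^ N := by exact_mod_cast h2
    linarith

theorem NAGood_of {z : ℝ≥0 → ℝ≥0∞} {D : Set ℝ≥0∞} (hD : Dense D)
    (hA : ∀ a ∈ D, ∀ b ∈ D, a < b → ∃ k, ¬ NAUpEv a b z k)
    (hB : ∃ b : ℕ, ¬ NAUpEv 0 (b : ℝ≥0∞) z 1)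
    (hC : ∀ n : ℕ, ∃ k : ℕ, ¬ NAUpEv ((k : ℝ≥0∞) + 1)⁻¹ ((n : ℝ≥0∞) + 1)⁻¹ z 2)
    (hpos : ∀ n : ℕ, 0 < z n) : NAGood z := by
  obtain ⟨b, hb⟩ := hB
  have hb' : ∀ q ∈ NAD, z q ≤ b := by
    intro q hq
    by_contra h
    refine hb ⟨[q], by simpa using hq, by simp, ?_⟩
    rw [NAUp, NACond, if_neg (by simp)]
    exact Or.inl ⟨(not_le.1 h).le, NAUp_zero _⟩
  have hbt : ∀ {F : Filter ℝ≥0} [F.NeBot] {L}, (∀ᶠ q in F, q ∈ NAD) → Tendsto z F (𝓝 L) → L ≠ ⊤ := by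
    intro F _ L hF hL
    exact ne_top_of_le_ne_top (ENNReal.natCast_ne_top b) (le_of_tendsto hL (hF.mono hb'))
  refine ⟨fun t => ?_, fun t ht => ?_⟩
  · obtain ⟨L, hL⟩ : ∃ L, Tendsto z (𝓝[Ioi t ∩ NAD] t) (𝓝 L) := by
      refine tendsto_of_no_upcrossings hD fun a ha b hb hab => ?_
      rintro ⟨h1, h2⟩
      obtain ⟨k, hk⟩ := hA a ha b hb hab
      exact hk (NAUp_right h1 h2 k)
    have := NA_dense_right t
    have hev : ∀ᶠ q in 𝓝[Ioi t ∩ NAD] t, q ∈ Ioi t ∩ NAD := self_mem_nhdsWithin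
    refine ⟨L, ?_, hbt (hev.mono fun q hq => hq.2) hL, hL⟩
    obtain ⟨T, hT⟩ := exists_nat_gt t
    obtain ⟨n, hn⟩ := ENNReal.exists_inv_nat_lt (hpos T).ne'
    obtain ⟨k, hk⟩ := hC n
    have hle : ((k : ℝ≥0∞) + 1)⁻¹ ≤ L := by
      refine ge_of_tendsto hL ?_
      have hT' : ∀ᶠ q in 𝓝[Ioi t ∩ NAD] t, q < (T : ℝ≥0) :=
        mem_nhdsWithin_of_mem_nhds (Iio_mem_nhds hT)
      filter_upwards [hev, hT'] with q hq hqT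
      by_contra h
      refine hk ⟨[q, T], ?_, ?_, ?_⟩
      · intro x hx
        rcases List.mem_cons.1 hx with rfl | hx
        · exact hq.2
        · rw [List.mem_singleton.1 hx]; exact nat_mem_NAD T
      · simpa using hqT
      · rw [NAUp, NACond, if_pos (by simp)]
        refine Or.inl ⟨(not_le.1 h).le, ?_⟩
        rw [NAUp, NACond, if_neg (by simp)]
        refine Or.inl ⟨le_trans ?_ hn.le, NAUp_zero _⟩
        exact ENNReal.inv_le_inv.2 le_self_add
    intro h0
    rw [h0] at hle
    simp at hle
  · obtain ⟨L, hL⟩ : ∃ L, Tendsto z (𝓝[Iio t ∩ NAD] t) (𝓝 L) := by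
      refine tendsto_of_no_upcrossings hD fun a ha b hb hab => ?_
      rintro ⟨h1, h2⟩
      obtain ⟨k, hk⟩ := hA a ha b hb hab
      exact hk (NAUp_left ht h1 h2 k)
    rcases (𝓝[Iio t ∩ NAD] t).eq_or_neBot with h0 | h0
    · exact ⟨0, ENNReal.zero_ne_top, by rw [h0]; exact tendsto_bot⟩
    · have hev : ∀ᶠ q in 𝓝[Iio t ∩ NAD] t, q ∈ Iio t ∩ NAD := self_mem_nhdsWithin
      exact ⟨L, hbt (hev.mono fun q hq => hq.2) hL, hL⟩

theorem NA_paths (P : Measure Ω) [IsProbabilityMeasure P] {Z : ℝ≥0 → Ω → ℝ≥0∞}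
    (hZm : ∀ s ∈ NAD, Measurable[ℱ s] (Z s)) (hZ1 : ∫⁻ ω, Z 0 ω ∂P ≤ 1)
    (hZpos : ∀ s ∈ NAD, ∀ᵐ ω ∂P, 0 < Z s ω)
    (hZ : ∀ s ∈ NAD, ∀ t ∈ NAD, s ≤ t → ∀ A, MeasurableSet[ℱ s] A →
        ∫⁻ ω in A, Z t ω ∂P ≤ ∫⁻ ω in A, Z s ω ∂P) :
    ∀ᵐ ω ∂P, NAGood (fun q => Z q ω) := by
  have bnd : ∀ {a b : ℝ≥0∞}, b ≠ 0 → b ≠ ⊤ → ∀ k : ℕ,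
      P {ω | NAUpEv a b (fun q => Z q ω) (2 * k)} ≤ (a / b) ^ k ∧
      P {ω | NAUpEv a b (fun q => Z q ω) (2 * k + 1)} ≤ (a / b) ^ k * b⁻¹ := by
    intro a b hb0 hbt k
    have key := fun (l : List ℝ≥0) (h1 : ∀ q ∈ l, q ∈ NAD) (h2 : l.Pairwise (· ≤ ·)) =>
      NAUp_bound (a := a) P hb0 hbt hZm hZ l 0 zero_mem_NAD h1
        (List.pairwise_cons.2 ⟨fun q _ => zero_le, h2⟩) univ MeasurableSet.univ k
    constructor
    · refine NAUpEv_bound P fun l h1 h2 => ?_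
      simpa using (key l h1 h2).1
    · refine NAUpEv_bound P fun l h1 h2 => ?_
      have := (key l h1 h2).2
      simp only [univ_inter, Measure.restrict_univ] at this
      refine this.trans ?_
      gcongr
      calc b⁻¹ * _ ≤ b⁻¹ * 1 := by gcongr
        _ = b⁻¹ := mul_one _
  obtain ⟨D, hDc, hDd, hD0, hDt⟩ := ENNReal.exists_countable_dense_no_zero_top
  have all : ∀ (E : ℕ → Ω → Prop) (c : ℕ → ℝ≥0∞), (∀ k, P {ω | E k ω} ≤ c k) →
      Tendsto c atTop (𝓝 0) → ∀ᵐ ω ∂P, ∃ k, ¬ E k ω := by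
    intro E c h1 h2
    rw [ae_iff]
    refine le_antisymm (ge_of_tendsto' h2 fun k => (measure_mono ?_).trans (h1 k)) (zero_le)
    intro ω hω
    simp only [not_exists, not_not, mem_ofPred_eq] at hω
    exact hω k
  have hA : ∀ᵐ ω ∂P, ∀ a ∈ D, ∀ b ∈ D, a < b → ∃ k, ¬ NAUpEv a b (fun q => Z q ω) k := by
    rw [ae_ball_iff hDc]
    intro a ha
    rw [ae_ball_iff hDc]
    intro b hb
    by_cases hab : a < b
    · have hb0 : b ≠ 0 := fun h => hD0 (h ▸ hb)
      have hbt : b ≠ ⊤ := fun h => hDt (h ▸ hb)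
      have := all (fun k ω => NAUpEv a b (fun q => Z q ω) (2 * k)) _ (fun k => (bnd hb0 hbt k).1)
        (ENNReal.tendsto_pow_atTop_nhds_zero_of_lt_one (ENNReal.div_lt_of_lt_mul (by simpa using hab)))
      filter_upwards [this] with ω hω _
      obtain ⟨k, hk⟩ := hω
      exact ⟨_, hk⟩
    · exact Eventually.of_forall fun ω h => (hab h).elim
  have hB : ∀ᵐ ω ∂P, ∃ b : ℕ, ¬ NAUpEv 0 (b : ℝ≥0∞) (fun q => Z q ω) 1 := by
    have := all (fun k ω => NAUpEv 0 ((k + 1 : ℕ) : ℝ≥0∞) (fun q => Z q ω) 1) _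
      (fun k => by
        have := (bnd (a := 0) (b := ((k + 1 : ℕ) : ℝ≥0∞)) (by exact_mod_cast Nat.succ_ne_zero k)
          (ENNReal.natCast_ne_top _) 0).2
        simpa only [pow_zero, one_mul, mul_zero, zero_add, Function.comp] using this)
      (ENNReal.tendsto_inv_nat_nhds_zero.comp (tendsto_add_atTop_nat 1))
    filter_upwards [this] with ω hω
    obtain ⟨k, hk⟩ := hω
    exact ⟨_, hk⟩
  have hC : ∀ᵐ ω ∂P, ∀ n : ℕ, ∃ k : ℕ,
      ¬ NAUpEv ((k : ℝ≥0∞) + 1)⁻¹ ((n : ℝ≥0∞) + 1)⁻¹ (fun q => Z q ω) 2 := by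
    rw [ae_all_iff]
    intro n
    have hn : ((n : ℝ≥0∞) + 1) ≠ ⊤ := by finiteness
    refine all (fun k ω => NAUpEv ((k : ℝ≥0∞) + 1)⁻¹ ((n : ℝ≥0∞) + 1)⁻¹ (fun q => Z q ω) 2)
      (fun k => ((k : ℝ≥0∞) + 1)⁻¹ * ((n : ℝ≥0∞) + 1))
      (fun k => by
        have := (bnd (a := ((k : ℝ≥0∞) + 1)⁻¹) (b := ((n : ℝ≥0∞) + 1)⁻¹) (ENNReal.inv_ne_zero.2 hn)
          (by simp) 1).1
        simpa only [pow_one, mul_one, div_eq_mul_inv, inv_inv] using this) ?_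
    have h0 : Tendsto (fun k : ℕ => ((k : ℝ≥0∞) + 1)⁻¹) atTop (𝓝 0) := by
      have := ENNReal.tendsto_inv_nat_nhds_zero.comp (tendsto_add_atTop_nat 1)
      refine this.congr fun k => ?_
      simp
    have := ENNReal.Tendsto.mul_const h0 (Or.inr hn)
    simpa using this
  have hpos : ∀ᵐ ω ∂P, ∀ n : ℕ, 0 < Z n ω := ae_all_iff.2 fun n => hZpos n (nat_mem_NAD n)
  filter_upwards [hA, hB, hC, hpos] with ω h1 h2 h3 h4
  exact NAGood_of hDd h1 h2 h3 h4

end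
end

noncomputable section
open MeasureTheory Set Filter
open scoped NNReal ENNReal Topology

section general
variable {Ω : Type*} {m0 m : MeasurableSpace Ω}

theorem NA_weight_le (hm : m0 ≤ m) (P : Measure Ω) {U V : Ω → ℝ≥0∞} (hU : Measurable U)
    (hV : Measurable V) (h : ∀ A, MeasurableSet[m0] A → ∫⁻ ω in A, U ω ∂P ≤ ∫⁻ ω in A, V ω ∂P)
    {W : Ω → ℝ≥0∞} (hW : Measurable[m0] W) :
    ∫⁻ ω, W ω * U ω ∂P ≤ ∫⁻ ω, W ω * V ω ∂P := by
  have hW' : Measurable W := hW.mono hm le_rfl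
  have e : (P.withDensity U).trim hm ≤ (P.withDensity V).trim hm := by
    refine @Measure.le_intro _ m0 _ _ fun A hA _ => ?_
    rw [trim_measurableSet_eq hm hA, trim_measurableSet_eq hm hA,
      withDensity_apply _ (hm _ hA), withDensity_apply _ (hm _ hA)]
    exact h A hA
  calc ∫⁻ ω, W ω * U ω ∂P = ∫⁻ ω, W ω ∂(P.withDensity U) := by
        rw [lintegral_withDensity_eq_lintegral_mul _ hU hW']
        simp only [Pi.mul_apply, mul_comm]
    _ ≤ ∫⁻ ω, W ω ∂(P.withDensity V) := by
        rw [← lintegral_trim hm hW, ← lintegral_trim hm hW]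
        exact lintegral_mono' e le_rfl
    _ = _ := by
        rw [lintegral_withDensity_eq_lintegral_mul _ hV hW']
        simp only [Pi.mul_apply, mul_comm]

theorem NA_min_le (hm : m0 ≤ m) (P : Measure Ω) {U V : Ω → ℝ≥0∞} (hV : Measurable[m0] V)
    (h : ∀ A, MeasurableSet[m0] A → ∫⁻ ω in A, U ω ∂P ≤ ∫⁻ ω in A, V ω ∂P) (K : ℝ≥0∞)
    (A : Set Ω) (hA : MeasurableSet[m0] A) :
    ∫⁻ ω in A, min (U ω) K ∂P ≤ ∫⁻ ω in A, min (V ω) K ∂P := by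
  have hC : MeasurableSet[m0] {ω | V ω ≤ K} := hV measurableSet_Iic
  set C := {ω | V ω ≤ K}
  rw [← lintegral_inter_add_sdiff _ A (hm _ hC), ← lintegral_inter_add_sdiff (fun ω => min (V ω) K)
    A (hm _ hC)]
  refine add_le_add ?_ ?_
  · calc ∫⁻ ω in A ∩ C, min (U ω) K ∂P ≤ ∫⁻ ω in A ∩ C, U ω ∂P :=
          lintegral_mono fun ω => min_le_left _ _
      _ ≤ ∫⁻ ω in A ∩ C, V ω ∂P := h _ (hA.inter hC)
      _ = _ := setLIntegral_congr_fun (hm _ (hA.inter hC)) fun ω hω => (min_eq_left hω.2).symm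
  · refine setLIntegral_mono' (hm _ (hA.diff hC)) fun ω hω => ?_
    have hK : K ≤ V ω := (not_le.1 (fun h' => hω.2 h')).le
    calc min (U ω) K ≤ K := min_le_right _ _
      _ = min (V ω) K := (min_eq_right hK).symm

theorem NA_lim_min {m : MeasurableSpace Ω} (P : Measure Ω) [IsFiniteMeasure P]
    {F G : ℕ → Ω → ℝ≥0∞} {F' G' : Ω → ℝ≥0∞}
    (hF : ∀ n, Measurable (F n)) (hG : ∀ n, Measurable (G n)) {K : ℝ≥0∞} (hK : K ≠ ⊤)
    (h : ∀ n, ∫⁻ ω, min (F n ω) K ∂P ≤ ∫⁻ ω, min (G n ω) K ∂P)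
    (hF' : ∀ᵐ ω ∂P, Tendsto (fun n => F n ω) atTop (𝓝 (F' ω)))
    (hG' : ∀ᵐ ω ∂P, Tendsto (fun n => G n ω) atTop (𝓝 (G' ω))) :
    ∫⁻ ω, min (F' ω) K ∂P ≤ ∫⁻ ω, min (G' ω) K ∂P := by
  have key : ∀ {F : ℕ → Ω → ℝ≥0∞} {F' : Ω → ℝ≥0∞}, (∀ n, Measurable (F n)) →
      (∀ᵐ ω ∂P, Tendsto (fun n => F n ω) atTop (𝓝 (F' ω))) →
      Tendsto (fun n => ∫⁻ ω, min (F n ω) K ∂P) atTop (𝓝 (∫⁻ ω, min (F' ω) K ∂P)) := by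
    intro F F' h1 h2
    refine tendsto_lintegral_of_dominated_convergence (fun _ => K)
      (fun n => (h1 n).min measurable_const) (fun n => Eventually.of_forall fun ω => min_le_right _ _)
      ?_ ?_
    · rw [lintegral_const]; exact ENNReal.mul_ne_top hK (measure_ne_top _ _)
    · filter_upwards [h2] with ω hω
      exact hω.min tendsto_const_nhds
  exact le_of_tendsto_of_tendsto' (key hF hF') (key hG hG') h

theorem NA_of_min {m : MeasurableSpace Ω} (P : Measure Ω)
    {F G : Ω → ℝ≥0∞} (hF : Measurable F)
    (h : ∀ K : ℕ, ∫⁻ ω, min (F ω) K ∂P ≤ ∫⁻ ω, min (G ω) K ∂P) :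
    ∫⁻ ω, F ω ∂P ≤ ∫⁻ ω, G ω ∂P := by
  have e : ∀ ω, F ω = ⨆ K : ℕ, min (F ω) (K : ℝ≥0∞) := by
    intro ω
    have : F ω = min (F ω) (⨆ K : ℕ, (K : ℝ≥0∞)) := by rw [ENNReal.iSup_natCast]; simp
    conv_lhs => rw [this]
    exact inf_iSup_eq _ _
  calc ∫⁻ ω, F ω ∂P = ∫⁻ ω, ⨆ K : ℕ, min (F ω) (K : ℝ≥0∞) ∂P := lintegral_congr e
    _ = ⨆ K : ℕ, ∫⁻ ω, min (F ω) (K : ℝ≥0∞) ∂P :=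
        lintegral_iSup (fun K => hF.min measurable_const)
          (fun a b hab ω => min_le_min le_rfl (by exact_mod_cast hab))
    _ ≤ _ := iSup_le fun K => (h K).trans (lintegral_mono fun ω => min_le_left _ _)

end general

/-- Dyadic approximation from the right. -/
def NAd (n : ℕ) (t : ℝ≥0) : ℝ≥0 := NAdt n (⌊t * 2 ^ n⌋₊ + 1)

theorem NAd_mem (n : ℕ) (t : ℝ≥0) : NAd n t ∈ NAD := ⟨_, _, rfl⟩

theorem lt_NAd (n : ℕ) (t : ℝ≥0) : t < NAd n t := by
  have hp : (0:ℝ≥0) < 2 ^ n := by positivity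
  rw [NAd, NAdt, lt_div_iff₀ hp]
  exact_mod_cast Nat.lt_floor_add_one (t * 2 ^ n)

theorem NAd_le (n : ℕ) (t : ℝ≥0) : NAd n t ≤ t + (1/2) ^ n := by
  have hp : (0:ℝ≥0) < 2 ^ n := by positivity
  rw [NAd, NAdt, div_le_iff₀ hp, add_mul]
  have h3 : ((1/2 : ℝ≥0)) ^ n * 2 ^ n = 1 := by rw [← mul_pow]; norm_num
  rw [h3]
  push_cast
  gcongr
  exact Nat.floor_le (zero_le)

theorem NAd_mono (n : ℕ) {s t : ℝ≥0} (h : s ≤ t) : NAd n s ≤ NAd n t := by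
  apply NAdt_mono
  gcongr

theorem NAd_tendsto (t : ℝ≥0) : Tendsto (fun n => NAd n t) atTop (𝓝[Ioi t ∩ NAD] t) := by
  refine tendsto_nhdsWithin_iff.2 ⟨?_, Eventually.of_forall fun n => ⟨lt_NAd n t, NAd_mem n t⟩⟩
  have h0 : (1/2 : ℝ≥0) < 1 := by rw [← NNReal.coe_lt_coe]; norm_num
  have h : Tendsto (fun n : ℕ => t + (1/2 : ℝ≥0) ^ n) atTop (𝓝 (t + 0)) :=
    tendsto_const_nhds.add (NNReal.tendsto_pow_atTop_nhds_zero_of_lt_one h0)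
  rw [add_zero] at h
  exact tendsto_of_tendsto_of_tendsto_of_le_of_le tendsto_const_nhds h (fun n => (lt_NAd n t).le)
    (fun n => NAd_le n t)

theorem NA_regularize {E : Type*} [TopologicalSpace E] [RegularSpace E] {z y : ℝ≥0 → E}
    (h : ∀ t, Tendsto z (𝓝[Ioi t ∩ NAD] t) (𝓝 (y t))) :
    (∀ t, ContinuousWithinAt y (Ici t) t) ∧
    ∀ t, 0 < t → ∀ L, Tendsto z (𝓝[Iio t ∩ NAD] t) (𝓝 L) → Tendsto y (𝓝[Iio t] t) (𝓝 L) := by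
  have mem : ∀ {V : Set E} {r u v : ℝ≥0}, IsClosed V → u < r → r < v →
      (∀ q ∈ Ioo u v, q ∈ NAD → z q ∈ V) → y r ∈ V := by
    intro V r u v hV hu hv hz
    have := NA_dense_right r
    refine hV.mem_of_tendsto (h r) ?_
    have h1 : ∀ᶠ q in 𝓝[Ioi r ∩ NAD] r, q ∈ Ioi r ∩ NAD := self_mem_nhdsWithin
    have h2 : ∀ᶠ q in 𝓝[Ioi r ∩ NAD] r, q < v := mem_nhdsWithin_of_mem_nhds (Iio_mem_nhds hv)
    filter_upwards [h1, h2] with q hq hq2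
    exact hz q ⟨hu.trans hq.1, hq2⟩ hq.2
  constructor
  · intro t
    rw [← continuousWithinAt_Ioi_iff_Ici]
    refine (closed_nhds_basis (y t)).tendsto_right_iff.2 ?_
    rintro V ⟨hV1, hV2⟩
    have h1 := h t hV1
    rw [mem_map, mem_nhdsWithin] at h1
    obtain ⟨O, hO, htO, hsub⟩ := h1
    have h2 : ∀ᶠ r in 𝓝[>] t, ∀ q ∈ Ioo t r, q ∈ O := by
      obtain ⟨v, hv, hv2⟩ := exists_Ico_subset_of_mem_nhds (hO.mem_nhds htO) ⟨t + 1, lt_add_one t⟩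
      filter_upwards [Ioo_mem_nhdsGT hv] with r hr q hq
      exact hv2 ⟨hq.1.le, hq.2.trans hr.2⟩
    obtain ⟨v, hv, hv2⟩ := exists_Ico_subset_of_mem_nhds (hO.mem_nhds htO) ⟨t + 1, lt_add_one t⟩
    filter_upwards [Ioo_mem_nhdsGT hv] with r hr
    exact mem hV2 hr.1 hr.2 fun q hq hqD => hsub ⟨hv2 ⟨hq.1.le, hq.2⟩, hq.1, hqD⟩
  · intro t ht L hL
    refine (closed_nhds_basis L).tendsto_right_iff.2 ?_
    rintro V ⟨hV1, hV2⟩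
    have h1 := hL hV1
    rw [mem_map, mem_nhdsWithin] at h1
    obtain ⟨O, hO, htO, hsub⟩ := h1
    obtain ⟨v, hv, hv2⟩ := exists_Ioc_subset_of_mem_nhds (hO.mem_nhds htO) ⟨0, ht⟩
    filter_upwards [Ioo_mem_nhdsLT hv] with r hr
    exact mem hV2 hr.1 hr.2 fun q hq hqD => hsub ⟨hv2 ⟨hq.1, hq.2.le⟩, hq.2, hqD⟩

theorem NA_meas_of_gt {Ω : Type*} {m : MeasurableSpace Ω} {ℱ : Filtration ℝ≥0 m}
    (hright : RightContinuousFiltration ℱ) {E : Type*} [MeasurableSpace E] {t : ℝ≥0} {f : Ω → E}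
    (h : ∀ u, t < u → Measurable[ℱ u] f) : Measurable[ℱ t] f := by
  intro s hs
  rw [hright t]
  rw [MeasurableSpace.measurableSet_iInf]
  intro u
  rw [MeasurableSpace.measurableSet_iInf]
  intro hu
  exact h u hu hs

section
variable {Ω : Type*} {m : MeasurableSpace Ω} {ℱ : Filtration ℝ≥0 m} {ι : Type*}
    {B : ℝ≥0 → ι → Ω → ℝ≥0}

theorem NA_exists_Y (P : Measure Ω) [IsProbabilityMeasure P]
    (hright : RightContinuousFiltration ℱ) (hcompl : CompleteFiltration ℱ P)
    (hB : ∀ t i, Measurable[ℱ t] (B t i))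
    (hBc : ∀ i ω t, ContinuousWithinAt (fun t => B t i ω) (Ici t) t)
    {Z : ℝ≥0 → Ω → ℝ≥0∞} (hZm : ∀ s ∈ NAD, Measurable[ℱ s] (Z s))
    (hZB : ∀ s ∈ NAD, ∀ t ∈ NAD, s ≤ t → ∀ i, ∀ A, MeasurableSet[ℱ s] A →
        ∫⁻ ω in A, B t i ω * Z t ω ∂P ≤ ∫⁻ ω in A, B s i ω * Z s ω ∂P)
    (hgood : ∀ᵐ ω ∂P, NAGood (fun q => Z q ω)) :
    ∃ Y : ℝ≥0 → Ω → ℝ≥0, (∀ t, Measurable[ℱ t] (Y t)) ∧ (∀ ω, Y 0 ω = 1) ∧ (∀ t ω, 0 < Y t ω) ∧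
      (∀ ω, IsCadlag (fun t => Y t ω)) ∧
      ∀ i s t, s ≤ t → ∀ A, MeasurableSet[ℱ s] A →
        ∫⁻ ω in A, ((B t i ω * Y t ω : ℝ≥0) : ℝ≥0∞) ∂P ≤
          ∫⁻ ω in A, ((B s i ω * Y s ω : ℝ≥0) : ℝ≥0∞) ∂P := by
  classical
  obtain ⟨N, hNsub, hNm, hN0⟩ := exists_measurable_superset_of_null (ae_iff.1 hgood)
  have hNF : ∀ t, MeasurableSet[ℱ t] N := fun t => ℱ.mono zero_le _ (hcompl N hNm hN0)
  have hg : ∀ ω, ω ∉ N → NAGood (fun q => Z q ω) := by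
    intro ω hω; by_contra h; exact hω (hNsub h)
  let y : ℝ≥0 → Ω → ℝ≥0∞ := fun t ω => if ω ∈ N then 1 else liminf (fun n => Z (NAd n t) ω) atTop
  let z : ℝ≥0 → Ω → ℝ≥0∞ := fun t ω => if ω ∈ N then 1 else Z t ω
  have hz : ∀ ω, NAGood (fun q => z q ω) := by
    intro ω
    by_cases h : ω ∈ N
    · simp only [z, h, if_true]
      exact ⟨fun t => ⟨1, one_ne_zero, ENNReal.one_ne_top, tendsto_const_nhds⟩,
        fun t _ => ⟨1, ENNReal.one_ne_top, tendsto_const_nhds⟩⟩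
    · simpa only [z, h, if_false] using hg ω h
  have hy : ∀ ω t, y t ω ≠ 0 ∧ y t ω ≠ ⊤ ∧ Tendsto (fun q => z q ω) (𝓝[Ioi t ∩ NAD] t) (𝓝 (y t ω)) := by
    intro ω t
    obtain ⟨L, h0, h1, h2⟩ := (hz ω).1 t
    have : y t ω = L := by
      by_cases h : ω ∈ N
      · simp only [y, z, h, if_true] at h2 ⊢
        have := NA_dense_right t
        exact tendsto_nhds_unique tendsto_const_nhds h2
      · simp only [y, z, h, if_false] at h2 ⊢
        exact (h2.comp (NAd_tendsto t)).liminf_eq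
    rw [this]; exact ⟨h0, h1, h2⟩
  have hym : ∀ t, Measurable[ℱ t] (y t) := by
    intro t
    refine NA_meas_of_gt hright fun u hu => ?_
    refine Measurable.ite (hNF u) measurable_const ?_
    have hev : ∀ᶠ n in atTop, NAd n t < u :=
      (tendsto_nhdsWithin_iff.1 (NAd_tendsto t)).1 (Iio_mem_nhds hu)
    obtain ⟨k, hk⟩ := eventually_atTop.1 hev
    have e : (fun ω => liminf (fun n => Z (NAd n t) ω) atTop) =
        fun ω => liminf (fun n => Z (NAd (n + k) t) ω) atTop := by
      funext ω
      exact (liminf_nat_add (fun n => Z (NAd n t) ω) k).symm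
    rw [e]
    refine Measurable.liminf (f := fun n ω => Z (NAd (n + k) t) ω) fun n => ?_
    exact (hZm _ (NAd_mem _ _)).mono (ℱ.mono (hk _ (Nat.le_add_left _ _)).le) le_rfl
  let Y1 : ℝ≥0 → Ω → ℝ≥0 := fun t ω => (y t ω).toNNReal
  have hY1 : ∀ t ω, (Y1 t ω : ℝ≥0∞) = y t ω := fun t ω => ENNReal.coe_toNNReal (hy ω t).2.1
  have hY1m : ∀ t, Measurable[ℱ t] (Y1 t) := fun t => ENNReal.measurable_toNNReal.comp (hym t)
  have hY1pos : ∀ t ω, 0 < Y1 t ω := fun t ω =>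
    ENNReal.toNNReal_pos (hy ω t).1 (hy ω t).2.1
  have hY1c : ∀ ω, IsCadlag (fun t => Y1 t ω) := by
    intro ω
    have h := NA_regularize (fun t => (hy ω t).2.2)
    refine ⟨fun t => ?_, fun t ht => ?_⟩
    · exact (ENNReal.tendsto_toNNReal (hy ω t).2.1).comp (h.1 t)
    · obtain ⟨L, hL, hL2⟩ := (hz ω).2 t ht
      exact ⟨L.toNNReal, (ENNReal.tendsto_toNNReal hL).comp (h.2 t ht L hL2)⟩
  have hBm : ∀ t i, Measurable (B t i) := fun t i => (hB t i).mono (ℱ.le t) le_rfl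
  have hNae : ∀ᵐ ω ∂P, ω ∉ N := measure_eq_zero_iff_ae_notMem.1 hN0
  have ineq1 : ∀ i s t, s ≤ t → ∀ A, MeasurableSet[ℱ s] A →
        ∫⁻ ω in A, ((B t i ω * Y1 t ω : ℝ≥0) : ℝ≥0∞) ∂P ≤
          ∫⁻ ω in A, ((B s i ω * Y1 s ω : ℝ≥0) : ℝ≥0∞) ∂P := by
    intro i s t hst A hA
    have hlim : ∀ t, ∀ᵐ ω ∂(P.restrict A),
        Tendsto (fun n => (B (NAd n t) i ω : ℝ≥0∞) * Z (NAd n t) ω) atTop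
          (𝓝 ((B t i ω * Y1 t ω : ℝ≥0) : ℝ≥0∞)) := by
      intro t
      filter_upwards [ae_restrict_of_ae hNae] with ω hω
      have h1 := (hy ω t).2.2.comp (NAd_tendsto t)
      have h2 : Tendsto (fun n => B (NAd n t) i ω) atTop (𝓝 (B t i ω)) :=
        (hBc i ω t).tendsto.comp ((NAd_tendsto t).mono_right
          (nhdsWithin_mono _ fun q hq => mem_Ici.2 (le_of_lt (mem_Ioi.1 hq.1))))
      have h3 := ENNReal.Tendsto.mul (ENNReal.tendsto_coe.2 h2) (Or.inr (hy ω t).2.1) h1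
        (Or.inr ENNReal.coe_ne_top)
      rw [← hY1, ← ENNReal.coe_mul] at h3
      refine h3.congr fun n => ?_
      simp [z, hω]
    refine NA_of_min _ ((hBm t i).mul ((hY1m t).mono (ℱ.le t) le_rfl)).coe_nnreal_ennreal fun K => ?_
    have hmm : ∀ t n, Measurable fun ω => (B (NAd n t) i ω : ℝ≥0∞) * Z (NAd n t) ω := fun t n =>
      (hBm _ i).coe_nnreal_ennreal.mul ((hZm _ (NAd_mem n t)).mono (ℱ.le _) le_rfl)
    refine NA_lim_min (P.restrict A) (hmm t) (hmm s) (ENNReal.natCast_ne_top K) ?_ (hlim t) (hlim s)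
    intro n
    refine NA_min_le (ℱ.le (NAd n s)) P ?_ ?_ K A (ℱ.mono (lt_NAd n s).le _ hA)
    · exact (hB _ i).coe_nnreal_ennreal.mul (hZm _ (NAd_mem n s))
    · exact fun A hA => hZB _ (NAd_mem n s) _ (NAd_mem n t) (NAd_mono n hst) i A hA
  refine ⟨fun t ω => Y1 t ω / Y1 0 ω, fun t => (hY1m t).div ((hY1m 0).mono (ℱ.mono zero_le) le_rfl),
    fun ω => div_self (hY1pos 0 ω).ne', fun t ω => div_pos (hY1pos t ω) (hY1pos 0 ω),
    fun ω => ⟨fun t => ((hY1c ω).1 t).div_const _, fun t ht => ?_⟩, ?_⟩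
  · obtain ⟨L, hL⟩ := (hY1c ω).2 t ht
    exact ⟨_, hL.div_const _⟩
  · intro i s t hst A hA
    have hA' := ℱ.le s _ hA
    have hmm : ∀ t, Measurable fun ω => ((B t i ω * Y1 t ω : ℝ≥0) : ℝ≥0∞) := fun t =>
      ((hBm t i).mul ((hY1m t).mono (ℱ.le t) le_rfl)).coe_nnreal_ennreal
    have hW : Measurable[ℱ s] (A.indicator fun ω => (((Y1 0 ω)⁻¹ : ℝ≥0) : ℝ≥0∞)) :=
      Measurable.indicator (((hY1m 0).mono (ℱ.mono zero_le) le_rfl).inv).coe_nnreal_ennreal hA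
    have := NA_weight_le (ℱ.le s) P (hmm t) (hmm s) (ineq1 i s t hst) hW
    have e : ∀ t, ∫⁻ ω in A, ((B t i ω * (Y1 t ω / Y1 0 ω) : ℝ≥0) : ℝ≥0∞) ∂P =
        ∫⁻ ω, A.indicator (fun ω => (((Y1 0 ω)⁻¹ : ℝ≥0) : ℝ≥0∞)) ω *
          ((B t i ω * Y1 t ω : ℝ≥0) : ℝ≥0∞) ∂P := by
      intro t
      rw [← lintegral_indicator hA']
      refine lintegral_congr fun ω => ?_
      by_cases h : ω ∈ A
      · simp only [h, indicator_of_mem]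
        rw [← ENNReal.coe_mul]
        congr 1
        rw [div_eq_mul_inv]; ring
      · simp [h]
    rw [e, e]
    exact this

end
end

noncomputable section
open MeasureTheory Set Filter
open scoped NNReal ENNReal Topology

section
variable {Ω : Type*} {m : MeasurableSpace Ω} {ℱ : Filtration ℝ≥0 m}

theorem NA_stop_le {σ : Ω → ℝ≥0} (hσ : IsStoppingTime ℱ (fun ω => (σ ω : WithTop ℝ≥0))) (u : ℝ≥0) :
    MeasurableSet[ℱ u] {ω | σ ω ≤ u} := by
  have h := hσ u
  have e : {ω | σ ω ≤ u} = {ω | (σ ω : WithTop ℝ≥0) ≤ u} := by ext ω; simp only [mem_ofPred_eq, WithTop.coe_le_coe]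
  rw [e]
  exact h

theorem NA_stop_lt {σ : Ω → ℝ≥0} (hσ : IsStoppingTime ℱ (fun ω => (σ ω : WithTop ℝ≥0))) (u : ℝ≥0) :
    MeasurableSet[ℱ u] {ω | σ ω < u} := by
  have h := hσ.measurableSet_lt u
  have e : {ω | σ ω < u} = {ω | (σ ω : WithTop ℝ≥0) < u} := by ext ω; simp only [mem_ofPred_eq, WithTop.coe_lt_coe]
  rw [e]
  exact h

theorem NA_stop_inter_le {σ : Ω → ℝ≥0} (hσ : IsStoppingTime ℱ (fun ω => (σ ω : WithTop ℝ≥0)))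
    {A : Set Ω} (hA : MeasurableSet[hσ.measurableSpace] A) (u : ℝ≥0) :
    MeasurableSet[ℱ u] (A ∩ {ω | σ ω ≤ u}) := by
  have h := ((hσ.measurableSet A).1 hA).2 u
  have e : {ω | σ ω ≤ u} = {ω | (σ ω : WithTop ℝ≥0) ≤ u} := by ext ω; simp only [mem_ofPred_eq, WithTop.coe_le_coe]
  rw [e]
  exact h

theorem NA_stop_of {σ : Ω → ℝ≥0} (hσ : IsStoppingTime ℱ (fun ω => (σ ω : WithTop ℝ≥0)))
    {A : Set Ω} (h : ∀ u, MeasurableSet[ℱ u] (A ∩ {ω | σ ω ≤ u})) :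
    MeasurableSet[hσ.measurableSpace] A := by
  refine (hσ.measurableSet A).2 ⟨?_, fun u => ?_⟩
  · have e : A = ⋃ n : ℕ, A ∩ {ω | σ ω ≤ n} := by
      ext ω
      simp only [mem_iUnion, mem_inter_iff, mem_ofPred_eq]
      constructor
      · intro h
        obtain ⟨n, hn⟩ := exists_nat_ge (σ ω)
        exact ⟨n, h, hn⟩
      · rintro ⟨n, h, _⟩
        exact h
    rw [e]
    exact MeasurableSet.iUnion fun n => le_iSup (fun t => (ℱ t : MeasurableSpace Ω)) (n : ℝ≥0) _ (h n)
  · have e : {ω | σ ω ≤ u} = {ω | (σ ω : WithTop ℝ≥0) ≤ u} :=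
      by ext ω; simp only [mem_ofPred_eq, WithTop.coe_le_coe]
    have h' := h u
    rw [e] at h'
    exact h'

theorem NA_stop_meas_const {ρ : Ω → ℝ≥0} (hρ : IsStoppingTime ℱ (fun ω => (ρ ω : WithTop ℝ≥0)))
    {t : ℝ≥0} (ht : ∀ ω, ρ ω ≤ t) : Measurable[ℱ t] ρ := by
  refine @measurable_of_Iic _ _ _ _ _ (ℱ t) _ _ _ _ fun c => ?_
  by_cases h : c ≤ t
  · exact ℱ.mono h _ (NA_stop_le hρ c)
  · have : ρ ⁻¹' Iic c = univ := by
      ext ω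
      simp [(ht ω).trans (not_le.1 h).le]
    rw [this]
    exact MeasurableSet.univ

theorem NA_meas_idx {Ω : Type*} {m0 : MeasurableSpace Ω} {E : Type*} [MeasurableSpace E]
    {G : ℕ → Ω → E} (hG : ∀ k, Measurable (G k)) {a : Ω → ℕ} (ha : Measurable a) :
    Measurable (fun ω => G (a ω) ω) := by
  have h2 : Measurable (fun p : ℕ × Ω => G p.1 p.2) :=
    measurable_from_prod_countable_right fun k => hG k
  exact h2.comp (ha.prodMk measurable_id)

theorem NA_meas_floor {Ω : Type*} {m0 : MeasurableSpace Ω} {ρ : Ω → ℝ≥0} (hρ : Measurable ρ)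
    (n : ℕ) : Measurable (fun ω => ⌊ρ ω * 2 ^ n⌋₊ + 1) :=
  (Nat.measurable_floor.comp (hρ.mul_const _)).add_const 1

theorem NA_meas_at (hright : RightContinuousFiltration ℱ) {E : Type*} [TopologicalSpace E]
    [TopologicalSpace.PseudoMetrizableSpace E] [MeasurableSpace E] [BorelSpace E]
    {M : ℝ≥0 → Ω → E} (hM : ∀ t, Measurable[ℱ t] (M t))
    (hMc : ∀ ω t, ContinuousWithinAt (fun t => M t ω) (Ici t) t)
    {ρ : Ω → ℝ≥0} {t : ℝ≥0} (hρ : Measurable[ℱ t] ρ) (ht : ∀ ω, ρ ω ≤ t) :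
    Measurable[ℱ t] (fun ω => M (ρ ω) ω) := by
  refine NA_meas_of_gt hright fun u hu => ?_
  have hρu : Measurable[ℱ u] ρ := hρ.mono (ℱ.mono hu.le) le_rfl
  refine @measurable_of_tendsto_metrizable _ _ (ℱ u) _ _ _ _
    (fun n ω => M (min (NAd n (ρ ω)) u) ω) _ (fun n => ?_) ?_
  · exact @NA_meas_idx _ (ℱ u) _ _ (fun k ω => M (min (NAdt n k) u) ω)
      (fun k => (hM _).mono (ℱ.mono (min_le_right _ _)) le_rfl) _ (@NA_meas_floor _ (ℱ u) _ hρu n)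
  · rw [tendsto_pi_nhds]
    intro ω
    refine (hMc ω (ρ ω)).tendsto.comp (tendsto_nhdsWithin_iff.2 ⟨?_, ?_⟩)
    · have h3 : Tendsto (fun n => min (NAd n (ρ ω)) u) atTop (𝓝 (min (ρ ω) u)) :=
        (tendsto_nhdsWithin_iff.1 (NAd_tendsto (ρ ω))).1.min tendsto_const_nhds
      rwa [min_eq_left ((ht ω).trans hu.le)] at h3
    · exact Eventually.of_forall fun n => le_min (lt_NAd _ _).le ((ht ω).trans hu.le)

/-- Discrete optional stopping. -/
theorem NA_opt_discrete (P : Measure Ω) {𝒢 : ℕ → MeasurableSpace Ω} (h𝒢 : ∀ k, 𝒢 k ≤ m)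
    {G : ℕ → Ω → ℝ≥0∞}
    (hG : ∀ k A, MeasurableSet[𝒢 k] A → ∫⁻ ω in A, G (k + 1) ω ∂P ≤ ∫⁻ ω in A, G k ω ∂P)
    {a b : Ω → ℕ} (L : ℕ) (hab : ∀ ω, a ω ≤ b ω) (hb : ∀ ω, b ω ≤ L)
    {A : Set Ω} (hA : MeasurableSet A) (hset : ∀ k, MeasurableSet[𝒢 k] (A ∩ {ω | a ω ≤ k ∧ k < b ω})) :
    ∫⁻ ω in A, G (b ω) ω ∂P ≤ ∫⁻ ω in A, G (a ω) ω ∂P := by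
  have key : ∀ k, ∫⁻ ω in A, G (max (a ω) (min (b ω) k)) ω ∂P ≤ ∫⁻ ω in A, G (a ω) ω ∂P := by
    intro k
    induction k with
    | zero => simp
    | succ k ih =>
      refine le_trans ?_ ih
      have hC := hset k
      have hC' := h𝒢 k _ hC
      set C := A ∩ {ω | a ω ≤ k ∧ k < b ω} with hCdef
      rw [← lintegral_inter_add_sdiff _ A hC',
        ← lintegral_inter_add_sdiff (fun ω => G (max (a ω) (min (b ω) k)) ω) A hC']
      have hAC : A ∩ C = C := inter_eq_right.2 inter_subset_left
      rw [hAC]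
      refine add_le_add ?_ ?_
      · calc _ = ∫⁻ ω in C, G (k + 1) ω ∂P := setLIntegral_congr_fun hC' fun ω hω => by
              have h1 := hω.2.1
              have h2 := hω.2.2
              have : max (a ω) (min (b ω) (k + 1)) = k + 1 := by omega
              simp only [this]
          _ ≤ ∫⁻ ω in C, G k ω ∂P := hG k C hC
          _ = _ := setLIntegral_congr_fun hC' fun ω hω => by
              have h1 := hω.2.1
              have h2 := hω.2.2
              have : max (a ω) (min (b ω) k) = k := by omega
              simp only [this]
      · refine le_of_eq (setLIntegral_congr_fun (hA.diff hC') fun ω hω => ?_)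
        have h1 : ¬ (a ω ≤ k ∧ k < b ω) := fun h => hω.2 ⟨hω.1, h⟩
        have h2 := hab ω
        have : max (a ω) (min (b ω) (k + 1)) = max (a ω) (min (b ω) k) := by omega
        simp only [this]
  have h := key L
  have e : ∀ ω, max (a ω) (min (b ω) L) = b ω := by
    intro ω
    rw [min_eq_left (hb ω), max_eq_right (hab ω)]
  simpa only [e] using h

theorem NA_floor_le {n k : ℕ} {x : ℝ≥0} : ⌊x * 2 ^ n⌋₊ + 1 ≤ k ↔ x < NAdt n k := by
  have hp : (0:ℝ≥0) < 2 ^ n := by positivity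
  rw [NAdt, lt_div_iff₀ hp, Nat.succ_le_iff, Nat.floor_lt zero_le]

theorem NA_opt_set (P : Measure Ω) [IsProbabilityMeasure P] (hright : RightContinuousFiltration ℱ)
    {M : ℝ≥0 → Ω → ℝ≥0} (hM : ∀ t, Measurable[ℱ t] (M t))
    (hMc : ∀ ω t, ContinuousWithinAt (fun t => M t ω) (Ici t) t)
    (hMs : ∀ s t, s ≤ t → ∀ A, MeasurableSet[ℱ s] A →
      ∫⁻ ω in A, (M t ω : ℝ≥0∞) ∂P ≤ ∫⁻ ω in A, (M s ω : ℝ≥0∞) ∂P)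
    {σ ρ : Ω → ℝ≥0} (hσ : IsStoppingTime ℱ (fun ω => (σ ω : WithTop ℝ≥0)))
    (hρ : IsStoppingTime ℱ (fun ω => (ρ ω : WithTop ℝ≥0))) (hσρ : ∀ ω, σ ω ≤ ρ ω)
    {t : ℝ≥0} (ht : ∀ ω, ρ ω ≤ t) {A : Set Ω} (hA : MeasurableSet[hσ.measurableSpace] A) :
    ∫⁻ ω in A, (M (ρ ω) ω : ℝ≥0∞) ∂P ≤ ∫⁻ ω in A, (M (σ ω) ω : ℝ≥0∞) ∂P := by
  have hAm : MeasurableSet A := hσ.measurableSpace_le _ hA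
  have hρt := NA_stop_meas_const hρ ht
  have hσt := NA_stop_meas_const hσ fun ω => (hσρ ω).trans (ht ω)
  have hmeas : ∀ {κ : Ω → ℝ≥0}, Measurable[ℱ t] κ → ∀ n,
      Measurable (fun ω => (M (NAd n (κ ω)) ω : ℝ≥0∞)) := by
    intro κ hκ n
    have hκ' : Measurable κ := hκ.mono (ℱ.le t) le_rfl
    exact NA_meas_idx (G := fun k ω => (M (NAdt n k) ω : ℝ≥0∞))
      (fun k => ((hM _).mono (ℱ.le _) le_rfl).coe_nnreal_ennreal) (NA_meas_floor hκ' n)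
  have hlim : ∀ (κ : Ω → ℝ≥0), ∀ᵐ ω ∂(P.restrict A),
      Tendsto (fun n => (M (NAd n (κ ω)) ω : ℝ≥0∞)) atTop (𝓝 (M (κ ω) ω : ℝ≥0∞)) := by
    intro κ
    refine Eventually.of_forall fun ω => ENNReal.tendsto_coe.2 ?_
    exact (hMc ω (κ ω)).tendsto.comp ((NAd_tendsto (κ ω)).mono_right
          (nhdsWithin_mono _ fun q hq => mem_Ici.2 (le_of_lt (mem_Ioi.1 hq.1))))
  have hFm : Measurable (fun ω => (M (ρ ω) ω : ℝ≥0∞)) :=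
    ((NA_meas_at hright hM hMc hρt ht).mono (ℱ.le t) le_rfl).coe_nnreal_ennreal
  refine NA_of_min _ hFm fun K => ?_
  refine NA_lim_min (P.restrict A) (hmeas hρt) (hmeas hσt) (ENNReal.natCast_ne_top K) (fun n => ?_)
    (hlim ρ) (hlim σ)
  refine NA_opt_discrete P (𝒢 := fun k => ℱ (NAdt n k)) (fun k => ℱ.le _)
    (G := fun k ω => min (M (NAdt n k) ω : ℝ≥0∞) K) (fun k C hC => ?_)
    (a := fun ω => ⌊σ ω * 2 ^ n⌋₊ + 1) (b := fun ω => ⌊ρ ω * 2 ^ n⌋₊ + 1)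
    (⌊t * 2 ^ n⌋₊ + 1) (fun ω => ?_) (fun ω => ?_) hAm (fun k => ?_)
  · exact NA_min_le (ℱ.le (NAdt n k)) P (hM _).coe_nnreal_ennreal
      (hMs _ _ (NAdt_mono n (Nat.le_succ k))) K C hC
  · have := hσρ ω
    gcongr
  · have := ht ω
    gcongr
  · have e : A ∩ {ω | ⌊σ ω * 2 ^ n⌋₊ + 1 ≤ k ∧ k < ⌊ρ ω * 2 ^ n⌋₊ + 1} =
        (A ∩ {ω | σ ω ≤ NAdt n k}) ∩ {ω | σ ω < NAdt n k} ∩ {ω | ρ ω < NAdt n k}ᶜ := by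
      ext ω
      simp only [mem_inter_iff, mem_ofPred_eq, mem_compl_iff, NA_floor_le, ← not_le (b := k)]
      constructor
      · rintro ⟨h1, h2, h3⟩
        exact ⟨⟨⟨h1, h2.le⟩, h2⟩, h3⟩
      · rintro ⟨⟨⟨h1, _⟩, h2⟩, h3⟩
        exact ⟨h1, h2, h3⟩
    rw [e]
    exact ((NA_stop_inter_le hσ hA _).inter (NA_stop_lt hσ _)).inter (NA_stop_lt hρ _).compl

theorem NA_opt (P : Measure Ω) [IsProbabilityMeasure P] (hright : RightContinuousFiltration ℱ)
    {M : ℝ≥0 → Ω → ℝ≥0} (hM : ∀ t, Measurable[ℱ t] (M t))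
    (hMc : ∀ ω t, ContinuousWithinAt (fun t => M t ω) (Ici t) t)
    (hMs : ∀ s t, s ≤ t → ∀ A, MeasurableSet[ℱ s] A →
      ∫⁻ ω in A, (M t ω : ℝ≥0∞) ∂P ≤ ∫⁻ ω in A, (M s ω : ℝ≥0∞) ∂P)
    {σ ρ : Ω → ℝ≥0} (hσ : IsStoppingTime ℱ (fun ω => (σ ω : WithTop ℝ≥0)))
    (hρ : IsStoppingTime ℱ (fun ω => (ρ ω : WithTop ℝ≥0))) (hσρ : ∀ ω, σ ω ≤ ρ ω)
    {t : ℝ≥0} (ht : ∀ ω, ρ ω ≤ t) {W : Ω → ℝ≥0∞} (hW : Measurable[hσ.measurableSpace] W) :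
    ∫⁻ ω, W ω * (M (ρ ω) ω : ℝ≥0∞) ∂P ≤ ∫⁻ ω, W ω * (M (σ ω) ω : ℝ≥0∞) ∂P := by
  have h1 : ∀ {κ : Ω → ℝ≥0} (hκ : IsStoppingTime ℱ (fun ω => (κ ω : WithTop ℝ≥0)))
      (_ : ∀ ω, κ ω ≤ t), Measurable (fun ω => (M (κ ω) ω : ℝ≥0∞)) := fun hκ hκt =>
    ((NA_meas_at hright hM hMc (NA_stop_meas_const hκ hκt) hκt).mono
      (ℱ.le t) le_rfl).coe_nnreal_ennreal
  exact NA_weight_le hσ.measurableSpace_le P (h1 hρ ht) (h1 hσ fun ω => (hσρ ω).trans (ht ω))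
    (fun A hA => NA_opt_set P hright hM hMc hMs hσ hρ hσρ ht hA) hW

/-- A process evaluated at a stopping time is measurable at that time. -/
theorem NA_meas_stop (hright : RightContinuousFiltration ℱ) {E : Type*} [TopologicalSpace E]
    [TopologicalSpace.PseudoMetrizableSpace E] [MeasurableSpace E] [BorelSpace E]
    {M : ℝ≥0 → Ω → E} (hM : ∀ t, Measurable[ℱ t] (M t))
    (hMc : ∀ ω t, ContinuousWithinAt (fun t => M t ω) (Ici t) t)
    {ρ : Ω → ℝ≥0} (hρ : IsStoppingTime ℱ (fun ω => (ρ ω : WithTop ℝ≥0))) :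
    Measurable[hρ.measurableSpace] (fun ω => M (ρ ω) ω) := by
  intro C hC
  refine NA_stop_of hρ fun u => ?_
  have hmin : IsStoppingTime ℱ (fun ω => ((min (ρ ω) u : ℝ≥0) : WithTop ℝ≥0)) := by
    have := hρ.min_const u
    simpa using this
  have h1 := NA_meas_at hright hM hMc
    (NA_stop_meas_const hmin fun ω => min_le_right _ _) (fun ω => min_le_right _ _)
  have e : (fun ω => M (ρ ω) ω) ⁻¹' C ∩ {ω | ρ ω ≤ u} =
      (fun ω => M (min (ρ ω) u) ω) ⁻¹' C ∩ {ω | ρ ω ≤ u} := by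
    ext ω
    simp only [mem_inter_iff, mem_preimage, mem_ofPred_eq]
    constructor
    · rintro ⟨h, h'⟩
      rw [min_eq_left h']
      exact ⟨h, h'⟩
    · rintro ⟨h, h'⟩
      rw [min_eq_left h'] at h
      exact ⟨h, h'⟩
  rw [e]
  exact (h1 hC).inter (NA_stop_le hρ u)

/-- Cutting down to `τ ≤ σ` turns time-`τ` weights into time-`σ` weights. -/
theorem NA_indicator_stop {τ σ : Ω → ℝ≥0}
    (hτ : IsStoppingTime ℱ (fun ω => (τ ω : WithTop ℝ≥0)))
    (hσ : IsStoppingTime ℱ (fun ω => (σ ω : WithTop ℝ≥0)))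
    {A : Set Ω} (hA : MeasurableSet[hσ.measurableSpace] A)
    {f : Ω → ℝ≥0∞} (hf : Measurable[hτ.measurableSpace] f) :
    Measurable[hσ.measurableSpace] ((A ∩ {ω | τ ω ≤ σ ω}).indicator f) := by
  have hset : ∀ C, MeasurableSet[hτ.measurableSpace] C →
      MeasurableSet[hσ.measurableSpace] (C ∩ {ω | τ ω ≤ σ ω}) := by
    intro C hC
    have h1 := IsStoppingTime.measurableSet_inter_le hτ hσ C hC
    have h2 := IsStoppingTime.measurableSpace_mono (hτ.min hσ) hσ (fun ω => min_le_right _ _) _ h1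
    have e : {ω | τ ω ≤ σ ω} = {ω | (τ ω : WithTop ℝ≥0) ≤ σ ω} :=
      by ext ω; simp only [mem_ofPred_eq, WithTop.coe_le_coe]
    rw [e]
    exact h2
  refine @measurable_of_Ioi _ _ _ _ _ hσ.measurableSpace _ _ _ _ fun c => ?_
  have e : ((A ∩ {ω | τ ω ≤ σ ω}).indicator f) ⁻¹' Ioi c =
      A ∩ (f ⁻¹' Ioi c ∩ {ω | τ ω ≤ σ ω}) := by
    ext ω
    simp only [mem_preimage, mem_Ioi, mem_inter_iff, mem_ofPred_eq, indicator]
    split_ifs with h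
    · exact ⟨fun h' => ⟨h.1, h', h.2⟩, fun h' => h'.2.1⟩
    · exact ⟨fun h' => absurd h' not_lt_zero, fun h' => absurd ⟨h'.1, h'.2.2⟩ h⟩
  rw [e]
  exact hA.inter (hset _ (hf measurableSet_Ioi))
end
end

noncomputable section
open MeasureTheory Set Filter
open scoped NNReal ENNReal Topology

section
variable {Ω : Type*} {m : MeasurableSpace Ω} {ℱ : Filtration ℝ≥0 m} {d : ℕ}
  {S : ℝ≥0 → Ω → Fin d → ℝ} {x : ℝ}

theorem NA_tau_mono (θ : SimpleStrategy ℱ d) (ω : Ω) {j k : ℕ} (h : j ≤ k) : θ.τ j ω ≤ θ.τ k ω :=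
  monotone_nat_of_le_succ (fun j => θ.τ_mono j ω) h

theorem NA_wealth_seg (θ : SimpleStrategy ℱ d) (S : ℝ≥0 → Ω → Fin d → ℝ) (x : ℝ)
    {j : ℕ} (hj : j < θ.n) {u : ℝ≥0} {ω : Ω}
    (h1 : θ.τ j ω ≤ u) (h2 : u ≤ θ.τ (j + 1) ω) :
    θ.wealth S x u ω = θ.wealth S x (θ.τ j ω) ω +
      ∑ i, θ.ϑ j ω i * (S u ω i - S (θ.τ j ω) ω i) := by
  have e : θ.wealth S x u ω - θ.wealth S x (θ.τ j ω) ω =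
      ∑ i, θ.ϑ j ω i * (S u ω i - S (θ.τ j ω) ω i) := by
    unfold SimpleStrategy.wealth
    rw [add_sub_add_left_eq_sub, ← Finset.sum_sub_distrib]
    rw [Finset.sum_eq_single j]
    · have h3 := θ.τ_mono j ω
      rw [min_eq_right h2, min_eq_left h1, min_eq_right h3, min_self]
      simp
    · intro k _ hkj
      rcases lt_or_gt_of_ne hkj with h | h
      · have a1 : θ.τ (k + 1) ω ≤ θ.τ j ω := NA_tau_mono θ ω h
        have a2 : θ.τ k ω ≤ θ.τ j ω := NA_tau_mono θ ω h.le
        rw [min_eq_left (a1.trans h1), min_eq_left (a2.trans h1), min_eq_left a1, min_eq_left a2,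
          sub_self]
      · have a1 : θ.τ (j + 1) ω ≤ θ.τ (k + 1) ω := NA_tau_mono θ ω (by omega)
        have a2 : θ.τ (j + 1) ω ≤ θ.τ k ω := NA_tau_mono θ ω h
        rw [min_eq_right (h2.trans a1), min_eq_right (h2.trans a2),
          min_eq_right (h1.trans (h2.trans a1)), min_eq_right (h1.trans (h2.trans a2))]
        simp
    · intro h
      exact absurd (Finset.mem_range.2 hj) h
  linarith

theorem NA_wealth_end (θ : SimpleStrategy ℱ d) (S : ℝ≥0 → Ω → Fin d → ℝ) (x : ℝ) {u : ℝ≥0} {ω : Ω}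
    (h1 : θ.τ θ.n ω ≤ u) : θ.wealth S x u ω = θ.wealth S x (θ.τ θ.n ω) ω := by
  unfold SimpleStrategy.wealth
  congr 1
  refine Finset.sum_congr rfl fun k hk => ?_
  have hk := Finset.mem_range.1 hk
  have a1 : θ.τ (k + 1) ω ≤ θ.τ θ.n ω := NA_tau_mono θ ω hk
  have a2 : θ.τ k ω ≤ θ.τ θ.n ω := NA_tau_mono θ ω hk.le
  rw [min_eq_left (a1.trans h1), min_eq_left (a2.trans h1), min_eq_left a1, min_eq_left a2]

theorem NA_wealth_zero (θ : SimpleStrategy ℱ d) (S : ℝ≥0 → Ω → Fin d → ℝ) (x : ℝ) (ω : Ω) :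
    θ.wealth S x 0 ω = x := by
  unfold SimpleStrategy.wealth
  simp

theorem NA_wealth_nonneg (θ : SimpleStrategy ℱ d) (hS : ∀ t ω i, 0 ≤ S t ω i) (hx : 0 ≤ x) {ω : Ω}
    (h : ∀ j < θ.n, (∀ i, 0 ≤ θ.ϑ j ω i) ∧
      ∑ i, θ.ϑ j ω i * S (θ.τ j ω) ω i ≤ θ.wealth S x (θ.τ j ω) ω) (u : ℝ≥0) :
    0 ≤ θ.wealth S x u ω := by
  have seg : ∀ j < θ.n, ∀ u, θ.τ j ω ≤ u → u ≤ θ.τ (j + 1) ω → 0 ≤ θ.wealth S x u ω := by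
    intro j hj u h1 h2
    rw [NA_wealth_seg θ S x hj h1 h2]
    have h3 := (h j hj).2
    have h4 : 0 ≤ ∑ i, θ.ϑ j ω i * S u ω i :=
      Finset.sum_nonneg fun i _ => mul_nonneg ((h j hj).1 i) (hS _ _ _)
    simp only [mul_sub, Finset.sum_sub_distrib]
    linarith
  have upto : ∀ j ≤ θ.n, ∀ u, u ≤ θ.τ j ω → 0 ≤ θ.wealth S x u ω := by
    intro j
    induction j with
    | zero =>
      intro _ u hu
      rw [θ.τ_zero] at hu
      rw [le_zero_iff.1 hu, NA_wealth_zero]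
      exact hx
    | succ j ih =>
      intro hj u hu
      rcases le_total u (θ.τ j ω) with h1 | h1
      · exact ih (by omega) u h1
      · exact seg j hj u h1 hu
  rcases le_total u (θ.τ θ.n ω) with h1 | h1
  · exact upto _ le_rfl u h1
  · rw [NA_wealth_end θ S x h1]
    exact upto _ le_rfl _ le_rfl

theorem NA_stop_min {τ : Ω → ℝ≥0} (hτ : IsStoppingTime ℱ (fun ω => (τ ω : WithTop ℝ≥0))) (t : ℝ≥0) :
    IsStoppingTime ℱ (fun ω => ((min (τ ω) t : ℝ≥0) : WithTop ℝ≥0)) := by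
  have h := hτ.min_const t
  simpa using h

theorem NA_stop_max {τ : Ω → ℝ≥0} (hτ : IsStoppingTime ℱ (fun ω => (τ ω : WithTop ℝ≥0))) (s : ℝ≥0) :
    IsStoppingTime ℱ (fun ω => ((max s (τ ω) : ℝ≥0) : WithTop ℝ≥0)) := by
  have h := hτ.max_const s
  have e : (fun ω => ((max s (τ ω) : ℝ≥0) : WithTop ℝ≥0)) =
      fun ω => max (τ ω : WithTop ℝ≥0) (s : WithTop ℝ≥0) := by
    funext ω
    rw [WithTop.coe_max, max_comm]
  rw [e]
  exact h

theorem NA_wealth_meas (hright : RightContinuousFiltration ℱ) (hSa : StronglyAdapted ℱ S)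
    (hSc : ∀ ω, IsCadlag (fun t => S t ω)) (θ : SimpleStrategy ℱ d) (x : ℝ) (t : ℝ≥0) :
    Measurable[ℱ t] (θ.wealth S x t) := by
  have hSm : ∀ t, Measurable[ℱ t] (S t) := fun t => (hSa t).measurable
  have hst : ∀ j, Measurable[ℱ t] (fun ω => S (min (θ.τ j ω) t) ω) := fun j =>
    NA_meas_at hright hSm (fun ω t => (hSc ω).1 t)
      (NA_stop_meas_const (NA_stop_min (θ.τ_stopping j) t) fun ω => min_le_right _ _)
      (fun ω => min_le_right _ _)
  have hsti : ∀ j i, Measurable[ℱ t] (fun ω => S (min (θ.τ j ω) t) ω i) := fun j i =>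
    (measurable_pi_apply i).comp (hst j)
  have hθ : ∀ j i, Measurable[ℱ t] ({ω | θ.τ j ω ≤ t}.indicator fun ω => θ.ϑ j ω i) := by
    intro j i
    have h1 : Measurable[(θ.τ_stopping j).measurableSpace] (fun ω => θ.ϑ j ω i) :=
      (measurable_pi_apply i).comp (θ.ϑ_meas j)
    intro C hC
    have e : ({ω | θ.τ j ω ≤ t}.indicator fun ω => θ.ϑ j ω i) ⁻¹' C =
        ((fun ω => θ.ϑ j ω i) ⁻¹' C ∩ {ω | θ.τ j ω ≤ t}) ∪
          ({ω | θ.τ j ω ≤ t}ᶜ ∩ {_ω | (0:ℝ) ∈ C}) := by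
      ext ω
      by_cases h : θ.τ j ω ≤ t <;> simp [indicator, h]
    rw [e]
    exact (NA_stop_inter_le (θ.τ_stopping j) (h1 hC) t).union
      ((NA_stop_le (θ.τ_stopping j) t).compl.inter (@MeasurableSet.const _ (ℱ t) _))
  have e : θ.wealth S x t = fun ω => x + ∑ j ∈ Finset.range θ.n, ∑ i,
      {ω | θ.τ j ω ≤ t}.indicator (fun ω => θ.ϑ j ω i) ω *
        (S (min (θ.τ (j + 1) ω) t) ω i - S (min (θ.τ j ω) t) ω i) := by
    funext ω
    unfold SimpleStrategy.wealth
    congr 1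
    refine Finset.sum_congr rfl fun j _ => Finset.sum_congr rfl fun i _ => ?_
    by_cases h : θ.τ j ω ≤ t
    · simp [indicator, h]
    · have h' := (not_le.1 h).le
      rw [min_eq_right h', min_eq_right (h'.trans (θ.τ_mono j ω))]
      simp
  rw [e]
  refine Measurable.const_add ?_ x
  refine Finset.measurable_sum _ fun j _ => ?_
  refine Finset.measurable_sum _ fun i _ => ?_
  exact Measurable.mul (hθ j i)
    (Measurable.sub (hsti (j+1) i) (hsti j i))

theorem NA_wealth_rc (hSc : ∀ ω, IsCadlag (fun t => S t ω)) (θ : SimpleStrategy ℱ d) (x : ℝ) (ω : Ω)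
    (t : ℝ≥0) : ContinuousWithinAt (fun t => θ.wealth S x t ω) (Ici t) t := by
  have h : ∀ (r : ℝ≥0) i, ContinuousWithinAt (fun t => S (min r t) ω i) (Ici t) t := by
    intro r i
    have h1 : ContinuousWithinAt (fun t => S t ω i) (Ici (min r t)) (min r t) :=
      (continuousWithinAt_pi.1 ((hSc ω).1 (min r t))) i
    have h2 : ContinuousWithinAt (fun t => min r t) (Ici t) t :=
      (continuous_const.min continuous_id).continuousWithinAt
    exact ContinuousWithinAt.comp (t := Ici (min r t)) h1 h2
      (fun u hu => mem_Ici.2 (min_le_min_left r (mem_Ici.1 hu)))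
  unfold SimpleStrategy.wealth
  refine continuousWithinAt_const.add ?_
  refine tendsto_finsetSum _ (fun j _ => ?_)
  refine tendsto_finsetSum _ (fun i _ => ?_)
  exact continuousWithinAt_const.mul ((h _ i).sub (h _ i))
end
end

noncomputable section
open MeasureTheory Set Filter
open scoped NNReal ENNReal Topology

section
variable {Ω : Type*} {m : MeasurableSpace Ω} {ℱ : Filtration ℝ≥0 m} {d : ℕ}
  {S : ℝ≥0 → Ω → Fin d → ℝ} {x : ℝ}

theorem NAB_rc (hSc : ∀ ω, IsCadlag (fun t => S t ω)) (i : Option (Fin d)) (ω : Ω) (t : ℝ≥0) :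
    ContinuousWithinAt (fun t => NAB S t i ω) (Ici t) t := by
  cases i with
  | none => exact continuousWithinAt_const
  | some i =>
    have h1 : ContinuousWithinAt (fun t => S t ω i) (Ici t) t :=
      (continuousWithinAt_pi.1 ((hSc ω).1 t)) i
    exact continuous_real_toNNReal.continuousAt.comp_continuousWithinAt h1

theorem NA_stop_ge {σ : Ω → ℝ≥0} (hσ : IsStoppingTime ℱ (fun ω => (σ ω : WithTop ℝ≥0))) {s : ℝ≥0}
    (hs : ∀ ω, s ≤ σ ω) {A : Set Ω} (hA : MeasurableSet[ℱ s] A) :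
    MeasurableSet[hσ.measurableSpace] A := by
  refine NA_stop_of hσ fun u => ?_
  by_cases h : s ≤ u
  · exact (ℱ.mono h _ hA).inter (NA_stop_le hσ u)
  · have e : A ∩ {ω | σ ω ≤ u} = ∅ := by
      ext ω
      simp only [mem_inter_iff, mem_ofPred_eq, mem_empty_iff_false, iff_false, not_and]
      exact fun _ h' => h ((hs ω).trans h')
    rw [e]
    exact @MeasurableSet.empty _ (ℱ u)

theorem NA_seg (P : Measure Ω) [IsProbabilityMeasure P] (hright : RightContinuousFiltration ℱ)
    (hSa : StronglyAdapted ℱ S) (hSc : ∀ ω, IsCadlag (fun t => S t ω))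
    (hSn : ∀ t ω i, 0 ≤ S t ω i)
    {Y : ℝ≥0 → Ω → ℝ≥0} (hYm : ∀ t, Measurable[ℱ t] (Y t)) (hYc : ∀ ω, IsCadlag (fun t => Y t ω))
    (hYs : ∀ i s t, s ≤ t → ∀ A, MeasurableSet[ℱ s] A →
      ∫⁻ ω in A, ((NAB S t i ω * Y t ω : ℝ≥0) : ℝ≥0∞) ∂P ≤
        ∫⁻ ω in A, ((NAB S s i ω * Y s ω : ℝ≥0) : ℝ≥0∞) ∂P)
    (θ : SimpleStrategy ℱ d) (hadm : θ.Admissible P S x)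
    {s t : ℝ≥0} (hst : s ≤ t) {A : Set Ω} (hA : MeasurableSet[ℱ s] A) {j : ℕ} (hj : j < θ.n) :
    ∫⁻ ω in A, ENNReal.ofReal (θ.wealth S x (max s (min (θ.τ (j + 1) ω) t)) ω) *
        Y (max s (min (θ.τ (j + 1) ω) t)) ω ∂P ≤
      ∫⁻ ω in A, ENNReal.ofReal (θ.wealth S x (max s (min (θ.τ j ω) t)) ω) *
        Y (max s (min (θ.τ j ω) t)) ω ∂P := by
  set σ : ℕ → Ω → ℝ≥0 := fun k ω => max s (min (θ.τ k ω) t) with hσdef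
  change ∫⁻ ω in A, ENNReal.ofReal (θ.wealth S x (σ (j + 1) ω) ω) * Y (σ (j + 1) ω) ω ∂P ≤
    ∫⁻ ω in A, ENNReal.ofReal (θ.wealth S x (σ j ω) ω) * Y (σ j ω) ω ∂P
  have hσs : ∀ k, IsStoppingTime ℱ (fun ω => (σ k ω : WithTop ℝ≥0)) := fun k =>
    NA_stop_max (NA_stop_min (θ.τ_stopping k) t) s
  have hσt : ∀ k ω, σ k ω ≤ t := fun k ω => max_le hst (min_le_right _ _)
  have hsσ : ∀ k ω, s ≤ σ k ω := fun k ω => le_max_left _ _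
  have hσm : ∀ ω, σ j ω ≤ σ (j + 1) ω := fun ω =>
    max_le_max_left s (min_le_min_right t (θ.τ_mono j ω))
  set H : Set Ω := A ∩ {ω | θ.τ (j + 1) ω < s}ᶜ with hHdef
  have hH : MeasurableSet[(hσs j).measurableSpace] H :=
    NA_stop_ge _ (hsσ j) (hA.inter (NA_stop_lt (θ.τ_stopping (j + 1)) s).compl)
  set E : Set Ω := H ∩ {ω | θ.τ j ω ≤ σ j ω} with hEdef
  have hAm : MeasurableSet A := ℱ.le _ _ hA
  have hEm : MeasurableSet E := by
    have h1 : MeasurableSet {ω | θ.τ j ω ≤ σ j ω} := by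
      have h2 : {ω | θ.τ j ω ≤ σ j ω} = {ω | θ.τ j ω ≤ t} := by
        ext ω
        simp only [mem_ofPred_eq]
        constructor
        · exact fun h => h.trans (hσt j ω)
        · exact fun h => le_max_of_le_right (le_min le_rfl h)
      rw [h2]
      exact ℱ.le _ _ (NA_stop_le (θ.τ_stopping j) t)
    exact ((hσs j).measurableSpace_le _ hH).inter h1
  have hEA : A ∩ E = E := inter_eq_right.2 fun ω hω => hω.1.1
  let a : Ω → ℝ := fun ω => θ.wealth S x (θ.τ j ω) ω - ∑ i, θ.ϑ j ω i * S (θ.τ j ω) ω i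
  have hSm : ∀ t, Measurable[ℱ t] (S t) := fun t => (hSa t).measurable
  have ham : Measurable[(θ.τ_stopping j).measurableSpace] a := by
    refine Measurable.sub (NA_meas_stop hright (NA_wealth_meas hright hSa hSc θ x)
      (fun ω t => NA_wealth_rc hSc θ x ω t) (θ.τ_stopping j)) ?_
    refine Finset.measurable_sum _ fun i _ => ?_
    exact Measurable.mul ((measurable_pi_apply i).comp (θ.ϑ_meas j))
      ((measurable_pi_apply i).comp (NA_meas_stop hright hSm (fun ω t => (hSc ω).1 t)
        (θ.τ_stopping j)))
  let w : Option (Fin d) → Ω → ℝ≥0∞ := fun o ω =>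
    ENNReal.ofReal (o.elim (a ω) (fun i => θ.ϑ j ω i))
  have hw : ∀ o, Measurable[(θ.τ_stopping j).measurableSpace] (w o) := by
    intro o
    cases o with
    | none => exact ENNReal.measurable_ofReal.comp ham
    | some i => exact ENNReal.measurable_ofReal.comp ((measurable_pi_apply i).comp (θ.ϑ_meas j))
  have hW : ∀ o, Measurable[(hσs j).measurableSpace] (E.indicator (w o)) := fun o =>
    NA_indicator_stop (θ.τ_stopping j) (hσs j) hH (hw o)
  have hWm : ∀ o, Measurable (E.indicator (w o)) := fun o =>
    (hW o).mono (hσs j).measurableSpace_le le_rfl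
  have hMm : ∀ o t, Measurable[ℱ t] (fun ω => NAB S t o ω * Y t ω) := fun o t =>
    Measurable.mul (NAB_meas hSa t o) (hYm t)
  have hMc : ∀ o ω t, ContinuousWithinAt (fun t => NAB S t o ω * Y t ω) (Ici t) t := fun o ω t =>
    (NAB_rc hSc o ω t).mul ((hYc ω).1 t)
  have hMk : ∀ o k, Measurable
      (fun ω => ((NAB S (σ k ω) o ω * Y (σ k ω) ω : ℝ≥0) : ℝ≥0∞)) := by
    intro o k
    have h1 := NA_meas_at hright (hMm o) (hMc o) (NA_stop_meas_const (hσs k) (hσt k)) (hσt k)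
    exact (h1.mono (ℱ.le t) le_rfl).coe_nnreal_ennreal
  have rep : ∀ k, (k = j ∨ k = j + 1) →
      ∫⁻ ω in E, ENNReal.ofReal (θ.wealth S x (σ k ω) ω) * Y (σ k ω) ω ∂P =
        ∑ o, ∫⁻ ω, E.indicator (w o) ω *
          ((NAB S (σ k ω) o ω * Y (σ k ω) ω : ℝ≥0) : ℝ≥0∞) ∂P := by
    intro k hk
    have hprod : ∀ o, Measurable (fun ω => E.indicator (w o) ω *
        ((NAB S (σ k ω) o ω * Y (σ k ω) ω : ℝ≥0) : ℝ≥0∞)) := fun o => (hWm o).mul (hMk o k)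
    rw [← lintegral_finsetSum _ fun o _ => hprod o, ← lintegral_indicator hEm]
    refine lintegral_congr_ae ?_
    filter_upwards [hadm j hj] with ω hω
    by_cases hωE : ω ∈ E
    · simp only [indicator_of_mem hωE]
      have b1 : θ.τ j ω ≤ σ j ω := hωE.2
      have b2 : s ≤ θ.τ (j + 1) ω := not_lt.1 hωE.1.2
      have b3 : θ.τ j ω ≤ σ k ω := by
        rcases hk with rfl | rfl
        · exact b1
        · exact b1.trans (hσm ω)
      have b4 : σ k ω ≤ θ.τ (j + 1) ω := by
        refine max_le b2 ((min_le_left _ _).trans (NA_tau_mono θ ω ?_))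
        omega
      have b5 : θ.wealth S x (σ k ω) ω = a ω + ∑ i, θ.ϑ j ω i * S (σ k ω) ω i := by
        rw [NA_wealth_seg θ S x hj b3 b4]
        simp only [mul_sub, Finset.sum_sub_distrib, a]
        ring
      have ha : 0 ≤ a ω := sub_nonneg.2 hω.2
      have b6 : ∀ i, 0 ≤ θ.ϑ j ω i * S (σ k ω) ω i := fun i => mul_nonneg (hω.1 i) (hSn _ _ _)
      rw [b5, ENNReal.ofReal_add ha (Finset.sum_nonneg fun i _ => b6 i),
        ENNReal.ofReal_sum_of_nonneg fun i _ => b6 i, Fintype.sum_option, add_mul, Finset.sum_mul]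
      congr 1
      · simp [w, NAB]
      · refine Finset.sum_congr rfl fun i _ => ?_
        rw [ENNReal.ofReal_mul (hω.1 i), ENNReal.coe_mul, mul_assoc]
        rfl
    · simp [indicator_of_notMem hωE]
  rw [← lintegral_inter_add_sdiff _ A hEm,
    ← lintegral_inter_add_sdiff (fun ω => ENNReal.ofReal (θ.wealth S x (σ j ω) ω) * Y (σ j ω) ω)
      A hEm, hEA]
  refine add_le_add ?_ (le_of_eq (setLIntegral_congr_fun (hAm.diff hEm) fun ω hω => ?_))
  · rw [rep _ (Or.inr rfl), rep _ (Or.inl rfl)]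
    refine Finset.sum_le_sum fun o _ => ?_
    exact NA_opt P hright (hMm o) (hMc o) (hYs o) (hσs j) (hσs (j + 1)) hσm (hσt (j + 1)) (hW o)
  · have e : σ (j + 1) ω = σ j ω := by
      by_cases h1 : θ.τ (j + 1) ω < s
      · simp only [hσdef]
        rw [max_eq_left ((min_le_left _ _).trans h1.le),
          max_eq_left ((min_le_left _ _).trans ((θ.τ_mono j ω).trans h1.le))]
      · have h2 : ¬ θ.τ j ω ≤ σ j ω := fun h => hω.2 ⟨⟨hω.1, h1⟩, h⟩
        have h3 : t ≤ θ.τ j ω := by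
          by_contra h4
          exact h2 (le_max_of_le_right (le_min le_rfl (not_le.1 h4).le))
        simp only [hσdef]
        rw [min_eq_right h3, min_eq_right (h3.trans (θ.τ_mono j ω))]
    simp only [e]

theorem NA_key (P : Measure Ω) [IsProbabilityMeasure P] (hright : RightContinuousFiltration ℱ)
    (hSa : StronglyAdapted ℱ S) (hSc : ∀ ω, IsCadlag (fun t => S t ω))
    (hSn : ∀ t ω i, 0 ≤ S t ω i)
    {Y : ℝ≥0 → Ω → ℝ≥0} (hYm : ∀ t, Measurable[ℱ t] (Y t)) (hYc : ∀ ω, IsCadlag (fun t => Y t ω))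
    (hYs : ∀ i s t, s ≤ t → ∀ A, MeasurableSet[ℱ s] A →
      ∫⁻ ω in A, ((NAB S t i ω * Y t ω : ℝ≥0) : ℝ≥0∞) ∂P ≤
        ∫⁻ ω in A, ((NAB S s i ω * Y s ω : ℝ≥0) : ℝ≥0∞) ∂P)
    (θ : SimpleStrategy ℱ d) (hadm : θ.Admissible P S x)
    {s t : ℝ≥0} (hst : s ≤ t) {A : Set Ω} (hA : MeasurableSet[ℱ s] A) :
    ∫⁻ ω in A, ENNReal.ofReal (θ.wealth S x t ω) * Y t ω ∂P ≤
      ∫⁻ ω in A, ENNReal.ofReal (θ.wealth S x s ω) * Y s ω ∂P := by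
  have hAm : MeasurableSet A := ℱ.le _ _ hA
  have tele : ∀ j ≤ θ.n,
      ∫⁻ ω in A, ENNReal.ofReal (θ.wealth S x (max s (min (θ.τ j ω) t)) ω) *
        Y (max s (min (θ.τ j ω) t)) ω ∂P ≤
      ∫⁻ ω in A, ENNReal.ofReal (θ.wealth S x s ω) * Y s ω ∂P := by
    intro j
    induction j with
    | zero =>
      intro _
      simp [θ.τ_zero]
    | succ j ih =>
      intro hj
      exact (NA_seg P hright hSa hSc hSn hYm hYc hYs θ hadm hst hA hj).trans (ih (by omega))
  refine le_trans ?_ (tele θ.n le_rfl)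
  set σ : Ω → ℝ≥0 := fun ω => max s (min (θ.τ θ.n ω) t) with hσdef
  change _ ≤ ∫⁻ ω in A, ENNReal.ofReal (θ.wealth S x (σ ω) ω) * Y (σ ω) ω ∂P
  have hσs : IsStoppingTime ℱ (fun ω => (σ ω : WithTop ℝ≥0)) :=
    NA_stop_max (NA_stop_min (θ.τ_stopping _) t) s
  have hσt : ∀ ω, σ ω ≤ t := fun ω => max_le hst (min_le_right _ _)
  have hAσ : MeasurableSet[hσs.measurableSpace] A := NA_stop_ge hσs (fun ω => le_max_left _ _) hA
  have hW : Measurable[hσs.measurableSpace]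
      (A.indicator fun ω => ENNReal.ofReal (θ.wealth S x (σ ω) ω)) := by
    refine Measurable.indicator ?_ hAσ
    exact ENNReal.measurable_ofReal.comp (NA_meas_stop hright (NA_wealth_meas hright hSa hSc θ x)
      (fun ω t => NA_wealth_rc hSc θ x ω t) hσs)
  have hYs' : ∀ s t, s ≤ t → ∀ A, MeasurableSet[ℱ s] A →
      ∫⁻ ω in A, (Y t ω : ℝ≥0∞) ∂P ≤ ∫⁻ ω in A, (Y s ω : ℝ≥0∞) ∂P := by
    intro s t h A hA
    simpa [NAB] using hYs none s t h A hA
  have h1 := NA_opt P hright hYm (fun ω t => (hYc ω).1 t) hYs' hσs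
    (isStoppingTime_const ℱ t) hσt (fun _ => le_rfl) hW
  rw [← lintegral_indicator hAm, ← lintegral_indicator hAm]
  refine le_trans (le_of_eq (lintegral_congr fun ω => ?_)) (h1.trans
    (le_of_eq (lintegral_congr fun ω => ?_)))
  · by_cases hω : ω ∈ A
    · simp only [indicator_of_mem hω]
      have e : θ.wealth S x t ω = θ.wealth S x (σ ω) ω := by
        rcases le_total (θ.τ θ.n ω) t with h | h
        · have h2 : θ.τ θ.n ω ≤ σ ω := le_max_of_le_right (le_min le_rfl h)
          rw [NA_wealth_end θ S x h, NA_wealth_end θ S x h2]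
        · have h2 : σ ω = t := by
            simp only [hσdef]
            rw [min_eq_right h, max_eq_right hst]
          rw [h2]
      rw [e]
    · simp [indicator_of_notMem hω]
  · by_cases hω : ω ∈ A
    · simp only [indicator_of_mem hω]
    · simp [indicator_of_notMem hω]

theorem NA_supermart (P : Measure Ω) [IsProbabilityMeasure P] (hright : RightContinuousFiltration ℱ)
    (hSa : StronglyAdapted ℱ S) (hSc : ∀ ω, IsCadlag (fun t => S t ω))
    (hSn : ∀ t ω i, 0 ≤ S t ω i)
    {Y : ℝ≥0 → Ω → ℝ≥0} (hYm : ∀ t, Measurable[ℱ t] (Y t)) (hY0 : ∀ ω, Y 0 ω = 1)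
    (hYc : ∀ ω, IsCadlag (fun t => Y t ω))
    (hYs : ∀ i s t, s ≤ t → ∀ A, MeasurableSet[ℱ s] A →
      ∫⁻ ω in A, ((NAB S t i ω * Y t ω : ℝ≥0) : ℝ≥0∞) ∂P ≤
        ∫⁻ ω in A, ((NAB S s i ω * Y s ω : ℝ≥0) : ℝ≥0∞) ∂P)
    (hx : 0 ≤ x) (θ : SimpleStrategy ℱ d) (hadm : θ.Admissible P S x) :
    Supermartingale (fun t ω => (Y t ω : ℝ) * θ.wealth S x t ω) ℱ P := by
  have hmeas : ∀ t, Measurable[ℱ t] (fun ω => (Y t ω : ℝ) * θ.wealth S x t ω) := fun t =>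
    Measurable.mul (measurable_coe_nnreal_real.comp (hYm t)) (NA_wealth_meas hright hSa hSc θ x t)
  have hmeas' : ∀ t, Measurable (fun ω => (Y t ω : ℝ) * θ.wealth S x t ω) := fun t =>
    (hmeas t).mono (ℱ.le t) le_rfl
  have hnn : ∀ᵐ ω ∂P, ∀ t, 0 ≤ (Y t ω : ℝ) * θ.wealth S x t ω := by
    have h : ∀ᵐ ω ∂P, ∀ j, j < θ.n → (∀ i, 0 ≤ θ.ϑ j ω i) ∧
        ∑ i, θ.ϑ j ω i * S (θ.τ j ω) ω i ≤ θ.wealth S x (θ.τ j ω) ω := by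
      rw [ae_all_iff]
      intro j
      by_cases hj : j < θ.n
      · filter_upwards [hadm j hj] with ω hω _ using hω
      · exact Eventually.of_forall fun ω h => absurd h hj
    filter_upwards [h] with ω hω t
    exact mul_nonneg (NNReal.coe_nonneg _) (NA_wealth_nonneg θ hSn hx hω t)
  have hof : ∀ t ω, ENNReal.ofReal ((Y t ω : ℝ) * θ.wealth S x t ω) =
      ENNReal.ofReal (θ.wealth S x t ω) * Y t ω := by
    intro t ω
    rw [ENNReal.ofReal_mul (NNReal.coe_nonneg _), ENNReal.ofReal_coe_nnreal, mul_comm]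
  have hYXint : ∀ t, Integrable (fun ω => (Y t ω : ℝ) * θ.wealth S x t ω) P := by
    intro t
    refine ⟨(hmeas' t).aestronglyMeasurable, ?_⟩
    rw [hasFiniteIntegral_iff_ofReal (by filter_upwards [hnn] with ω hω using hω t)]
    simp only [hof]
    have h1 := NA_key P hright hSa hSc hSn hYm hYc hYs θ hadm (zero_le : 0 ≤ t)
      (@MeasurableSet.univ _ (ℱ 0))
    simp only [Measure.restrict_univ, NA_wealth_zero, hY0] at h1
    refine lt_of_le_of_lt h1 ?_
    simp
  have hneg : Submartingale (fun t ω => -((Y t ω : ℝ) * θ.wealth S x t ω)) ℱ P := by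
    refine submartingale_of_setIntegral_le (fun t => (hmeas t).neg.stronglyMeasurable)
      (fun t => (hYXint t).neg) fun s t hst A hA => ?_
    rw [integral_neg, integral_neg, neg_le_neg_iff]
    have hr : ∀ u, ∫ ω in A, (Y u ω : ℝ) * θ.wealth S x u ω ∂P =
        (∫⁻ ω in A, ENNReal.ofReal (θ.wealth S x u ω) * Y u ω ∂P).toReal := by
      intro u
      rw [integral_eq_lintegral_of_nonneg_ae
        (ae_restrict_of_ae (by filter_upwards [hnn] with ω hω using hω u))
        (hmeas' u).aestronglyMeasurable]
      simp only [hof]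
    rw [hr, hr]
    refine ENNReal.toReal_mono ?_ (NA_key P hright hSa hSc hSn hYm hYc hYs θ hadm hst hA)
    have h2 := (hYXint s).integrableOn (s := A)
    have h3 := (hasFiniteIntegral_iff_ofReal (ae_restrict_of_ae
      (by filter_upwards [hnn] with ω hω using hω s))).1 h2.2
    simp only [hof] at h3
    exact h3.ne
  have h := hneg.neg
  have e : (-fun t ω => -((Y t ω : ℝ) * θ.wealth S x t ω)) =
      fun t ω => (Y t ω : ℝ) * θ.wealth S x t ω := by
    funext t ω
    simp
  rwa [e] at h
end
end

/-- **Theorem 2.3, (i) ⇒ (ii).** If condition NA1_s holds then `𝒴_s ≠ ∅`: there is an adapted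
càdlàg process `Y` with `P[Y_0 = 1 and Y_t > 0 for all t] = 1` such that `Y·X` is a
supermartingale for every `X ∈ 𝒳_s`. -/
theorem na1s_implies_deflator_exists
    {Ω : Type*} {m : MeasurableSpace Ω} (P : MeasureTheory.Measure Ω)
    [MeasureTheory.IsProbabilityMeasure P] (ℱ : MeasureTheory.Filtration ℝ≥0 m)
    (hright : RightContinuousFiltration ℱ) (hcompl : CompleteFiltration ℱ P)
    (d : ℕ) (S : ℝ≥0 → Ω → Fin d → ℝ)
    (hS_adapted : MeasureTheory.StronglyAdapted ℱ S)
    (hS_cadlag : ∀ ω, IsCadlag (fun t => S t ω))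
    (hS_nonneg : ∀ t ω i, 0 ≤ S t ω i)
    (hNA1 : NA1s P ℱ S) :
    Ys P ℱ S ≠ ∅ := by
  obtain ⟨Z, hZ, hZB⟩ := NA_exists_Z (ℱ := ℱ) (B := NAB S) P (NAB_meas hS_adapted) none
    (fun _ _ => rfl) (fun T _ A hA hn => NA_of_NA1s P hS_nonneg hNA1 T A hA hn)
  have hZm : ∀ s ∈ NAD, Measurable[ℱ s] (Z s) := fun s hs => (hZ s hs).1
  have hgood : ∀ᵐ ω ∂P, NAGood (fun q => Z q ω) := by
    refine NA_paths P hZm (hZ 0 zero_mem_NAD).2.1 (fun s hs => (hZ s hs).2.2) ?_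
    intro s hs t ht hst A hA
    simpa [NAB] using hZB s hs t ht hst none A hA
  obtain ⟨Y, hYm, hY0, hYpos, hYc, hYs⟩ := NA_exists_Y P hright hcompl (NAB_meas hS_adapted)
    (NAB_rc hS_cadlag) hZm hZB hgood
  refine Set.Nonempty.ne_empty ⟨fun t ω => (Y t ω : ℝ), ?_, ?_, ?_, ?_⟩
  · exact fun t => (measurable_coe_nnreal_real.comp (hYm t)).stronglyMeasurable
  · intro ω
    refine ⟨fun t => ?_, fun t ht => ?_⟩
    · exact NNReal.continuous_coe.continuousAt.comp_continuousWithinAt ((hYc ω).1 t)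
    · obtain ⟨l, hl⟩ := (hYc ω).2 t ht
      exact ⟨(l : ℝ), (NNReal.continuous_coe.tendsto l).comp hl⟩
  · exact Eventually.of_forall fun ω => ⟨by simp [hY0 ω], fun t => NNReal.coe_pos.2 (hYpos t ω)⟩
  · rintro X ⟨x, hx, θ, hadm, rfl⟩
    exact NA_supermart P hright hS_adapted hS_cadlag hS_nonneg hYm hY0 hYc hYs hx θ hadm

end
end

section
/- If 𝒴_s ≠ ∅, then condition NA1_s holds; more precisely, if there exists Y ∈ 𝒴_s, then for every T ∈ [0,∞) one has sup_{X ∈ 𝒳_s(1)} E[Y_T X_T] ≤ 1, the set {X_T : X ∈ 𝒳_s(1)} is bounded in probability, and there is no arbitrage of the first kind on [0,T]. -/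
open MeasureTheory Set Filter
open scoped NNReal ENNReal Topology

noncomputable section

variable {Ω : Type*} {m : MeasurableSpace Ω}

theorem wealth_at_zero {Ω : Type*} {m : MeasurableSpace Ω} {ℱ : MeasureTheory.Filtration ℝ≥0 m}
    {d : ℕ} (θ : SimpleStrategy ℱ d) (S : ℝ≥0 → Ω → Fin d → ℝ) (x : ℝ) (ω : Ω) :
    θ.wealth S x 0 ω = x := by
  simp [SimpleStrategy.wealth]

theorem wealth_nonneg_path {Ω : Type*} {m : MeasurableSpace Ω}
    {ℱ : MeasureTheory.Filtration ℝ≥0 m}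
    {d : ℕ} (θ : SimpleStrategy ℱ d) (S : ℝ≥0 → Ω → Fin d → ℝ)
    (hS : ∀ t ω i, 0 ≤ S t ω i) (x : ℝ) (hx : 0 ≤ x) (ω : Ω)
    (hadm : ∀ j < θ.n, (∀ i, 0 ≤ θ.ϑ j ω i) ∧
      ∑ i, θ.ϑ j ω i * S (θ.τ j ω) ω i ≤ θ.wealth S x (θ.τ j ω) ω) (t : ℝ≥0) :
    0 ≤ θ.wealth S x t ω := by
  have hmono : Monotone (fun j => θ.τ j ω) := monotone_nat_of_le_succ (fun j => θ.τ_mono j ω)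
  have key : ∀ k ≤ θ.n, 0 ≤ x + ∑ j ∈ Finset.range k, ∑ i, θ.ϑ j ω i *
      (S (min (θ.τ (j + 1) ω) t) ω i - S (min (θ.τ j ω) t) ω i) := by
    intro k
    induction k with
    | zero => intro _; simpa using hx
    | succ k ih =>
      intro hk
      rw [Finset.sum_range_succ]
      rcases le_total t (θ.τ k ω) with h | h
      · have h2 : t ≤ θ.τ (k + 1) ω := h.trans (θ.τ_mono k ω)
        simp only [min_eq_right h, min_eq_right h2, sub_self, mul_zero, Finset.sum_const_zero,
          add_zero]
        exact ih (by omega)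
      · obtain ⟨h0, h1⟩ := hadm k (by omega)
        have e1 : θ.wealth S x (θ.τ k ω) ω = x + ∑ j ∈ Finset.range k, ∑ i, θ.ϑ j ω i *
            (S (min (θ.τ (j + 1) ω) t) ω i - S (min (θ.τ j ω) t) ω i) := by
          unfold SimpleStrategy.wealth
          congr 1
          rw [← Finset.sum_subset (Finset.range_mono (show k ≤ θ.n by omega))]
          · refine Finset.sum_congr rfl fun j hj => ?_
            have hj' := Finset.mem_range.1 hj
            have a1 : θ.τ (j + 1) ω ≤ θ.τ k ω := hmono (by omega)
            have a2 : θ.τ j ω ≤ θ.τ k ω := hmono (by omega)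
            rw [min_eq_left a1, min_eq_left a2, min_eq_left (a1.trans h), min_eq_left (a2.trans h)]
          · intro j _ hj
            have hj' : k ≤ j := by simpa using hj
            have a1 : θ.τ k ω ≤ θ.τ (j + 1) ω := hmono (by omega)
            have a2 : θ.τ k ω ≤ θ.τ j ω := hmono (by omega)
            simp [min_eq_right a1, min_eq_right a2]
        rw [← add_assoc, ← e1]
        rw [min_eq_left h]
        simp only [mul_sub, Finset.sum_sub_distrib]
        have h3 : 0 ≤ ∑ i, θ.ϑ k ω i * S (min (θ.τ (k + 1) ω) t) ω i :=
          Finset.sum_nonneg fun i _ => mul_nonneg (h0 i) (hS _ _ _)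
        linarith
  exact key θ.n le_rfl

theorem Xs_basic {Ω : Type*} {m : MeasurableSpace Ω} (P : MeasureTheory.Measure Ω)
    [MeasureTheory.IsProbabilityMeasure P] (ℱ : MeasureTheory.Filtration ℝ≥0 m)
    (d : ℕ) (S : ℝ≥0 → Ω → Fin d → ℝ)
    (hS_nonneg : ∀ t ω i, 0 ≤ S t ω i)
    (Y : ℝ≥0 → Ω → ℝ) (hY : Y ∈ Ys P ℱ S) (T : ℝ≥0) (x : ℝ) (hx : 0 ≤ x)
    (X : ℝ≥0 → Ω → ℝ) (hX : X ∈ Xs P ℱ S x) :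
    (∀ᵐ ω ∂P, 0 ≤ X T ω) ∧ Integrable (fun ω => Y T ω * X T ω) P ∧
      ∫ ω, Y T ω * X T ω ∂P ≤ x := by
  obtain ⟨_, _, hpos, hsup⟩ := hY
  have hs := hsup X ⟨x, hx, hX⟩
  obtain ⟨θ, hadm, rfl⟩ := hX
  refine ⟨?_, hs.integrable T, ?_⟩
  · have : ∀ᵐ ω ∂P, ∀ j, j < θ.n → (∀ i, 0 ≤ θ.ϑ j ω i) ∧
      ∑ i, θ.ϑ j ω i * S (θ.τ j ω) ω i ≤ θ.wealth S x (θ.τ j ω) ω := by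
      rw [ae_all_iff]
      intro j
      by_cases hj : j < θ.n
      · filter_upwards [hadm j hj] with ω hω _ using hω
      · exact Eventually.of_forall fun ω h => absurd h hj
    filter_upwards [this] with ω hω
    exact wealth_nonneg_path θ S hS_nonneg x hx ω hω T
  · have h := hs.setIntegral_le (zero_le (a := T)) (s := univ) MeasurableSet.univ
    simp only [Measure.restrict_univ] at h
    refine h.trans (le_of_eq ?_)
    have : (fun ω => Y 0 ω * θ.wealth S x 0 ω) =ᵐ[P] fun _ => x := by
      filter_upwards [hpos] with ω hω
      rw [wealth_at_zero, hω.1, one_mul]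
    rw [integral_congr_ae this]
    simp

/-- **Theorem 2.3, (ii) ⇒ (i).** If `Y ∈ 𝒴_s` then, for every `T`:
`E[Y_T X_T] ≤ 1` for all `X ∈ 𝒳_s(1)`, the set `{X_T : X ∈ 𝒳_s(1)}` is bounded in
probability, and there is no arbitrage of the first kind on `[0, T]`. -/
theorem deflator_implies_na1s
    {Ω : Type*} {m : MeasurableSpace Ω} (P : MeasureTheory.Measure Ω)
    [MeasureTheory.IsProbabilityMeasure P] (ℱ : MeasureTheory.Filtration ℝ≥0 m)
    (hright : RightContinuousFiltration ℱ) (hcompl : CompleteFiltration ℱ P)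
    (d : ℕ) (S : ℝ≥0 → Ω → Fin d → ℝ)
    (hS_adapted : MeasureTheory.StronglyAdapted ℱ S)
    (hS_cadlag : ∀ ω, IsCadlag (fun t => S t ω))
    (hS_nonneg : ∀ t ω i, 0 ≤ S t ω i)
    (Y : ℝ≥0 → Ω → ℝ) (hY : Y ∈ Ys P ℱ S) :
    ∀ T : ℝ≥0,
      (∀ X ∈ Xs P ℱ S 1, ∫ ω, Y T ω * X T ω ∂P ≤ 1) ∧
      BddInProb P ((fun X : ℝ≥0 → Ω → ℝ => X T) '' Xs P ℱ S 1) ∧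
      ∀ ξ : Ω → ℝ, ¬ ArbitrageOfFirstKind P ℱ S T ξ := by
  intro T
  have hb := fun x hx => Xs_basic P ℱ d S hS_nonneg Y hY T x hx
  have hYm : Measurable (Y T) := ((hY.1 T).mono (ℱ.le T)).measurable
  have hYpos : ∀ᵐ ω ∂P, 0 < Y T ω := by
    filter_upwards [hY.2.2.1] with ω hω using hω.2 T
  refine ⟨fun X hX => (hb 1 zero_le_one X hX).2.2, ?_, ?_⟩
  · unfold BddInProb
    have hlim : Tendsto (fun n : ℕ => P {ω | Y T ω ≤ 1 / ((n : ℝ) + 1)}) atTop (𝓝 0) := by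
      have h0 : P (⋂ n : ℕ, {ω | Y T ω ≤ 1 / ((n : ℝ) + 1)}) = 0 := by
        refine measure_mono_null ?_ (ae_iff.1 hYpos)
        intro ω hω
        simp only [mem_iInter, mem_ofPred_eq] at hω
        simp only [mem_ofPred_eq, not_lt]
        exact ge_of_tendsto' tendsto_one_div_add_atTop_nhds_zero_nat hω
      rw [← h0]
      refine tendsto_measure_iInter_atTop
        (fun n => (measurableSet_le hYm measurable_const).nullMeasurableSet) ?_
        ⟨0, measure_ne_top _ _⟩
      intro a b hab ω hω
      have hω' : Y T ω ≤ 1 / ((b : ℝ) + 1) := hω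
      exact le_trans hω' (Nat.one_div_le_one_div hab)
    rw [ENNReal.tendsto_nhds_zero]
    intro ε hε
    obtain ⟨n, hn⟩ := ((ENNReal.tendsto_nhds_zero.1 hlim) (ε / 2)
      (ENNReal.half_pos hε.ne')).exists
    set δ : ℝ := 1 / ((n : ℝ) + 1) with hδ
    have hδ0 : 0 < δ := by positivity
    have hlim2 : Tendsto (fun ℓ : ℝ => ENNReal.ofReal ((δ * ℓ)⁻¹)) atTop (𝓝 0) := by
      rw [← ENNReal.ofReal_zero]
      exact ENNReal.tendsto_ofReal
        (tendsto_inv_atTop_zero.comp (tendsto_id.const_mul_atTop hδ0))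
    filter_upwards [(ENNReal.tendsto_nhds_zero.1 hlim2) (ε / 2) (ENNReal.half_pos hε.ne'),
      eventually_gt_atTop (0 : ℝ)] with ℓ hℓ hℓ0
    refine iSup₂_le ?_
    rintro f ⟨X, hX, rfl⟩
    obtain ⟨hX0, hint, hle⟩ := hb 1 zero_le_one X hX
    have hmk : P {ω | δ * ℓ ≤ Y T ω * X T ω} ≤ ENNReal.ofReal ((δ * ℓ)⁻¹) := by
      have hnn : 0 ≤ᵐ[P] fun ω => Y T ω * X T ω := by
        filter_upwards [hX0, hYpos] with ω h1 h2 using mul_nonneg h2.le h1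
      have h := mul_meas_ge_le_integral_of_nonneg hnn hint (δ * ℓ)
      have hp : 0 < δ * ℓ := by positivity
      have h' : P.real {ω | δ * ℓ ≤ Y T ω * X T ω} ≤ (δ * ℓ)⁻¹ := by
        rw [inv_eq_one_div, le_div_iff₀ hp, mul_comm]
        exact h.trans hle
      rw [← ofReal_measureReal]
      exact ENNReal.ofReal_le_ofReal h'
    calc P {ω | ℓ < |X T ω|}
        ≤ P ({ω | Y T ω ≤ δ} ∪ {ω | δ * ℓ ≤ Y T ω * X T ω}) := by
          refine measure_mono_ae ?_
          filter_upwards [hX0] with ω h1 h2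
          have h3 : ℓ < |X T ω| := h2
          rw [abs_of_nonneg h1] at h3
          rcases le_total (Y T ω) δ with h | h
          · exact Or.inl h
          · exact Or.inr (mul_le_mul h h3.le hℓ0.le (hδ0.le.trans h))
      _ ≤ P {ω | Y T ω ≤ δ} + P {ω | δ * ℓ ≤ Y T ω * X T ω} := measure_union_le _ _
      _ ≤ ε / 2 + ε / 2 := add_le_add hn (hmk.trans hℓ)
      _ = ε := ENNReal.add_halves ε
  · rintro ξ ⟨hm, h0, hpos, harb⟩
    have hξm : Measurable ξ := hm.mono (ℱ.le T) le_rfl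
    have hnn : 0 ≤ᵐ[P] fun ω => Y T ω * ξ ω := by
      filter_upwards [h0, hYpos] with ω h1 h2 using mul_nonneg h2.le h1
    have hdom : ∀ x : ℝ, 0 < x → Integrable (fun ω => Y T ω * ξ ω) P ∧
        ∫ ω, Y T ω * ξ ω ∂P ≤ x := by
      intro x hx
      obtain ⟨X, hX, hle⟩ := harb x hx
      obtain ⟨_, hint, hi⟩ := hb x hx.le X hX
      have hl : (fun ω => Y T ω * ξ ω) ≤ᵐ[P] fun ω => Y T ω * X T ω := by
        filter_upwards [hle, hYpos] with ω h1 h2 using mul_le_mul_of_nonneg_left h1 h2.le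
      have hI : Integrable (fun ω => Y T ω * ξ ω) P := by
        refine hint.mono' (hYm.mul hξm).aestronglyMeasurable ?_
        filter_upwards [hl, hnn] with ω h1 h2
        rw [Real.norm_of_nonneg h2]
        exact h1
      exact ⟨hI, (integral_mono_ae hI hint hl).trans hi⟩
    have hz : ∫ ω, Y T ω * ξ ω ∂P = 0 :=
      le_antisymm (le_of_forall_pos_le_add fun x hx => by simpa using (hdom x hx).2)
        (integral_nonneg_of_ae hnn)
    have hz' := (integral_eq_zero_iff_of_nonneg_ae hnn (hdom 1 one_pos).1).1 hz
    refine hpos.ne' ?_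
    have : ∀ᵐ ω ∂P, ¬ 0 < ξ ω := by
      filter_upwards [hz', hYpos] with ω h1 h2 h3
      exact (mul_pos h2 h3).ne' h1
    simpa [ae_iff] using this

end
end
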